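/- Let a be a real number with 0 < a < 1 and δ > 0, and assume there exists M₁ such that for all real M ≥ M₁ the number of rational primes p with M ≤ p ≤ M + M^a is at least δ·M^a / log M. Then for every integer k ≥ 3 there exists a positive integer M₀, depending only on a, δ and k, such that for every real M ≥ M₀ the set of primes in the interval [M, M + M^a] contains an arithmetic progression of length k, i.e. there exist a natural number m and a positive integer d such that m + i·d is prime and M ≤ m + i·d ≤ M + M^a for all i = 0, 1, …, k−1. (Green–Tao theorem for short intervals, conditional strong form.) -/

import Mathlib

/-! ### Averages over finite types -/

/-- The average of a real function over a finite type. -/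
noncomputable def avg {X : Type*} (f : X → ℝ) : ℝ := (∑ᶠ x, f x) / Nat.card X

/-- The indicator of a proposition, as a real number. -/
noncomputable def ind (p : Prop) : ℝ := by classical exact if p then 1 else 0

section Ind

theorem ind_of_true {p : Prop} (h : p) : ind p = 1 := by simp [ind, h]

theorem ind_of_false {p : Prop} (h : ¬ p) : ind p = 0 := by simp [ind, h]

theorem ind_nonneg (p : Prop) : 0 ≤ ind p := by
  by_cases h : p <;> simp [ind, h]

theorem ind_le_one (p : Prop) : ind p ≤ 1 := by
  by_cases h : p <;> simp [ind, h]

theorem ind_mono {p q : Prop} (h : p → q) : ind p ≤ ind q := by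
  by_cases hp : p
  · rw [ind_of_true hp, ind_of_true (h hp)]
  · rw [ind_of_false hp]; exact ind_nonneg q

theorem ind_congr {p q : Prop} (h : p ↔ q) : ind p = ind q := by rw [h]

theorem ind_and (p q : Prop) : ind (p ∧ q) = ind p * ind q := by
  by_cases hp : p <;> by_cases hq : q <;> simp [ind, hp, hq]

theorem ind_not (p : Prop) : ind (¬ p) = 1 - ind p := by
  by_cases hp : p <;> simp [ind, hp]

theorem ind_forall_finset {ι : Type*} (s : Finset ι) (p : ι → Prop) :
    ind (∀ i ∈ s, p i) = ∏ i ∈ s, ind (p i) := by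
  classical
  induction s using Finset.induction_on with
  | empty => simp [ind]
  | insert a s ha ih =>
    rw [Finset.prod_insert ha, ← ih, ← ind_and]
    exact ind_congr (by simp)

theorem ind_forall {ι : Type*} [Fintype ι] (p : ι → Prop) :
    ind (∀ i, p i) = ∏ i, ind (p i) := by
  rw [← ind_forall_finset]; exact ind_congr (by simp)

end Ind

section Avg

variable {X Y Z : Type*}

theorem avg_eq_sum [Fintype X] (f : X → ℝ) : avg f = (∑ x, f x) / Fintype.card X := by
  simp [avg, finsum_eq_sum_of_fintype]

theorem sum_eq_card_mul_avg [Fintype X] [Nonempty X] (f : X → ℝ) :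
    ∑ x, f x = Fintype.card X * avg f := by
  rw [avg_eq_sum]; field_simp

theorem avg_const [Finite X] [Nonempty X] (c : ℝ) : avg (fun _ : X => c) = c := by
  have := Fintype.ofFinite X
  rw [avg_eq_sum]; simp

theorem avg_add [Finite X] (f g : X → ℝ) : avg (fun x => f x + g x) = avg f + avg g := by
  have := Fintype.ofFinite X
  simp only [avg_eq_sum, Finset.sum_add_distrib]; ring

theorem avg_sub [Finite X] (f g : X → ℝ) : avg (fun x => f x - g x) = avg f - avg g := by
  have := Fintype.ofFinite X
  simp only [avg_eq_sum, Finset.sum_sub_distrib]; ring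

theorem avg_neg [Finite X] (f : X → ℝ) : avg (fun x => - f x) = - avg f := by
  have := Fintype.ofFinite X
  simp only [avg_eq_sum, Finset.sum_neg_distrib]; ring

theorem avg_mul_left [Finite X] (c : ℝ) (f : X → ℝ) : avg (fun x => c * f x) = c * avg f := by
  have := Fintype.ofFinite X
  simp only [avg_eq_sum, ← Finset.mul_sum]; ring

theorem avg_mul_right [Finite X] (c : ℝ) (f : X → ℝ) : avg (fun x => f x * c) = avg f * c := by
  have := Fintype.ofFinite X
  simp only [avg_eq_sum, ← Finset.sum_mul]; ring

theorem avg_mono [Finite X] {f g : X → ℝ} (h : ∀ x, f x ≤ g x) : avg f ≤ avg g := by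
  have := Fintype.ofFinite X
  rw [avg_eq_sum, avg_eq_sum]
  gcongr with x
  exact h x

theorem avg_nonneg [Finite X] {f : X → ℝ} (h : ∀ x, 0 ≤ f x) : 0 ≤ avg f := by
  have := Fintype.ofFinite X
  rw [avg_eq_sum]
  have := Finset.sum_nonneg (fun x (_ : x ∈ Finset.univ) => h x)
  positivity

theorem avg_le_of_le [Finite X] [Nonempty X] {f : X → ℝ} {c : ℝ} (h : ∀ x, f x ≤ c) :
    avg f ≤ c := (avg_mono h).trans (avg_const c).le

theorem le_avg_of_le [Finite X] [Nonempty X] {f : X → ℝ} {c : ℝ} (h : ∀ x, c ≤ f x) :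
    c ≤ avg f := (avg_const c).symm.le.trans (avg_mono h)

theorem abs_avg_le [Finite X] (f : X → ℝ) : |avg f| ≤ avg (fun x => |f x|) := by
  have := Fintype.ofFinite X
  rw [avg_eq_sum, avg_eq_sum, abs_div, Nat.abs_cast]
  gcongr
  exact Finset.abs_sum_le_sum_abs _ _

theorem abs_avg_le_of_le [Finite X] [Nonempty X] {f : X → ℝ} {c : ℝ} (h : ∀ x, |f x| ≤ c) :
    |avg f| ≤ c := (abs_avg_le f).trans (avg_le_of_le h)

theorem avg_congr {f g : X → ℝ} (h : ∀ x, f x = g x) : avg f = avg g := by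
  rw [funext h]

theorem avg_equiv (e : X ≃ Y) (f : Y → ℝ) : avg (fun x => f (e x)) = avg f := by
  rw [avg, avg, Nat.card_congr e, finsum_comp_equiv e]

theorem avg_sum [Finite X] {ι : Type*} (s : Finset ι) (f : ι → X → ℝ) :
    avg (fun x => ∑ i ∈ s, f i x) = ∑ i ∈ s, avg (f i) := by
  have := Fintype.ofFinite X
  simp only [avg_eq_sum]
  rw [Finset.sum_comm, Finset.sum_div]

theorem avg_prod [Finite X] [Finite Y] (f : X × Y → ℝ) :
    avg f = avg fun x => avg fun y => f (x, y) := by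
  have := Fintype.ofFinite X
  have := Fintype.ofFinite Y
  simp only [avg_eq_sum, Fintype.sum_prod_type, Fintype.card_prod, ← Finset.sum_div]
  rw [div_div]; push_cast; ring

theorem avg_comm [Finite X] [Finite Y] (f : X → Y → ℝ) :
    (avg fun x => avg fun y => f x y) = avg fun y => avg fun x => f x y := by
  rw [← avg_prod (fun p : X × Y => f p.1 p.2), ← avg_prod (fun p : Y × X => f p.2 p.1),
    ← avg_equiv (Equiv.prodComm X Y)]
  rfl

theorem exists_avg_le [Finite X] [Nonempty X] (f : X → ℝ) : ∃ x, avg f ≤ f x := by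
  by_contra! h
  have := Fintype.ofFinite X
  have h2 : ∑ x, f x < ∑ _x : X, avg f := Finset.sum_lt_sum_of_nonempty Finset.univ_nonempty
    (fun x _ => h x)
  rw [sum_eq_card_mul_avg] at h2
  simp at h2

theorem avg_mul_sq_le [Finite X] (f g : X → ℝ) :
    (avg fun x => f x * g x) ^ 2 ≤ (avg fun x => f x ^ 2) * avg fun x => g x ^ 2 := by
  have := Fintype.ofFinite X
  simp only [avg_eq_sum]
  rw [div_pow, div_mul_div_comm, ← sq]
  gcongr
  exact Finset.sum_mul_sq_le_sq_mul_sq _ _ _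

theorem sq_avg_le [Finite X] [Nonempty X] (f : X → ℝ) :
    (avg f) ^ 2 ≤ avg fun x => f x ^ 2 := by
  have := avg_mul_sq_le (fun _ => 1) f
  simpa [avg_const] using this

/-- Weighted Cauchy–Schwarz for averages. -/
theorem avg_mul_sq_le_weighted [Finite X] (w f : X → ℝ) (hw : ∀ x, 0 ≤ w x) :
    (avg fun x => w x * f x) ^ 2 ≤ avg w * avg fun x => w x * f x ^ 2 := by
  have h := avg_mul_sq_le (fun x => √(w x)) (fun x => √(w x) * f x)
  have e1 : (fun x => √(w x) * (√(w x) * f x)) = fun x => w x * f x := by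
    funext x; rw [← mul_assoc, Real.mul_self_sqrt (hw x)]
  have e2 : (fun x => √(w x) ^ 2) = w := by funext x; rw [Real.sq_sqrt (hw x)]
  have e3 : (fun x => (√(w x) * f x) ^ 2) = fun x => w x * f x ^ 2 := by
    funext x; rw [mul_pow, Real.sq_sqrt (hw x)]
  rwa [e1, e2, e3] at h

theorem avg_sumArrow {ι ι' α : Type*} [Finite ι] [Finite ι'] [Finite α] (f : (ι ⊕ ι' → α) → ℝ) :
    avg f = avg fun x : ι → α => avg fun y : ι' → α => f (Sum.elim x y) := by
  rw [← avg_prod (fun p : (ι → α) × (ι' → α) => f (Sum.elim p.1 p.2)),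
    ← avg_equiv (Equiv.sumArrowEquivProdArrow ι ι' α).symm]
  rfl

theorem avg_mul_avg [Finite X] [Finite Y] (f : X → ℝ) (g : Y → ℝ) :
    avg f * avg g = avg fun x => avg fun y => f x * g y := by
  simp_rw [avg_mul_left, avg_mul_right]

/-- If many points satisfy one of finitely many relations, some relation holds often. -/
theorem exists_frequent {L : Type*} [Finite L] [Finite Y] [Nonempty Y] (R : L → Y → Prop)
    (g : Y → ℝ) (δ : ℝ) (hδ : 0 < δ) (h : ∀ y, δ / 2 ≤ g y → ∃ l, R l y)
    (h1 : ∀ y, g y ≤ 1) (hg : δ ≤ avg g) :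
    ∃ l, δ / 2 / (Nat.card L) ≤ avg fun y => ind (R l y) := by
  have := Fintype.ofFinite L
  by_contra! hc
  have hL : Nonempty L := by
    obtain ⟨y, hy⟩ := exists_avg_le g
    obtain ⟨l, -⟩ := h y (by linarith)
    exact ⟨l⟩
  have h2 : ∀ y, g y - δ / 2 ≤ ∑ l, ind (R l y) := by
    intro y
    have h0 : 0 ≤ ∑ l, ind (R l y) := Finset.sum_nonneg fun l _ => ind_nonneg _
    by_cases hy : δ / 2 ≤ g y
    · obtain ⟨l, hl⟩ := h y hy
      have := Finset.single_le_sum (fun l _ => ind_nonneg (R l y)) (Finset.mem_univ l)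
      rw [ind_of_true hl] at this
      linarith [h1 y]
    · linarith
  have h3 := avg_mono h2
  rw [avg_sub, avg_const, avg_sum] at h3
  have h4 : ∑ l, (avg fun y => ind (R l y)) < ∑ _l : L, δ / 2 / (Nat.card L) :=
    Finset.sum_lt_sum_of_nonempty Finset.univ_nonempty (fun l _ => hc l)
  rw [Finset.sum_const, Finset.card_univ, nsmul_eq_mul, Nat.card_eq_fintype_card,
    mul_div_cancel₀ _ (by positivity)] at h4
  linarith

end Avg

/-! ### More on averages -/

section AvgPi

theorem sum_ind_eq {X : Type*} [Fintype X] (a : X) : ∑ x, ind (a = x) = 1 := by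
  rw [Finset.sum_eq_single a, ind_of_true rfl]
  · intro b _ hb
    exact ind_of_false (Ne.symm hb)
  · simp

theorem avg_pi_prod {n : Type*} [Fintype n] {X : n → Type*} [∀ j, Finite (X j)]
    (f : ∀ j, X j → ℝ) :
    avg (fun x : ∀ j, X j => ∏ j, f j (x j)) = ∏ j, avg (f j) := by
  classical
  have := fun j => Fintype.ofFinite (X j)
  simp only [avg_eq_sum, Finset.prod_div_distrib, Fintype.card_pi]
  rw [Finset.prod_univ_sum, Fintype.piFinset_univ]
  push_cast
  rfl

theorem avg_pi_eval {n P : Type*} [Finite n] [Finite P] [Nonempty P] (i : n) (f : P → ℝ) :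
    avg (fun x : n → P => f (x i)) = avg f := by
  classical
  have := Fintype.ofFinite n
  have h := avg_pi_prod (X := fun _ : n => P) (fun j p => if j = i then f p else 1)
  have h1 : ∀ j, avg (fun p : P => if j = i then f p else 1) = if j = i then avg f else 1 := by
    intro j
    by_cases hj : j = i <;> simp [hj, avg_const]
  simp_rw [h1] at h
  simpa using h

theorem avg_pi_eval₂ {n P : Type*} [Finite n] [Finite P] [Nonempty P] {i j : n} (hij : i ≠ j)
    (f g : P → ℝ) :
    avg (fun x : n → P => f (x i) * g (x j)) = avg f * avg g := by
  classical
  have := Fintype.ofFinite n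
  have h := avg_pi_prod (X := fun _ : n => P)
    (fun k p => (if k = i then f p else 1) * (if k = j then g p else 1))
  have h1 : ∀ k, avg (fun p : P => (if k = i then f p else 1) * (if k = j then g p else 1)) =
      (if k = i then avg f else 1) * (if k = j then avg g else 1) := by
    intro k
    by_cases hj : k = i
    · subst hj; simp [hij]
    · by_cases hk : k = j
      · subst hk; simp [hj]
      · simp [hj, hk, avg_const]
  simp_rw [h1, Finset.prod_mul_distrib] at h
  simpa using h

theorem avg_ind_range {C X : Type*} [Finite C] [Finite X] [Nonempty C] (φ : C → X)
    (hφ : φ.Injective) (g : X → ℝ) :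
    (avg fun x => g x * ind (∃ c, φ c = x)) = (Nat.card C / Nat.card X : ℝ) *
      avg fun c => g (φ c) := by
  classical
  have := Fintype.ofFinite C
  have := Fintype.ofFinite X
  rw [avg_eq_sum, avg_eq_sum, Nat.card_eq_fintype_card, Nat.card_eq_fintype_card]
  have h : ∑ x, g x * ind (∃ c, φ c = x) = ∑ c, g (φ c) := by
    rw [← Finset.sum_image (s := Finset.univ) (g := φ) (f := g) (fun a _ b _ h => hφ h)]
    rw [← Finset.sum_subset (Finset.subset_univ (Finset.univ.image φ))]
    · refine Finset.sum_congr rfl fun x hx => ?_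
      rw [ind_of_true (by simpa using hx), mul_one]
    · intro x _ hx
      rw [ind_of_false (by simpa using hx), mul_zero]
  rw [h]
  have : (Fintype.card C : ℝ) ≠ 0 := by
    simp [Fintype.card_ne_zero]
  field_simp

/-- Overwriting the coordinates `j i` of a word by the letters `c i`. -/
noncomputable def overwrite {ι m P : Type*} (j : m → ι) (x : ι → P) (c : m → P) : ι → P :=
  Function.extend j c x

theorem overwrite_apply {ι m P : Type*} {j : m → ι} (hj : j.Injective) (x : ι → P) (c : m → P)
    (i : m) : overwrite j x c (j i) = c i := hj.extend_apply c x i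

theorem overwrite_apply' {ι m P : Type*} {j : m → ι} (x : ι → P) (c : m → P)
    (p : ι) (hp : ¬ ∃ i, j i = p) : overwrite j x c p = x p := Function.extend_apply' c x p hp

theorem avg_overwrite {ι m P : Type*} [Finite ι] [Finite m] [Finite P] [Nonempty P] {j : m → ι}
    (hj : j.Injective) (G : (ι → P) → (m → P) → ℝ) :
    (avg fun x => G x (x ∘ j)) = avg fun x => avg fun c => G (overwrite j x c) c := by
  let σ : (ι → P) × (m → P) → (ι → P) × (m → P) := fun p => (overwrite j p.1 p.2, p.1 ∘ j)
  have hσ : Function.Involutive σ := by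
    rintro ⟨x, c⟩
    simp only [σ, Prod.mk.injEq]
    constructor
    · funext p
      by_cases hp : ∃ i, j i = p
      · obtain ⟨i, rfl⟩ := hp
        rw [overwrite_apply hj]; rfl
      · rw [overwrite_apply' _ _ _ hp, overwrite_apply' _ _ _ hp]
    · funext i
      exact overwrite_apply hj _ _ _
  have h := avg_equiv hσ.toPerm (fun p : (ι → P) × (m → P) => G p.1 (p.1 ∘ j))
  rw [avg_prod, avg_prod] at h
  simp only [avg_const] at h
  rw [← h]
  refine avg_congr fun x => avg_congr fun c => ?_
  show G (overwrite j x c) (overwrite j x c ∘ j) = _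
  congr
  funext i
  exact overwrite_apply hj _ _ _

end AvgPi

/-! ### The resampling lemma -/

section Resample

variable {P K : Type} [Finite P] [Nonempty P] [Finite K] [Nonempty K]

theorem avg_sq_avg_le {B : ℕ} (hB : 0 < B) (w : P → ℝ) (C : ℝ) (h0 : ∀ p, 0 ≤ w p)
    (hC : ∀ p, w p ≤ C) (h1 : avg w = 1) :
    (avg fun x : Fin B → P => (avg fun i => w (x i)) ^ 2) ≤ 1 + C / B := by
  have : Nonempty (Fin B) := ⟨⟨0, hB⟩⟩
  have hpair : ∀ i i' : Fin B, (avg fun x : Fin B → P => w (x i) * w (x i')) ≤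
      1 + C * ind (i = i') := by
    intro i i'
    by_cases h : i = i'
    · subst h
      rw [ind_of_true rfl, avg_pi_eval i (fun p => w p * w p)]
      have : (avg fun p => w p * w p) ≤ avg fun p => C * w p :=
        avg_mono fun p => mul_le_mul_of_nonneg_right (hC p) (h0 p)
      rw [avg_mul_left, h1] at this
      linarith
    · rw [avg_pi_eval₂ h, h1, ind_of_false h]; norm_num
  have e : ∀ x : Fin B → P, (avg fun i => w (x i)) ^ 2 =
      avg fun i => avg fun i' => w (x i) * w (x i') := by
    intro x; rw [sq, avg_mul_avg]
  simp_rw [e]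
  rw [avg_comm]
  simp_rw [avg_comm (X := Fin B → P)]
  refine (avg_mono fun i => avg_mono fun i' => hpair i i').trans ?_
  have : ∀ i : Fin B, (avg fun i' => 1 + C * ind (i = i')) = 1 + C / B := by
    intro i
    rw [avg_add, avg_const, avg_mul_left, avg_eq_sum]
    rw [sum_ind_eq, Fintype.card_fin, mul_one_div]
  simp_rw [this, avg_const]
  rfl

omit [Finite K] in
theorem avg_prod_fiber_card {m : ℕ} [Fintype K] [DecidableEq P] (r : K → P)
    (H : (Fin m → P) → ℝ) :
    (avg fun c : Fin m → P => (∏ j, (Nat.card P / Fintype.card K : ℝ) *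
      ∑ κ, ind (r κ = c j)) * H c) = avg fun c : Fin m → K => H (r ∘ c) := by
  have := Fintype.ofFinite P
  have hP : (Fintype.card P : ℝ) ≠ 0 := by simp [Fintype.card_ne_zero]
  have hK : (Fintype.card K : ℝ) ≠ 0 := by simp [Fintype.card_ne_zero]
  simp only [avg_eq_sum, Finset.prod_mul_distrib, Finset.prod_univ_sum, Fintype.piFinset_univ]
  simp only [Finset.prod_const, Finset.card_univ, Fintype.card_fin, Fintype.card_pi,
    Nat.card_eq_fintype_card]
  simp_rw [mul_assoc, ← Finset.mul_sum, Finset.sum_mul]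
  rw [Finset.sum_comm]
  have : ∀ c : Fin m → K, ∑ d : Fin m → P, (∏ j, ind (r (c j) = d j)) * H d = H (r ∘ c) := by
    intro c
    simp_rw [← ind_forall]
    rw [Finset.sum_eq_single (r ∘ c)]
    · rw [ind_of_true (by simp), one_mul]
    · intro d _ hd
      rw [ind_of_false, zero_mul]
      exact fun h => hd (funext fun j => (h j).symm)
    · simp
  simp_rw [this]
  push_cast
  rw [div_pow]
  field_simp

/-- **Resampling.** If `B` is large then, for some choice of one coordinate in each of `m` blocks of
length `B`, resampling the letters at these coordinates from the distribution of `r` does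
not decrease the mean of `F` substantially. -/
theorem exists_resample (m : ℕ) (ε : ℝ) (hε : 0 < ε) : ∃ B : ℕ, 0 < B ∧ ∀ r : K → P,
    ∀ F : (Fin m × Fin B → P) → ℝ, (∀ x, |F x| ≤ 1) → ∃ j : Fin m → Fin m × Fin B,
      j.Injective ∧ avg F - ε ≤ avg fun x => avg fun c : Fin m → K => F (overwrite j x (r ∘ c)) := by
  classical
  have := Fintype.ofFinite K
  have := Fintype.ofFinite P
  set C : ℝ := (Nat.card P : ℝ) with hCdef
  have hlim : Filter.Tendsto (fun B : ℕ => (1 + C / B) ^ m - 1) Filter.atTop (nhds 0) := by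
    have h1 := (tendsto_const_div_atTop_nhds_zero_nat C).const_add 1
    have h2 := (h1.pow m).sub_const 1
    simpa using h2
  obtain ⟨B, hB1, hB0⟩ := ((hlim.eventually (gt_mem_nhds (show (0:ℝ) < ε ^ 2 by positivity))).and
    (Filter.eventually_gt_atTop 0)).exists
  refine ⟨B, hB0, fun r F hF => ?_⟩
  have : Nonempty (Fin B) := ⟨⟨0, hB0⟩⟩
  have hK0 : (0 : ℝ) < Fintype.card K := by exact_mod_cast Fintype.card_pos
  have hP0 : (0 : ℝ) < C := by rw [hCdef]; exact_mod_cast Nat.card_pos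
  let w : P → ℝ := fun p => (C / Fintype.card K : ℝ) * ∑ κ, ind (r κ = p)
  have hw0 : ∀ p, 0 ≤ w p := fun p => mul_nonneg (by positivity)
    (Finset.sum_nonneg fun κ _ => ind_nonneg _)
  have hwC : ∀ p, w p ≤ C := by
    intro p
    have : ∑ κ, ind (r κ = p) ≤ Fintype.card K := by
      refine (Finset.sum_le_sum fun κ _ => ind_le_one (r κ = p)).trans ?_
      simp
    calc w p ≤ C / Fintype.card K * Fintype.card K := by
          simp only [w]; gcongr
      _ = C := by field_simp
  have hw1 : avg w = 1 := by
    simp only [w]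
    rw [avg_mul_left, avg_sum]
    have : ∀ κ, avg (fun p => ind (r κ = p)) = 1 / C := by
      intro κ
      rw [avg_eq_sum, hCdef, Nat.card_eq_fintype_card, sum_ind_eq]
    simp_rw [this]
    simp
    field_simp
  let L : (Fin m × Fin B → P) → ℝ := fun x => ∏ j, avg fun i => w (x (j, i))
  have hpull : ∀ f : (Fin B → P) → ℝ, (avg fun x : Fin m × Fin B → P => ∏ j, f fun i => x (j, i)) =
      (avg f) ^ m := by
    intro f
    have h := avg_pi_prod (X := fun _ : Fin m => Fin B → P) (fun _ => f)
    rw [← avg_equiv (Equiv.curry (Fin m) (Fin B) P)] at h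
    rw [Finset.prod_const, Finset.card_univ, Fintype.card_fin] at h
    rw [← h]
    rfl
  have hL1 : avg L = 1 := by
    simp only [L]
    rw [hpull (fun x => avg fun i => w (x i)), avg_comm]
    simp_rw [avg_pi_eval, hw1, avg_const, one_pow]
  have hL2 : (avg fun x => L x ^ 2) ≤ (1 + C / B) ^ m := by
    simp only [L, ← Finset.prod_pow]
    rw [hpull (fun x => (avg fun i => w (x i)) ^ 2)]
    exact pow_le_pow_left₀ (avg_nonneg fun x => sq_nonneg _) (avg_sq_avg_le hB0 w C hw0 hwC hw1) m
  have hvar : (avg fun x => (L x - 1) ^ 2) ≤ ε ^ 2 := by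
    have : ∀ x, (L x - 1) ^ 2 = L x ^ 2 - (2 * L x - 1) := fun x => by ring
    simp_rw [this]
    rw [avg_sub, avg_sub, avg_const, avg_mul_left, hL1]
    linarith
  have hcs : (avg fun x => F x * (L x - 1)) ^ 2 ≤ ε ^ 2 := by
    refine (avg_mul_sq_le _ _).trans ?_
    have h1 : (avg fun x => F x ^ 2) ≤ 1 := avg_le_of_le fun x => by
      rw [← sq_abs]; exact pow_le_one₀ (abs_nonneg _) (hF x)
    have h0 : 0 ≤ avg fun x => (L x - 1) ^ 2 := avg_nonneg fun x => sq_nonneg _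
    nlinarith
  have hcs' := (abs_le_of_sq_le_sq' hcs hε.le).1
  have e1 : (avg fun x => F x * (L x - 1)) = (avg fun x => L x * F x) - avg F := by
    rw [← avg_sub]; exact avg_congr fun x => by ring
  have e2 : (avg fun x => L x * F x) =
      avg fun i : Fin m → Fin B => avg fun x => (∏ j, w (x (j, i j))) * F x := by
    rw [avg_comm]
    refine avg_congr fun x => ?_
    rw [avg_mul_right, avg_pi_prod (X := fun _ : Fin m => Fin B) (fun j i => w (x (j, i)))]
  rw [e1, e2] at hcs'
  obtain ⟨i, hi⟩ := exists_avg_le fun i : Fin m → Fin B => avg fun x => (∏ j, w (x (j, i j))) * F x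
  have hj : Function.Injective fun q : Fin m => (q, i q) := fun a b h => congrArg Prod.fst h
  refine ⟨fun q => (q, i q), hj, ?_⟩
  have e3 := avg_overwrite hj (fun (x : Fin m × Fin B → P) c => (∏ q, w (c q)) * F x)
  simp only [Function.comp_apply] at e3
  rw [e3] at hi
  have e4 : ∀ x : Fin m × Fin B → P, (avg fun c => (∏ q, w (c q)) *
      F (overwrite (fun q : Fin m => (q, i q)) x c)) =
      avg fun c : Fin m → K => F (overwrite (fun q : Fin m => (q, i q)) x (r ∘ c)) := fun x =>
    avg_prod_fiber_card r fun c => F (overwrite (fun q : Fin m => (q, i q)) x c)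
  simp_rw [e4] at hi
  linarith

end Resample

/-! ### Density Hales–Jewett: subspaces -/

open Combinatorics

section Subspaces

instance {α ι : Type*} [Finite α] [Finite ι] : Finite (Line α ι) :=
  Finite.of_injective (fun l : Line α ι => l.idxFun) fun _ _ h => Line.ext h

instance {η α ι : Type*} [Finite η] [Finite α] [Finite ι] : Finite (Subspace η α ι) :=
  Finite.of_injective (fun l : Subspace η α ι => l.idxFun) fun _ _ h => Subspace.ext h

theorem exists_equiv_sum (ι J : Type) [Finite ι] [Finite J] (h : Nat.card J ≤ Nat.card ι) :
    Nonempty (ι ≃ J ⊕ Fin (Nat.card ι - Nat.card J)) := by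
  have := Fintype.ofFinite ι
  have := Fintype.ofFinite J
  simp only [Nat.card_eq_fintype_card] at *
  refine ⟨Fintype.equivOfCardEq ?_⟩
  simp; omega

theorem avg_comp_equiv {ι ι' α : Type*} (e : ι ≃ ι') (f : (ι → α) → ℝ) :
    (avg fun x : ι' → α => f (x ∘ e)) = avg f :=
  avg_equiv (e.arrowCongr (Equiv.refl α)).symm f

/-- Composition of a subspace with a subspace of its parameter space. -/
def Combinatorics.Subspace.comp {α ι η θ : Type*} (V : Subspace η α ι) (W : Subspace θ α η) :
    Subspace θ α ι where
  idxFun i := (V.idxFun i).elim .inl W.idxFun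
  proper e := by
    obtain ⟨h, hh⟩ := W.proper e
    obtain ⟨i, hi⟩ := V.proper h
    exact ⟨i, by simp [hi, hh]⟩

theorem Combinatorics.Subspace.comp_apply {α ι η θ : Type*} (V : Subspace η α ι)
    (W : Subspace θ α η) (x : θ → α) : V.comp W x = V (W x) := by
  funext i
  simp only [Subspace.apply_def, Subspace.comp]
  cases V.idxFun i <;> rfl

/-- Composition of a subspace with a line of its parameter space. -/
def Combinatorics.Subspace.compLine {α ι η : Type*} (V : Subspace η α ι) (l : Line α η) :
    Line α ι where
  idxFun i := (V.idxFun i).elim some l.idxFun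
  proper := by
    obtain ⟨h, hh⟩ := l.proper
    obtain ⟨i, hi⟩ := V.proper h
    exact ⟨i, by simp [hi, hh]⟩

theorem Combinatorics.Subspace.compLine_apply {α ι η : Type*} (V : Subspace η α ι)
    (l : Line α η) (a : α) : V.compLine l a = V (l a) := by
  funext i
  simp only [Subspace.apply_def, Subspace.compLine, Line.apply_def]
  cases V.idxFun i <;> rfl

/-- The subspace of words with prescribed coordinates on the right. -/
def Combinatorics.Subspace.fixRight {α ι ι' η : Type*} (V : Subspace η α ι) (y : ι' → α) :
    Subspace η α (ι ⊕ ι') where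
  idxFun := Sum.elim V.idxFun (fun i => .inl (y i))
  proper e := by
    obtain ⟨i, hi⟩ := V.proper e
    exact ⟨.inl i, hi⟩

theorem Combinatorics.Subspace.fixRight_apply {α ι ι' η : Type*} (V : Subspace η α ι)
    (y : ι' → α) (x : η → α) : V.fixRight y x = Sum.elim (V x) y := by
  funext i
  cases i <;> rfl

/-- The subspace of words with prescribed coordinates on the left. -/
def Combinatorics.Subspace.fixLeft {α ι ι' η : Type*} (x : ι → α) (V : Subspace η α ι') :
    Subspace η α (ι ⊕ ι') where
  idxFun := Sum.elim (fun i => .inl (x i)) V.idxFun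
  proper e := by
    obtain ⟨i, hi⟩ := V.proper e
    exact ⟨.inr i, hi⟩

theorem Combinatorics.Subspace.fixLeft_apply {α ι ι' η : Type*} (x : ι → α)
    (V : Subspace η α ι') (y : η → α) : V.fixLeft x y = Sum.elim x (V y) := by
  funext i
  cases i <;> rfl

theorem Combinatorics.Subspace.injective {α ι η : Type*} (V : Subspace η α ι) :
    Function.Injective (fun x : η → α => V x) := by
  intro x y h
  funext e
  obtain ⟨i, hi⟩ := V.proper e
  have := congrFun h i
  simpa [Subspace.apply_inr hi] using this

/-- The identity subspace, reindexed along an equivalence. -/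
def Combinatorics.Subspace.ofEquiv {α ι η : Type*} (e : ι ≃ η) : Subspace η α ι where
  idxFun i := .inr (e i)
  proper j := ⟨e.symm j, by simp⟩

theorem Combinatorics.Subspace.ofEquiv_apply {α ι η : Type*} (e : ι ≃ η) (x : η → α) :
    (Subspace.ofEquiv e : Subspace η α ι) x = x ∘ e := rfl

end Subspaces

/-- Sets of density `δ` in high-dimensional cubes over `α` contain combinatorial lines. -/
def DHJAt (α : Type) (δ : ℝ) : Prop :=
  ∃ n : ℕ, ∀ (ι : Type) [Finite ι], n ≤ Nat.card ι → ∀ A : Set (ι → α),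
    δ ≤ (avg fun x => ind (x ∈ A)) → ∃ l : Line α ι, ∀ a, l a ∈ A

/-- The density Hales–Jewett property for the alphabet `α`. -/
def DHJ (α : Type) : Prop := ∀ δ : ℝ, 0 < δ → DHJAt α δ

theorem DHJ.exists_subspace {α : Type} [Finite α] [Nonempty α] (h : DHJ α) (d : ℕ) :
    ∀ δ : ℝ, 0 < δ → ∃ n : ℕ, ∀ (ι : Type) [Finite ι], n ≤ Nat.card ι → ∀ A : Set (ι → α),
      δ ≤ (avg fun x => ind (x ∈ A)) → ∃ V : Subspace (Fin d) α ι, ∀ x, V x ∈ A := by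
  induction d with
  | zero =>
    intro δ hδ
    refine ⟨0, fun ι _ _ A hA => ?_⟩
    obtain ⟨x, hx⟩ := exists_avg_le fun x => ind (x ∈ A)
    have hxA : x ∈ A := by
      by_contra hc
      rw [ind_of_false hc] at hx
      linarith
    exact ⟨⟨fun i => .inl (x i), fun e => e.elim0⟩, fun _ => hxA⟩
  | succ d ih =>
    intro δ hδ
    obtain ⟨n1, hn1⟩ := h (δ / 2) (by positivity)
    have hpos : ∀ l : Line α (Fin n1), 0 < δ / 2 / Nat.card (Line α (Fin n1)) := by
      intro l
      have : Nonempty (Line α (Fin n1)) := ⟨l⟩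
      have : (0 : ℝ) < Nat.card (Line α (Fin n1)) := by exact_mod_cast Nat.card_pos
      positivity
    by_cases hne : Nonempty (Line α (Fin n1))
    swap
    · refine ⟨n1, fun ι _ hι A hA => ?_⟩
      exfalso
      obtain ⟨l, -⟩ := hn1 (Fin n1) (by simp) Set.univ (by
        have h1 : (avg fun x => ind (x ∈ A)) ≤ 1 := avg_le_of_le fun x => ind_le_one _
        simp only [Set.mem_univ, ind_of_true, avg_const]
        linarith)
      exact hne ⟨l⟩
    obtain ⟨l0⟩ := hne
    obtain ⟨n2, hn2⟩ := ih _ (hpos l0)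
    refine ⟨n1 + n2, fun ι _ hι A hA => ?_⟩
    obtain ⟨e⟩ := exists_equiv_sum ι (Fin n1) (by simp; omega)
    set ι2 := Fin (Nat.card ι - Nat.card (Fin n1))
    rw [← avg_comp_equiv e, avg_sumArrow, avg_comm] at hA
    obtain ⟨l, hl⟩ := exists_frequent
      (fun (l : Line α (Fin n1)) (y : ι2 → α) => ∀ a, (Sum.elim (l a) y) ∘ e ∈ A)
      (fun y => avg fun x => ind ((Sum.elim x y) ∘ e ∈ A)) δ hδ
      (fun y hy => hn1 (Fin n1) (by simp) {x | (Sum.elim x y) ∘ e ∈ A} hy)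
      (fun y => avg_le_of_le fun x => ind_le_one _) hA
    obtain ⟨V, hV⟩ := hn2 ι2 (by simp [ι2]; omega)
      {y | ∀ a, (Sum.elim (l a) y) ∘ e ∈ A} hl
    let W : Subspace (Fin (d + 1)) α (Fin n1 ⊕ ι2) :=
      { idxFun := Sum.elim (fun i => (l.idxFun i).elim (.inr 0) .inl)
          (fun i => (V.idxFun i).map id Fin.succ)
        proper := by
          intro p
          refine Fin.cases ?_ (fun p => ?_) p
          · obtain ⟨i, hi⟩ := l.proper
            exact ⟨.inl i, by simp [hi]⟩
          · obtain ⟨i, hi⟩ := V.proper p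
            exact ⟨.inr i, by simp [hi]⟩ }
    have hW : ∀ x, W x = Sum.elim (l (x 0)) (V (Fin.tail x)) := by
      intro x
      funext i
      rcases i with i | i
      · simp only [Subspace.apply_def, W, Sum.elim_inl, Line.apply_def]
        cases l.idxFun i <;> rfl
      · simp only [Subspace.apply_def, W, Sum.elim_inr]
        cases V.idxFun i <;> rfl
    refine ⟨(Subspace.ofEquiv e).comp W, fun x => ?_⟩
    rw [Subspace.comp_apply, Subspace.ofEquiv_apply, hW]
    exact hV _ _

/-! ### Insensitive sets -/

section Insensitive

variable {β ι ι' : Type}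

/-- Replace the letter `none` by the letter `some b`. -/
def fillWith (b : β) (x : ι → Option β) : ι → Option β := fun i => some ((x i).getD b)

/-- A set of words which is insensitive to interchanging the letters `none` and `some b`. -/
def Insensitive (b : β) (E : Set (ι → Option β)) : Prop := ∀ x, fillWith b x ∈ E ↔ x ∈ E

theorem Insensitive.mem_iff {b : β} {E : Set (ι → Option β)} (hE : Insensitive b E)
    {x y : ι → Option β} (h : fillWith b x = fillWith b y) : x ∈ E ↔ y ∈ E := by
  rw [← hE x, h, hE y]

theorem Insensitive.compl {b : β} {E : Set (ι → Option β)} (hE : Insensitive b E) :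
    Insensitive b Eᶜ := fun x => not_congr (hE x)

theorem fillWith_fillWith (b : β) (x : ι → Option β) :
    fillWith b (fillWith b x) = fillWith b x := rfl

theorem fillWith_elim (b : β) (x : ι → Option β) (y : ι' → Option β) :
    fillWith b (Sum.elim x y) = Sum.elim (fillWith b x) (fillWith b y) := by
  funext i; cases i <;> rfl

theorem fillWith_subspace {η : Type} (b : β) (V : Subspace η (Option β) ι) (x : η → Option β) :
    fillWith b (V (fillWith b x)) = fillWith b (V x) := by
  funext i
  simp only [fillWith, Subspace.apply_def]
  cases V.idxFun i <;> rfl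

theorem Insensitive.preimage {η : Type} {b : β} {E : Set (ι → Option β)} (hE : Insensitive b E)
    (V : Subspace η (Option β) ι) : Insensitive b {x | V x ∈ E} :=
  fun x => hE.mem_iff (fillWith_subspace b V x)

theorem DHJ.exists_subspace_insensitive [Finite β] [Nonempty β] (h : DHJ β) (d : ℕ) (η : ℝ)
    (hη : 0 < η) : ∃ (J : Type) (_ : Finite J), ∀ (b : β) (E : Set (J → Option β)),
      Insensitive b E → η ≤ (avg fun x => ind (x ∈ E)) →
      ∃ V : Subspace (Fin d) (Option β) J, ∀ x, V x ∈ E := by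
  obtain ⟨n, hn⟩ := h.exists_subspace d (η / 2) (by positivity)
  obtain ⟨B, -, hB⟩ := exists_resample (P := Option β) (K := β) n (η / 2) (by positivity)
  refine ⟨Fin n × Fin B, inferInstance, fun b E hE hd => ?_⟩
  obtain ⟨j, hj, hjE⟩ := hB some (fun x => ind (x ∈ E)) (fun x => by
    rw [abs_of_nonneg (ind_nonneg _)]; exact ind_le_one _)
  obtain ⟨x, hx⟩ := exists_avg_le fun x => avg fun c : Fin n → β =>
    ind (overwrite j x (some ∘ c) ∈ E)
  obtain ⟨V, hV⟩ := hn (Fin n) (by simp) {c | overwrite j x (some ∘ c) ∈ E}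
    (by simp only [Set.mem_ofPred_eq]; linarith)
  let W : Subspace (Fin d) (Option β) (Fin n × Fin B) :=
    { idxFun := overwrite j (fun p => .inl (x p)) (fun i => (V.idxFun i).map some id)
      proper := by
        intro p
        obtain ⟨i, hi⟩ := V.proper p
        exact ⟨j i, by simp [overwrite_apply hj, hi]⟩ }
  refine ⟨W, fun c => ?_⟩
  rw [hE.mem_iff (y := overwrite j x (some ∘ (V fun i => (c i).getD b)))]
  · exact hV _
  · funext p
    simp only [fillWith, Subspace.apply_def, W]
    by_cases hp : ∃ i, j i = p
    · obtain ⟨i, rfl⟩ := hp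
      simp only [overwrite_apply hj, Function.comp, Subspace.apply_def]
      cases V.idxFun i <;> rfl
    · simp only [overwrite_apply' _ _ _ hp]
      rfl

end Insensitive

section Tiling

variable {β : Type} [Finite β] [Nonempty β]

/-- `g` has nonpositive mean on every `d`-dimensional subspace. -/
def NonposOn (d : ℕ) {ι : Type} (g : (ι → Option β) → ℝ) : Prop :=
  ∀ V : Subspace (Fin d) (Option β) ι, (avg fun x => g (V x)) ≤ 0

omit [Finite β] [Nonempty β] in
theorem NonposOn.comp {d : ℕ} {ι η : Type} {g : (ι → Option β) → ℝ} (hg : NonposOn d g)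
    (W : Subspace η (Option β) ι) : NonposOn d fun x => g (W x) := fun V => by
  simp_rw [← Subspace.comp_apply]
  exact hg _

theorem NonposOn.avg_nonpos {d : ℕ} {ι : Type} [Finite ι] (hd : d ≤ Nat.card ι)
    {g : (ι → Option β) → ℝ} (hg : NonposOn d g) : avg g ≤ 0 := by
  obtain ⟨e⟩ := exists_equiv_sum ι (Fin d) (by simpa)
  rw [← avg_comp_equiv e, avg_sumArrow, avg_comm]
  refine avg_le_of_le fun y => ?_
  have h := hg ((Subspace.ofEquiv e).comp ((default : Subspace (Fin d) (Option β) (Fin d)).fixRight y))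
  simp only [Subspace.comp_apply, Subspace.fixRight_apply, Subspace.ofEquiv_apply] at h
  exact h

theorem tile_step {J : Type} [Finite J] {d : ℕ} {η : ℝ} (b : β)
    (hJ : ∀ (E : Set (J → Option β)), Insensitive b E → η ≤ (avg fun x => ind (x ∈ E)) →
      ∃ V : Subspace (Fin d) (Option β) J, ∀ x, V x ∈ E)
    {κ : ℝ} (hκ : κ = Nat.card (Fin d → Option β) / Nat.card (J → Option β)) (hκ1 : κ ≤ 1)
    (hη : 0 ≤ η) (r : ℕ) :
    ∀ (ι : Type) [Finite ι], r * Nat.card J ≤ Nat.card ι → ∀ E : Set (ι → Option β),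
      Insensitive b E → ∀ g : (ι → Option β) → ℝ, (∀ x, g x ≤ 1) → NonposOn d g →
      (avg fun x => g x * ind (x ∈ E)) ≤ η + (1 - κ) ^ r * ((avg fun x => ind (x ∈ E)) - η) := by
  classical
  have hκ0 : 0 ≤ κ := by rw [hκ]; positivity
  induction r with
  | zero =>
    intro ι _ _ E _ g hg _
    simp only [pow_zero, one_mul, add_sub_cancel]
    exact avg_mono fun x => mul_le_of_le_one_left (ind_nonneg _) (hg x)
  | succ r ih =>
    intro ι _ hι E hE g hg hgd
    obtain ⟨e⟩ := exists_equiv_sum ι J (by nlinarith)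
    have hcard : r * Nat.card J ≤ Nat.card (Fin (Nat.card ι - Nat.card J)) := by
      rw [Nat.card_fin]; rw [Nat.succ_mul] at hι; omega
    set ι2 := Fin (Nat.card ι - Nat.card J)
    -- Transfer to words on `J ⊕ ι2`.
    let g' : (J ⊕ ι2 → Option β) → ℝ := fun x => g (x ∘ e)
    let E' : Set (J ⊕ ι2 → Option β) := {x | x ∘ e ∈ E}
    have hE' : Insensitive b E' := fun x => hE (x ∘ e)
    have hgd' : NonposOn d g' := hgd.comp (Subspace.ofEquiv e)
    let Es : (ι2 → Option β) → Set (J → Option β) := fun y => {x | Sum.elim x y ∈ E'}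
    have hEs : ∀ y, Insensitive b (Es y) := fun y x => hE'.mem_iff (by
      rw [fillWith_elim, fillWith_elim, fillWith_fillWith])
    have hEsf : ∀ y, Es (fillWith b y) = Es y := fun y => by
      ext x
      exact hE'.mem_iff (by rw [fillWith_elim, fillWith_elim, fillWith_fillWith])
    let good : Set (J → Option β) → Prop := fun F => ∃ V : Subspace (Fin d) (Option β) J, ∀ x, V x ∈ F
    -- The part of a section which is removed.
    let rem : Set (J → Option β) → Set (J → Option β) := fun F =>
      if h : good F then {x | ∃ c, h.choose c = x} else ∅
    have hrem_sub : ∀ F, rem F ⊆ F := by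
      intro F x hx
      by_cases h : good F
      · simp only [rem, dif_pos h] at hx
        obtain ⟨c, rfl⟩ := hx
        exact h.choose_spec c
      · simp [rem, dif_neg h] at hx
    have hrem_nonpos : ∀ y, (avg fun x => g' (Sum.elim x y) * ind (x ∈ rem (Es y))) ≤ 0 := by
      intro y
      by_cases h : good (Es y)
      · simp only [rem, dif_pos h]
        show (avg fun x => g' (Sum.elim x y) * ind (∃ c, h.choose c = x)) ≤ 0
        rw [avg_ind_range (fun c => h.choose c) h.choose.injective]
        have := hgd' (h.choose.fixRight y)
        simp only [Subspace.fixRight_apply] at this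
        exact mul_nonpos_of_nonneg_of_nonpos (by positivity) this
      · simp only [rem, dif_neg h]
        simp [ind_of_false, avg_const]
    have hrem_dens : ∀ y, η ≤ (avg fun x => ind (x ∈ Es y)) →
        (avg fun x => ind (x ∈ rem (Es y))) = κ := by
      intro y hy
      have h : good (Es y) := hJ _ (hEs y) hy
      simp only [rem, dif_pos h]
      have := avg_ind_range (fun c => h.choose c) h.choose.injective (fun _ => 1)
      simp only [one_mul, avg_const, mul_one] at this
      rw [hκ, ← this]
      rfl
    let R : (J → Option β) → Set (ι2 → Option β) := fun x => {y | x ∈ Es y ∧ x ∉ rem (Es y)}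
    have hR : ∀ x, Insensitive b (R x) := by
      intro x y
      show (_ ∧ _) ↔ (_ ∧ _)
      rw [hEsf]
    have hsplit : ∀ x y, ind (x ∈ Es y) = ind (x ∈ rem (Es y)) + ind (y ∈ R x) := by
      intro x y
      by_cases h1 : x ∈ rem (Es y)
      · rw [ind_of_true h1, ind_of_true (hrem_sub _ h1), ind_of_false (fun h => h.2 h1), add_zero]
      · rw [ind_of_false h1, zero_add]
        exact ind_congr ⟨fun h => ⟨h, h1⟩, fun h => h.1⟩
    have hdens : (avg fun x => ind (x ∈ E)) = avg fun y => avg fun x => ind (x ∈ Es y) := by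
      rw [← avg_comp_equiv e, avg_sumArrow, avg_comm]; rfl
    have hmain : (avg fun x => g x * ind (x ∈ E)) =
        avg fun y => avg fun x => g' (Sum.elim x y) * ind (x ∈ Es y) := by
      rw [← avg_comp_equiv e, avg_sumArrow, avg_comm]; rfl
    have hdecr : (avg fun x => avg fun y => ind (y ∈ R x)) - η ≤
        (1 - κ) * ((avg fun x => ind (x ∈ E)) - η) := by
      rw [hdens, avg_comm]
      have : ∀ y, (avg fun x => ind (y ∈ R x)) ≤
          η + (1 - κ) * ((avg fun x => ind (x ∈ Es y)) - η) := by
        intro y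
        have h1 : (avg fun x => ind (x ∈ Es y)) =
            (avg fun x => ind (x ∈ rem (Es y))) + avg fun x => ind (y ∈ R x) := by
          rw [← avg_add]; exact avg_congr fun x => hsplit x y
        have h2 : (avg fun x => ind (x ∈ Es y)) ≤ 1 := avg_le_of_le fun x => ind_le_one _
        have h3 : 0 ≤ (avg fun x => ind (x ∈ rem (Es y))) := avg_nonneg fun x => ind_nonneg _
        by_cases hy : η ≤ (avg fun x => ind (x ∈ Es y))
        · rw [hrem_dens y hy] at h1
          nlinarith
        · push Not at hy
          nlinarith
      have := avg_mono this
      rw [avg_add, avg_const, avg_mul_left, avg_sub, avg_const] at this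
      linarith
    have hrec : (avg fun x => avg fun y => g' (Sum.elim x y) * ind (y ∈ R x)) ≤
        η + (1 - κ) ^ r * ((avg fun x => avg fun y => ind (y ∈ R x)) - η) := by
      have : ∀ x, (avg fun y => g' (Sum.elim x y) * ind (y ∈ R x)) ≤
          η + (1 - κ) ^ r * ((avg fun y => ind (y ∈ R x)) - η) := fun x =>
        ih ι2 hcard (R x) (hR x) (fun y => g' (Sum.elim x y)) (fun y => hg _) (fun V => by
          have := hgd' (V.fixLeft x)
          simpa only [Subspace.fixLeft_apply] using this)
      have := avg_mono this
      rwa [avg_add, avg_const, avg_mul_left, avg_sub, avg_const] at this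
    calc (avg fun x => g x * ind (x ∈ E))
        = (avg fun y => avg fun x => g' (Sum.elim x y) * ind (x ∈ rem (Es y))) +
          avg fun x => avg fun y => g' (Sum.elim x y) * ind (y ∈ R x) := by
          rw [hmain, avg_comm (X := J → Option β), ← avg_add]
          refine avg_congr fun y => ?_
          rw [← avg_add]
          exact avg_congr fun x => by rw [hsplit]; ring
      _ ≤ 0 + (η + (1 - κ) ^ r * ((avg fun x => avg fun y => ind (y ∈ R x)) - η)) :=
          add_le_add (avg_le_of_le hrem_nonpos) hrec
      _ ≤ 0 + (η + (1 - κ) ^ r * ((1 - κ) * ((avg fun x => ind (x ∈ E)) - η))) := by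
          have : 0 ≤ (1 - κ) ^ r := pow_nonneg (by linarith) r
          gcongr
      _ = _ := by ring

theorem tile (h : DHJ β) (d : ℕ) (η : ℝ) (hη : 0 < η) :
    ∃ n : ℕ, ∀ (ι : Type) [Finite ι], n ≤ Nat.card ι → ∀ (b : β) (E : Set (ι → Option β)),
      Insensitive b E → ∀ g : (ι → Option β) → ℝ, (∀ x, g x ≤ 1) → NonposOn d g →
      (avg fun x => g x * ind (x ∈ E)) ≤ η := by
  by_cases hη1 : 1 ≤ η
  · refine ⟨0, fun ι _ _ b E _ g hg _ => (avg_le_of_le fun x => ?_).trans hη1⟩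
    have h0 := ind_nonneg (x ∈ E)
    have h1 := ind_le_one (x ∈ E)
    nlinarith [hg x]
  push Not at hη1
  obtain ⟨J, _, hJ⟩ := h.exists_subspace_insensitive d (η / 2) (by positivity)
  obtain ⟨b0⟩ := ‹Nonempty β›
  obtain ⟨V, -⟩ := hJ b0 Set.univ (fun _ => Iff.rfl) (by
    simp only [Set.mem_univ, ind_of_true, avg_const]; linarith)
  set κ : ℝ := Nat.card (Fin d → Option β) / Nat.card (J → Option β) with hκ
  have hJpos : (0 : ℝ) < Nat.card (J → Option β) := by exact_mod_cast Nat.card_pos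
  have hdpos : (0 : ℝ) < Nat.card (Fin d → Option β) := by exact_mod_cast Nat.card_pos
  have hκ0 : 0 < κ := by positivity
  have hκ1 : κ ≤ 1 := by
    rw [hκ, div_le_one hJpos]
    exact_mod_cast Nat.card_le_card_of_injective _ V.injective
  obtain ⟨r, hr⟩ := exists_pow_lt_of_lt_one (show 0 < η / 2 by positivity)
    (show 1 - κ < 1 by linarith)
  refine ⟨r * Nat.card J, fun ι _ hι b E hE g hg hgd => ?_⟩
  have := tile_step b (hJ b) hκ hκ1 (by positivity) r ι hι E hE g hg hgd
  have h1 : (avg fun x => ind (x ∈ E)) ≤ 1 := avg_le_of_le fun x => ind_le_one _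
  have h2 : 0 ≤ (1 - κ) ^ r := pow_nonneg (by linarith) r
  nlinarith

theorem tile_finset (h : DHJ β) (d : ℕ) (s : Finset β) : ∀ η : ℝ, 0 < η →
    ∃ n : ℕ, ∀ (ι : Type) [Finite ι], n ≤ Nat.card ι → ∀ (E : β → Set (ι → Option β)),
      (∀ b, Insensitive b (E b)) → ∀ g : (ι → Option β) → ℝ, (∀ x, g x ≤ 1) → NonposOn d g →
      (avg fun x => g x * ∏ b ∈ s, ind (x ∈ E b)) ≤ η := by
  classical
  induction s using Finset.induction_on with
  | empty =>
    intro η hη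
    refine ⟨d, fun ι _ hι E hE g hg hgd => ?_⟩
    simp only [Finset.prod_empty, mul_one]
    exact (hgd.avg_nonpos hι).trans hη.le
  | insert a s ha ih =>
    intro η hη
    obtain ⟨d', hd'⟩ := ih (η / 2) (by positivity)
    obtain ⟨n, hn⟩ := tile h d' (η / 2) (by positivity)
    refine ⟨n, fun ι _ hι E hE g hg hgd => ?_⟩
    have hprod0 : ∀ x, 0 ≤ ∏ b ∈ s, ind (x ∈ E b) := fun x =>
      Finset.prod_nonneg fun _ _ => ind_nonneg _
    have hprod1 : ∀ x, ∏ b ∈ s, ind (x ∈ E b) ≤ 1 := fun x =>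
      Finset.prod_le_one (fun _ _ => ind_nonneg _) fun _ _ => ind_le_one _
    have key := hn ι hι a (E a) (hE a) (fun x => g x * (∏ b ∈ s, ind (x ∈ E b)) - η / 2)
      (fun x => by nlinarith [hg x, hprod0 x, hprod1 x]) (fun V => by
        rw [avg_sub, avg_const]
        have := hd' (Fin d') (by simp) (fun b => {x | V x ∈ E b}) (fun b => (hE b).preimage V)
          (fun x => g (V x)) (fun x => hg _) (hgd.comp V)
        simp only [Set.mem_ofPred_eq] at this
        linarith)
    have e : ∀ x, g x * ∏ b ∈ insert a s, ind (x ∈ E b) ≤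
        (g x * (∏ b ∈ s, ind (x ∈ E b)) - η / 2) * ind (x ∈ E a) + η / 2 := by
      intro x
      rw [Finset.prod_insert ha]
      nlinarith [ind_nonneg (x ∈ E a), ind_le_one (x ∈ E a)]
    have := avg_mono e
    rw [avg_add, avg_const] at this
    linarith

/-- A function whose mean on every `d`-dimensional subspace is nonpositive has small mean on the
complement of an intersection of insensitive sets. -/
theorem tile_compl (h : DHJ β) (d : ℕ) (s : Finset β) (η : ℝ) (hη : 0 < η) :
    ∃ n : ℕ, ∀ (ι : Type) [Finite ι], n ≤ Nat.card ι → ∀ (E : β → Set (ι → Option β)),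
      (∀ b, Insensitive b (E b)) → ∀ g : (ι → Option β) → ℝ, (∀ x, g x ≤ 1) → NonposOn d g →
      (avg fun x => g x * (1 - ∏ b ∈ s, ind (x ∈ E b))) ≤ s.card * η := by
  classical
  induction s using Finset.induction_on with
  | empty =>
    refine ⟨0, fun ι _ hι E hE g hg hgd => ?_⟩
    simp [avg_const]
  | insert a s ha ih =>
    obtain ⟨n1, hn1⟩ := ih
    obtain ⟨n2, hn2⟩ := tile_finset h d (insert a s) η hη
    refine ⟨max n1 n2, fun ι _ hι E hE g hg hgd => ?_⟩
    have h1 := hn1 ι (le_trans (le_max_left _ _) hι) E hE g hg hgd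
    have h2 := hn2 ι (le_trans (le_max_right _ _) hι) (fun b => if b = a then (E b)ᶜ else E b)
      (fun b => by
        by_cases hb : b = a
        · simpa [hb] using (hE a).compl
        · simpa [hb] using hE b) g hg hgd
    have e : ∀ x, g x * (1 - ∏ b ∈ insert a s, ind (x ∈ E b)) =
        g x * (1 - ∏ b ∈ s, ind (x ∈ E b)) +
        g x * ∏ b ∈ insert a s, ind (x ∈ if b = a then (E b)ᶜ else E b) := by
      intro x
      rw [Finset.prod_insert ha, Finset.prod_insert ha, if_pos rfl, Set.mem_compl_iff, ind_not]
      have hc : ∏ b ∈ s, ind (x ∈ if b = a then (E b)ᶜ else E b) = ∏ b ∈ s, ind (x ∈ E b) :=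
        Finset.prod_congr rfl fun b hb => by
          rw [if_neg (ne_of_mem_of_not_mem hb ha)]
      rw [hc]
      ring
    simp_rw [e]
    rw [avg_add, Finset.card_insert_of_notMem ha]
    push_cast
    linarith

end Tiling

section MainStep

/-- A set of words containing no combinatorial line. -/
def LineFree {α ι : Type} (A : Set (ι → α)) : Prop := ¬ ∃ l : Line α ι, ∀ a, l a ∈ A

theorem LineFree.preimage {α ι η : Type} {A : Set (ι → α)} (hA : LineFree A)
    (V : Subspace η α ι) : LineFree {x | V x ∈ A} := by
  rintro ⟨l, hl⟩
  exact hA ⟨V.compLine l, fun a => by rw [Subspace.compLine_apply]; exact hl a⟩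

theorem LineFree.section {α ι η : Type} {A : Set (ι ⊕ η → α)} (hA : LineFree A)
    (x : ι → α) : LineFree {y | Sum.elim x y ∈ A} := by
  have := hA.preimage ((default : Subspace η α η).fixLeft x)
  simp only [Subspace.fixLeft_apply] at this
  exact this

/-- The critical density for lines. -/
theorem exists_critical_density {α : Type} [Finite α] [Nonempty α] (h : ¬ DHJ α) :
    ∃ δ : ℝ, 0 < δ ∧ δ ≤ 1 ∧ (∀ γ : ℝ, 0 < γ → ∃ n : ℕ, ∀ (ι : Type) [Finite ι], n ≤ Nat.card ι →
      ∀ A : Set (ι → α), LineFree A → (avg fun x => ind (x ∈ A)) ≤ δ + γ) ∧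
      (∀ γ : ℝ, 0 < γ → ∀ n : ℕ, ∃ (ι : Type) (_ : Finite ι), n ≤ Nat.card ι ∧
        ∃ A : Set (ι → α), LineFree A ∧ δ - γ ≤ (avg fun x => ind (x ∈ A))) := by
  simp only [DHJ] at h
  push Not at h
  obtain ⟨δ0, hδ0, hδ0'⟩ := h
  set S := {δ : ℝ | ¬ DHJAt α δ} with hS
  have hle : ∀ δ ∈ S, δ ≤ 1 := by
    intro δ hδ
    by_contra! hc
    refine hδ ⟨0, fun ι _ _ A hA => ?_⟩
    have h1 : (avg fun x => ind (x ∈ A)) ≤ 1 := avg_le_of_le fun x => ind_le_one _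
    linarith
  have hbdd : BddAbove S := ⟨1, hle⟩
  refine ⟨sSup S, lt_of_lt_of_le hδ0 (le_csSup hbdd hδ0'), csSup_le ⟨δ0, hδ0'⟩ hle, ?_, ?_⟩
  · intro γ hγ
    have : DHJAt α (sSup S + γ) := by
      by_contra hc
      have := le_csSup hbdd (show sSup S + γ ∈ S from hc)
      linarith
    obtain ⟨n, hn⟩ := this
    refine ⟨n, fun ι _ hι A hA => ?_⟩
    by_contra! hc
    exact hA (hn ι hι A hc.le)
  · intro γ hγ n
    obtain ⟨δ, hδ, hδ'⟩ := exists_lt_of_lt_csSup (⟨δ0, hδ0'⟩ : S.Nonempty)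
      (show sSup S - γ < sSup S by linarith)
    simp only [hS, DHJAt, Set.mem_ofPred_eq] at hδ
    push Not at hδ
    obtain ⟨ι, hfin, hι, A, hA, hA'⟩ := hδ n
    refine ⟨ι, hfin, hι, A, ?_, by linarith⟩
    rintro ⟨l, hl⟩
    obtain ⟨a, ha⟩ := hA' l
    exact ha (hl a)

/-- If all means of `f` are at most `c` and the total mean is nearly `c` then each value is nearly
`c`. -/
theorem le_of_avg_ge {X : Type*} [Finite X] [Nonempty X] {f : X → ℝ} {c γ : ℝ}
    (hf : ∀ x, f x ≤ c) (h : c - γ ≤ avg f) (x : X) : c - Nat.card X * γ ≤ f x := by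
  classical
  have := Fintype.ofFinite X
  have h1 : ∑ y, (c - f y) = Nat.card X * (c - avg f) := by
    rw [Finset.sum_sub_distrib, sum_eq_card_mul_avg f]
    simp
    ring
  have h2 : c - f x ≤ ∑ y, (c - f y) :=
    Finset.single_le_sum (f := fun y => c - f y) (fun y _ => by linarith [hf y]) (Finset.mem_univ x)
  rw [h1] at h2
  have h3 : (0 : ℝ) ≤ Nat.card X := by positivity
  nlinarith

variable {β : Type} [Finite β] [Nonempty β]

theorem DHJ.option (h : DHJ β) : DHJ (Option β) := by
  classical
  have := Fintype.ofFinite β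
  by_contra hcon
  obtain ⟨δ, hδ0, hδ1, hupper, hlower⟩ := exists_critical_density hcon
  -- Choice of parameters.
  obtain ⟨M, hM⟩ := h (δ / 2 / 2) (by positivity)
  obtain ⟨l0, -⟩ := hM (Fin M) (by simp) Set.univ (by
    simp only [Set.mem_univ, ind_of_true, avg_const]; linarith)
  set θ : ℝ := δ / 2 / 2 / Nat.card (Line β (Fin M)) with hθ
  have hcardL : (0 : ℝ) < Nat.card (Line β (Fin M)) := by
    have : Nonempty (Line β (Fin M)) := ⟨l0⟩
    exact_mod_cast Nat.card_pos
  have hθ0 : 0 < θ := by positivity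
  have hθ1 : θ ≤ 1 := by
    rw [hθ, div_le_one hcardL]
    have : (1 : ℝ) ≤ Nat.card (Line β (Fin M)) := by
      have : Nonempty (Line β (Fin M)) := ⟨l0⟩
      exact_mod_cast Nat.card_pos
    linarith
  set γ : ℝ := δ * θ / 16 with hγ
  have hγ0 : 0 < γ := by positivity
  have hγ1 : γ ≤ 1 / 16 := by rw [hγ]; nlinarith
  set ε : ℝ := γ * θ / 16 with hε
  have hε0 : 0 < ε := by positivity
  obtain ⟨d, hd⟩ := hupper γ hγ0
  obtain ⟨m1, hm1⟩ := tile_compl h d Finset.univ (γ / (Fintype.card β)) (by positivity)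
  obtain ⟨m2, hm2⟩ := hupper ε hε0
  obtain ⟨m, hmm1, hmm2⟩ : ∃ m, m1 ≤ m ∧ m2 ≤ m := ⟨max m1 m2, le_max_left _ _, le_max_right _ _⟩
  obtain ⟨B, -, hB⟩ := exists_resample (P := β ⊕ Fin M) (K := Option β) m ε hε0
  set N := Nat.card ((Fin m × Fin B) ⊕ Fin M → Option β) with hN
  have hN0 : (0 : ℝ) < N := by rw [hN]; exact_mod_cast Nat.card_pos
  obtain ⟨n0, hn0⟩ := hupper (ε / (2 * N)) (by positivity)
  obtain ⟨ι, _, hι, A0, hA0, hA0d⟩ := hlower (ε / (2 * N))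
    (by positivity) (n0 + Nat.card ((Fin m × Fin B) ⊕ Fin M))
  obtain ⟨e⟩ := exists_equiv_sum ι ((Fin m × Fin B) ⊕ Fin M) (by omega)
  have hcard2 : n0 ≤ Nat.card (Fin (Nat.card ι - Nat.card ((Fin m × Fin B) ⊕ Fin M))) := by
    rw [Nat.card_fin]; omega
  set ι2 := Fin (Nat.card ι - Nat.card ((Fin m × Fin B) ⊕ Fin M))
  let A : Set (((Fin m × Fin B) ⊕ Fin M) ⊕ ι2 → Option β) := {x | x ∘ e ∈ A0}
  have hA : LineFree A := hA0.preimage (Subspace.ofEquiv e)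
  have hAd : (δ + ε / (2 * N)) - ε / N ≤
      avg fun u => avg fun y => ind (Sum.elim u y ∈ A) := by
    rw [← avg_comp_equiv e, avg_sumArrow] at hA0d
    refine le_trans (le_of_eq ?_) hA0d
    field_simp
    ring
  -- All sections are nearly of critical density.
  have hsec : ∀ u, δ - ε ≤ avg fun y => ind (Sum.elim u y ∈ A) := by
    intro u
    have := le_of_avg_ge (fun u => hn0 ι2 hcard2 _ (hA.section u)) hAd u
    have h2 : (Nat.card ((Fin m × Fin B) ⊕ Fin M → Option β) : ℝ) * (ε / N) = ε := by
      rw [hN]; field_simp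
    have h3 : 0 ≤ ε / (2 * N) := by positivity
    rw [h2] at this
    change _ ≤ avg fun y => ind (Sum.elim u y ∈ A) at this
    linarith
  -- Find a line template.
  let word : (β ⊕ Fin M → Option β) → (Fin m × Fin B → β ⊕ Fin M) →
      ((Fin m × Fin B) ⊕ Fin M → Option β) := fun s x => Sum.elim (s ∘ x) (s ∘ Sum.inr)
  let lab : (Fin M → β) → (β ⊕ Fin M → Option β) := fun v => Sum.elim some (some ∘ v)
  have hfreq : δ / 2 ≤ avg fun p : (Fin m × Fin B → β ⊕ Fin M) × (ι2 → Option β) =>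
      avg fun v => ind (Sum.elim (word (lab v) p.1) p.2 ∈ A) := by
    rw [avg_prod]
    refine le_avg_of_le fun x => ?_
    rw [avg_comm]
    refine le_avg_of_le fun v => ?_
    refine le_trans ?_ (hsec (word (lab v) x))
    nlinarith
  obtain ⟨l, hl⟩ := exists_frequent
    (fun (l : Line β (Fin M)) (p : (Fin m × Fin B → β ⊕ Fin M) × (ι2 → Option β)) =>
      ∀ b, Sum.elim (word (lab (l b)) p.1) p.2 ∈ A) _ (δ / 2) (by positivity)
    (fun p hp => hM (Fin M) (by simp) {v | Sum.elim (word (lab v) p.1) p.2 ∈ A} hp)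
    (fun p => avg_le_of_le fun v => ind_le_one _) hfreq
  rw [avg_prod] at hl
  change θ ≤ _ at hl
  obtain ⟨i0, hi0⟩ := l.proper
  let s : β ⊕ Fin M → Option β := Sum.elim some l.idxFun
  let r : Option β → β ⊕ Fin M := fun o => o.elim (Sum.inr i0) Sum.inl
  have hsr : ∀ o, s (r o) = o := by
    intro o; cases o <;> simp [s, r, hi0]
  -- Resample.
  obtain ⟨j, hj, hjF⟩ := hB r (fun x => avg fun y => (ind (Sum.elim (word s x) y ∈ A) +
      γ * ind (∀ b, Sum.elim (word (lab (l b)) x) y ∈ A)) / 2) (fun x => abs_avg_le_of_le fun y => by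
    have h1 := ind_nonneg (Sum.elim (word s x) y ∈ A)
    have h2 := ind_le_one (Sum.elim (word s x) y ∈ A)
    have h3 := ind_nonneg (∀ b, Sum.elim (word (lab (l b)) x) y ∈ A)
    have h4 := ind_le_one (∀ b, Sum.elim (word (lab (l b)) x) y ∈ A)
    rw [abs_le]
    constructor <;> nlinarith)
  simp_rw [div_eq_mul_inv, avg_mul_right, avg_add, avg_mul_left] at hjF
  obtain ⟨x, hx⟩ := exists_avg_le fun x => ((avg fun c => avg fun y =>
    ind (Sum.elim (word s (overwrite j x (r ∘ c))) y ∈ A)) +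
    γ * avg fun c => avg fun y => ind (∀ b, Sum.elim (word (lab (l b)) (overwrite j x (r ∘ c))) y ∈ A)) * 2⁻¹
  simp_rw [avg_mul_right, avg_add, avg_mul_left] at hx
  obtain ⟨y, hy⟩ := exists_avg_le fun y : ι2 → Option β => (avg fun c =>
    ind (Sum.elim (word s (overwrite j x (r ∘ c))) y ∈ A)) +
    γ * avg fun c => ind (∀ b, Sum.elim (word (lab (l b)) (overwrite j x (r ∘ c))) y ∈ A)
  rw [avg_add, avg_mul_left, avg_comm, avg_comm (X := ι2 → Option β)] at hy
  have hlow : δ - ε ≤ avg fun x => avg fun y => ind (Sum.elim (word s x) y ∈ A) :=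
    le_avg_of_le fun x => hsec _
  -- The subspace.
  let U : Subspace (Fin m) (Option β) (((Fin m × Fin B) ⊕ Fin M) ⊕ ι2) :=
    { idxFun := Sum.elim (Sum.elim (overwrite j (fun p => .inl (s (x p))) .inr)
        (fun i => .inl (l.idxFun i))) (fun i => .inl (y i))
      proper := fun q => ⟨.inl (.inl (j q)), by simp [overwrite_apply hj]⟩ }
  have hU : ∀ c, U c = Sum.elim (word s (overwrite j x (r ∘ c))) y := by
    intro c
    funext p
    rcases p with (p | p) | p
    · by_cases hp : ∃ q, j q = p
      · obtain ⟨q, rfl⟩ := hp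
        simp [Subspace.apply_def, U, word, overwrite_apply hj, hsr]
      · simp [Subspace.apply_def, U, word, overwrite_apply' _ _ _ hp]
    · rfl
    · rfl
  let A' : Set (Fin m → Option β) := {c | U c ∈ A}
  have hA' : LineFree A' := hA.preimage U
  let E : β → Set (Fin m → Option β) := fun b =>
    {c | Sum.elim (word (lab (l b)) (overwrite j x (r ∘ c))) y ∈ A}
  have hE : ∀ b, Insensitive b (E b) := by
    intro b c
    have : word (lab (l b)) (overwrite j x (r ∘ fillWith b c)) =
        word (lab (l b)) (overwrite j x (r ∘ c)) := by
      funext p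
      rcases p with p | p
      · by_cases hp : ∃ q, j q = p
        · obtain ⟨q, rfl⟩ := hp
          simp only [word, Sum.elim_inl, Function.comp_apply, overwrite_apply hj, fillWith]
          cases c q with
          | none => simp [lab, r, hi0]
          | some a => rfl
        · simp [word, overwrite_apply' _ _ _ hp]
      · rfl
    show Sum.elim (word _ _) y ∈ A ↔ Sum.elim (word _ _) y ∈ A
    rw [this]
  have hdisj : ∀ c, c ∈ A' → ¬ ∀ b, c ∈ E b := by
    intro c hc hcE
    let l' : Line (Option β) (((Fin m × Fin B) ⊕ Fin M) ⊕ ι2) :=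
      { idxFun := Sum.elim (Sum.elim (fun p => (s (overwrite j x (r ∘ c) p)).map some)
          (fun i => (l.idxFun i).map some)) (fun i => some (y i))
        proper := ⟨.inl (.inr i0), by simp [hi0]⟩ }
    refine hA ⟨l', fun a => ?_⟩
    cases a with
    | none =>
      have : l' none = Sum.elim (word s (overwrite j x (r ∘ c))) y := by
        funext p
        rcases p with (p | p) | p
        · simp only [Line.apply_def, l', word, Sum.elim_inl, Function.comp]
          cases s (overwrite j x (r ∘ c) p) <;> rfl
        · simp only [Line.apply_def, l', word, Sum.elim_inl, Sum.elim_inr, Function.comp, s]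
          cases l.idxFun p <;> rfl
        · rfl
      rw [this, ← hU]
      exact hc
    | some b =>
      have : l' (some b) = Sum.elim (word (lab (l b)) (overwrite j x (r ∘ c))) y := by
        funext p
        rcases p with (p | p) | p
        · simp only [Line.apply_def, l', word, Sum.elim_inl, Function.comp]
          cases overwrite j x (r ∘ c) p with
          | inl a => rfl
          | inr i =>
            simp only [s, lab, Sum.elim_inr, Function.comp]
            cases l.idxFun i <;> rfl
        · simp only [Line.apply_def, l', word, Sum.elim_inl, Sum.elim_inr, Function.comp, lab]
          cases l.idxFun p <;> rfl
        · rfl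
      rw [this]
      exact hcE b
  -- Densities on the subspace.
  have hA'u : (avg fun c => ind (c ∈ A')) ≤ δ + ε := hm2 (Fin m) (by simpa) A' hA'
  have hupp : ∀ V : Subspace (Fin d) (Option β) (Fin m), (avg fun c => ind (V c ∈ A')) ≤ δ + γ :=
    fun V => hd (Fin d) (by simp) {c | V c ∈ A'} (hA'.preimage V)
  have hnon : NonposOn d fun c : Fin m → Option β => ind (c ∈ A') - (δ + γ) := by
    intro V
    rw [avg_sub, avg_const]
    linarith [hupp V]
  have htile := hm1 (Fin m) (by simpa) E hE (fun c => ind (c ∈ A') - (δ + γ))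
    (fun c => by linarith [ind_le_one (c ∈ A')]) hnon
  have e1 : ∀ c : Fin m → Option β, (ind (c ∈ A') - (δ + γ)) * (1 - ∏ b, ind (c ∈ E b)) =
      ind (c ∈ A') - (δ + γ) + (δ + γ) * ind (∀ b, c ∈ E b) := by
    intro c
    rw [← ind_forall]
    by_cases hc : c ∈ A'
    · rw [ind_of_false (hdisj c hc)]; ring
    · rw [ind_of_false hc]; ring
  simp_rw [e1] at htile
  rw [avg_add, avg_sub, avg_const, avg_mul_left, Finset.card_univ,
    mul_div_cancel₀ _ (by positivity)] at htile
  have hUA : ∀ c, ind (Sum.elim (word s (overwrite j x (r ∘ c))) y ∈ A) = ind (c ∈ A') := by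
    intro c; rw [← hU]; rfl
  simp_rw [hUA] at hy
  change _ ≤ (avg fun c => ind (c ∈ A')) + γ * avg fun c => ind (∀ b, c ∈ E b) at hy
  have hD1 : (avg fun c => ind (∀ b, c ∈ E b)) ≤ 1 := avg_le_of_le fun x => ind_le_one _
  set a := avg fun c => ind (c ∈ A')
  set D := avg fun c => ind (∀ b, c ∈ E b)
  have hl' := mul_le_mul_of_nonneg_left hl hγ0.le
  have h1 : δ - ε + γ * θ - 2 * ε ≤ a + γ * D := by
    refine le_trans ?_ hy
    linarith
  have h2 : γ * (θ / 2) ≤ γ * D := by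
    have : 0 < γ * θ := by positivity
    linarith
  have h3 : θ / 2 ≤ D := le_of_mul_le_mul_left h2 hγ0
  have h4 : γ * D ≤ γ * 1 := mul_le_mul_of_nonneg_left hD1 hγ0.le
  have h5 : δ * (θ / 2) ≤ δ * D := mul_le_mul_of_nonneg_left h3 hδ0.le
  have h6 : 0 ≤ γ * D := mul_nonneg hγ0.le (by linarith)
  have h7 : γ * θ ≤ γ * 1 := mul_le_mul_of_nonneg_left hθ1 hγ0.le
  have h8 : 0 < γ * θ := by positivity
  nlinarith

end MainStep

theorem dhjAt_of_subsingleton {α : Type} [Subsingleton α] (δ : ℝ) (hδ : 0 < δ) : DHJAt α δ := by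
  refine ⟨1, fun ι _ hι A hA => ?_⟩
  have : Nonempty ι := (Nat.card_pos_iff.1 (by omega)).1
  refine ⟨Line.diagonal α ι, fun a => ?_⟩
  have : Nonempty α := ⟨a⟩
  have : Finite α := inferInstance
  obtain ⟨x, hx⟩ := exists_avg_le fun x => ind (x ∈ A)
  have hxA : x ∈ A := by
    by_contra hc
    rw [ind_of_false hc] at hx
    linarith
  convert hxA

theorem DHJ.of_equiv {α β : Type} (e : α ≃ β) (h : DHJ α) : DHJ β := by
  intro δ hδ
  obtain ⟨n, hn⟩ := h δ hδ
  refine ⟨n, fun ι _ hι A hA => ?_⟩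
  obtain ⟨l, hl⟩ := hn ι hι {x | e ∘ x ∈ A} (by
    rw [← avg_equiv ((Equiv.refl ι).arrowCongr e)] at hA
    exact hA)
  refine ⟨l.map e, fun b => ?_⟩
  rw [← e.apply_symm_apply b, Line.map_apply]
  exact hl _

/-- **The density Hales–Jewett theorem.** -/
theorem dhj (α : Type) [Finite α] : DHJ α := by
  have := Fintype.ofFinite α
  induction α using Finite.induction_empty_option with
  | of_equiv e h =>
    have := Finite.of_equiv _ e.symm
    exact DHJ.of_equiv e (h (Fintype.ofFinite _))
  | h_empty => exact fun δ hδ => dhjAt_of_subsingleton δ hδ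
  | @h_option β _ ih =>
    by_cases hβ : Nonempty β
    · exact (ih inferInstance).option
    · have := not_nonempty_iff.1 hβ
      exact fun δ hδ => dhjAt_of_subsingleton δ hδ

/-! ### Szemerédi's theorem in cyclic groups, counting version -/

theorem avg_add_right {G : Type*} [AddGroup G] (f : G → ℝ) (a : G) :
    (avg fun x => f (x + a)) = avg f := avg_equiv (Equiv.addRight a) f

theorem avg_mul_isUnit {N : ℕ} (f : ZMod N → ℝ) {u : ZMod N} (hu : IsUnit u) :
    (avg fun x => f (x * u)) = avg f := by
  obtain ⟨u, rfl⟩ := hu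
  exact avg_equiv (Units.mulRight u) f

theorem isUnit_natCast_of_le {N n e : ℕ} (h : N.Coprime n.factorial) (h1 : 1 ≤ e) (h2 : e ≤ n) :
    IsUnit (e : ZMod N) := by
  rw [ZMod.isUnit_iff_coprime]
  exact (h.coprime_dvd_right (Nat.dvd_factorial h1 h2)).symm

theorem szemeredi_set (k : ℕ) (δ : ℝ) (hδ : 0 < δ) : ∃ n : ℕ, ∃ c : ℝ, 0 < c ∧
    ∀ (N : ℕ) [NeZero N], N.Coprime n.factorial → ∀ A : Set (ZMod N),
      δ ≤ (avg fun x => ind (x ∈ A)) →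
      c ≤ avg fun x : ZMod N => avg fun d : ZMod N => ind (∀ i : Fin k, x + (i : ℕ) * d ∈ A) := by
  by_cases hk : k = 0
  · subst hk
    refine ⟨0, 1, one_pos, fun N _ _ A _ => ?_⟩
    simp [ind_of_true, avg_const]
  have : Nonempty (Fin k) := ⟨⟨0, Nat.pos_of_ne_zero hk⟩⟩
  obtain ⟨n, hn⟩ := dhj (Fin k) (δ / 2) (by positivity)
  refine ⟨n, δ / 2 / (Nat.card (Line (Fin k) (Fin n)) + 1), by positivity, fun N _ hN A hA => ?_⟩
  let pt : (Fin n → Fin k) → ZMod N × ZMod N → ZMod N := fun c p => p.1 + p.2 * ∑ i, ((c i : ℕ) : ZMod N)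
  obtain ⟨l, hl⟩ := exists_frequent
    (fun (l : Line (Fin k) (Fin n)) (p : ZMod N × ZMod N) => ∀ a, pt (l a) p ∈ A)
    (fun p => avg fun c => ind (pt c p ∈ A)) δ hδ
    (fun p hp => hn (Fin n) (by simp) {c | pt c p ∈ A} hp)
    (fun p => avg_le_of_le fun v => ind_le_one _) (by
      rw [avg_comm]
      refine le_avg_of_le fun c => ?_
      rw [avg_prod, avg_comm]
      refine le_avg_of_le fun d => ?_
      simp only [pt]
      rw [avg_add_right (fun x => ind (x ∈ A))]
      exact hA)
  set s : ZMod N := ∑ i, (match l.idxFun i with | none => 0 | some b => ((b : ℕ) : ZMod N)) with hs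
  set e : ℕ := (Finset.univ.filter fun i => l.idxFun i = none).card with he
  have he1 : 1 ≤ e := by
    obtain ⟨i, hi⟩ := l.proper
    exact Finset.card_pos.2 ⟨i, by simpa using hi⟩
  have he2 : e ≤ n := (Finset.card_le_univ _).trans (by simp)
  have hsum : ∀ a : Fin k, ∑ i, ((l a i : ℕ) : ZMod N) = s + e * (a : ℕ) := by
    intro a
    have : (e : ZMod N) * (a : ℕ) = ∑ i, if l.idxFun i = none then ((a : ℕ) : ZMod N) else 0 := by
      rw [← Finset.sum_filter, Finset.sum_const, nsmul_eq_mul]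
    rw [this, hs, ← Finset.sum_add_distrib]
    refine Finset.sum_congr rfl fun i _ => ?_
    rw [Line.coe_apply]
    cases l.idxFun i <;> simp
  have hu : IsUnit (e : ZMod N) := isUnit_natCast_of_le hN he1 he2
  have hcard : (0 : ℝ) < Nat.card (Line (Fin k) (Fin n)) := by
    have : Nonempty (Line (Fin k) (Fin n)) := ⟨l⟩
    exact_mod_cast Nat.card_pos
  have h1 : δ / 2 / (Nat.card (Line (Fin k) (Fin n)) + 1) ≤ δ / 2 / (Nat.card (Line (Fin k) (Fin n))) := by
    gcongr
    linarith
  refine h1.trans (hl.trans (le_of_eq ?_))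
  rw [avg_prod, avg_comm,
    avg_comm fun (x : ZMod N) (d : ZMod N) => ind (∀ i : Fin k, x + (i : ℕ) * d ∈ A)]
  rw [← avg_mul_isUnit (fun d : ZMod N => avg fun x => ind (∀ i : Fin k, x + (i : ℕ) * d ∈ A)) hu]
  refine avg_congr fun d => ?_
  rw [← avg_add_right (fun x => ind (∀ i : Fin k, x + (i : ℕ) * (d * e) ∈ A)) (d * s)]
  refine avg_congr fun x => ind_congr (forall_congr' fun i => ?_)
  simp only [pt, hsum]
  rw [show x + d * (s + e * (i : ℕ)) = x + d * s + (i : ℕ) * (d * e) by ring]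

/-- **Szemerédi's theorem**, counting version for functions on cyclic groups. -/
theorem szemeredi (k : ℕ) (δ : ℝ) (hδ : 0 < δ) : ∃ n : ℕ, ∃ c : ℝ, 0 < c ∧
    ∀ (N : ℕ) [NeZero N], N.Coprime n.factorial → ∀ f : ZMod N → ℝ, (∀ x, 0 ≤ f x) →
      (∀ x, f x ≤ 1) → δ ≤ avg f →
      c ≤ avg fun x : ZMod N => avg fun d : ZMod N => ∏ i : Fin k, f (x + (i : ℕ) * d) := by
  obtain ⟨n, c, hc, h⟩ := szemeredi_set k (δ / 2) (by positivity)
  refine ⟨n, (δ / 2) ^ k * c, by positivity, fun N _ hN f hf0 hf1 hf => ?_⟩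
  have h1 := h N hN {x | δ / 2 ≤ f x} (by
    have : ∀ x, f x - δ / 2 ≤ ind (x ∈ {x | δ / 2 ≤ f x}) := by
      intro x
      by_cases hx : δ / 2 ≤ f x
      · rw [ind_of_true (show x ∈ {x | δ / 2 ≤ f x} from hx)]
        linarith [hf1 x]
      · rw [ind_of_false (show x ∉ {x | δ / 2 ≤ f x} from hx)]
        linarith
    have := avg_mono this
    rw [avg_sub, avg_const] at this
    linarith)
  refine (mul_le_mul_of_nonneg_left h1 (by positivity)).trans ?_
  simp_rw [← avg_mul_left]
  refine avg_mono fun x => avg_mono fun d => ?_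
  rw [ind_forall]
  calc (δ / 2) ^ k * ∏ i : Fin k, ind (x + (i : ℕ) * d ∈ {x | δ / 2 ≤ f x})
      = ∏ i : Fin k, (δ / 2 * ind (x + (i : ℕ) * d ∈ {x | δ / 2 ≤ f x})) := by
        rw [Finset.prod_mul_distrib, Finset.prod_const, Finset.card_univ, Fintype.card_fin]
    _ ≤ _ := by
        refine Finset.prod_le_prod (fun i _ => mul_nonneg (by positivity) (ind_nonneg _))
          fun i _ => ?_
        by_cases hx : δ / 2 ≤ f (x + (i : ℕ) * d)
        · rw [ind_of_true (by exact hx)]; linarith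
        · rw [ind_of_false (by exact hx), mul_zero]; exact hf0 _

/-! ### Weighted Gowers–Cauchy–Schwarz inequality -/

open Function

section Independence

variable {Y X : Type} [DecidableEq Y]

/-- `F` does not depend on the coordinate `p`. -/
def IndepOf (p : Y) (F : (Y → X) → ℝ) : Prop := ∀ x t, F (update x p t) = F x

theorem IndepOf.mul {p : Y} {F G : (Y → X) → ℝ} (hF : IndepOf p F) (hG : IndepOf p G) :
    IndepOf p fun x => F x * G x := fun x t => by simp only [hF x t, hG x t]

theorem IndepOf.prod {p : Y} {ι : Type*} {F : ι → (Y → X) → ℝ} {s : Finset ι}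
    (hF : ∀ i ∈ s, IndepOf p (F i)) :
    IndepOf p fun x => ∏ i ∈ s, F i x :=
  fun x t => Finset.prod_congr rfl fun i hi => hF i hi x t

variable [Finite Y] [Finite X]

theorem avg_update [Nonempty X] (p : Y) (F : (Y → X) → ℝ) :
    (avg fun x => avg fun t => F (update x p t)) = avg F := by
  let σ : (Y → X) × X → (Y → X) × X := fun a => (update a.1 p a.2, a.1 p)
  have hσ : Involutive σ := by
    rintro ⟨x, c⟩
    simp [σ]
  have h := avg_equiv hσ.toPerm (fun a : (Y → X) × X => F a.1)
  rw [avg_prod, avg_prod] at h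
  simp only [avg_const] at h
  exact h

theorem avg_mul_indep [Nonempty X] {p : Y} {A B : (Y → X) → ℝ} (hA : IndepOf p A) :
    (avg fun x => A x * B x) = avg fun x => A x * avg fun t => B (update x p t) := by
  rw [← avg_update p]
  refine avg_congr fun x => ?_
  rw [← avg_mul_left]
  exact avg_congr fun t => by rw [hA]

theorem gowers_cauchy_schwarz_step [Nonempty X] {p q : Y} (hpq : p ≠ q)
    {A A' B : (Y → X) → ℝ} (hA : IndepOf p A) (hA'p : IndepOf p A') (hA'q : IndepOf q A')
    (hB : IndepOf q B) (h : ∀ x, |A x| ≤ A' x) :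
    (avg fun x => A x * B x) ^ 2 ≤
      avg A' * avg fun x => A' x * (B x * B (x ∘ Equiv.swap p q)) := by
  set m : (Y → X) → ℝ := fun x => avg fun t => B (update x p t) with hm
  have hmp : IndepOf p m := fun x t => by simp [hm]
  have h0 : ∀ x, 0 ≤ A' x := fun x => (abs_nonneg _).trans (h x)
  have h1 : (avg fun x => A x * B x) = avg fun x => A x * m x := avg_mul_indep hA
  have h2 : (avg fun x => A' x * (B x * B (x ∘ Equiv.swap p q))) = avg fun x => A' x * m x ^ 2 := by
    rw [← avg_update q]
    have e1 : ∀ x : Y → X, (avg fun t => A' (update x q t) * (B (update x q t) *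
        B (update x q t ∘ Equiv.swap p q))) = A' x * m x * B x := by
      intro x
      rw [mul_right_comm, ← avg_mul_left]
      refine avg_congr fun t => ?_
      rw [hA'q, hB, mul_assoc]
      congr 2
      have : update x q t ∘ Equiv.swap p q = update (update x p t) q (x p) := by
        funext y
        by_cases hy : y = q
        · subst hy; simp [hpq]
        · by_cases hy' : y = p
          · subst hy'; simp [hpq]
          · simp [hy, hy', Equiv.swap_apply_of_ne_of_ne hy' hy]
      rw [this, hB]
    simp_rw [e1]
    rw [avg_mul_indep (hA'p.mul hmp)]
    exact avg_congr fun x => by ring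
  rw [h1, h2]
  have h3 : |avg fun x => A x * m x| ≤ avg fun x => A' x * |m x| :=
    (abs_avg_le _).trans (avg_mono fun x => by
      rw [abs_mul]; exact mul_le_mul_of_nonneg_right (h x) (abs_nonneg _))
  calc (avg fun x => A x * m x) ^ 2 = |avg fun x => A x * m x| ^ 2 := (sq_abs _).symm
    _ ≤ (avg fun x => A' x * |m x|) ^ 2 := pow_le_pow_left₀ (abs_nonneg _) h3 2
    _ ≤ avg A' * avg fun x => A' x * |m x| ^ 2 := avg_mul_sq_le_weighted _ _ h0
    _ = _ := by simp_rw [sq_abs]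

end Independence

section Labels

variable {I X : Type} [DecidableEq I]

/-- The point of `I → X` obtained by selecting, for each coordinate, one of two copies. -/
def pick (ω : I → Bool) (x : I ⊕ I → X) : I → X := fun i => x (cond (ω i) (.inr i) (.inl i))

/-- The weight `ν j` evaluated at the point selected by `ω`. -/
def liftWeight (ν : I → (I → X) → ℝ) (p : I × (I → Bool)) (x : I ⊕ I → X) : ℝ :=
  ν p.1 (pick p.2 x)

/-- The doubling of a label in the coordinate `i`. -/
def flipLabel (i : I) (p : I × (I → Bool)) : I × (I → Bool) := (p.1, update p.2 i true)

/-- The linear forms condition with error `ε`. -/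
def LinearFormsCondition (ν : I → (I → X) → ℝ) (ε : ℝ) : Prop :=
  ∀ S : Finset (I × (I → Bool)), (∀ p ∈ S, p.2 p.1 = false) →
    |(avg fun x => ∏ p ∈ S, liftWeight ν p x) - 1| ≤ ε

theorem liftWeight_indep_inr {ν : I → (I → X) → ℝ} {p : I × (I → Bool)} {i : I}
    (h : p.2 i = false) : IndepOf (Sum.inr i) (liftWeight ν p) := by
  intro x t
  simp only [liftWeight]
  congr 1
  funext a
  simp only [pick]
  cases ha : p.2 a with
  | false => simp
  | true =>
    have : a ≠ i := fun hai => by simp [hai, h] at ha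
    simp [this]

theorem liftWeight_indep_inl {ν : I → (I → X) → ℝ} (hν : ∀ j, IndepOf j (ν j))
    {p : I × (I → Bool)} {i : I} (h : p.1 = i) : IndepOf (Sum.inl i) (liftWeight ν p) := by
  intro x t
  subst h
  simp only [liftWeight]
  rw [← hν p.1 (pick p.2 x) (pick p.2 (update x (.inl p.1) t) p.1)]
  congr 1
  funext a
  by_cases ha : a = p.1
  · subst ha; simp
  · simp only [update_of_ne ha]
    simp only [pick]
    cases p.2 a <;> simp [ha]

theorem liftWeight_swap {ν : I → (I → X) → ℝ} {p : I × (I → Bool)} {i : I} (h : p.2 i = false)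
    (x : I ⊕ I → X) :
    liftWeight ν p (x ∘ Equiv.swap (.inl i) (.inr i)) = liftWeight ν (flipLabel i p) x := by
  simp only [liftWeight, flipLabel]
  congr 1
  funext a
  simp only [pick, comp]
  by_cases ha : a = i
  · subst ha; simp [h]
  · rw [update_of_ne ha]
    cases p.2 a
    · simp [Equiv.swap_apply_of_ne_of_ne, ha]
    · simp [Equiv.swap_apply_of_ne_of_ne, ha]

theorem flipLabel_injOn {i : I} {S : Set (I × (I → Bool))} (hS : ∀ p ∈ S, p.2 i = false) :
    Set.InjOn (flipLabel i) S := by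
  rintro ⟨j, ω⟩ hp ⟨j', ω'⟩ hq h
  simp only [flipLabel, Prod.mk.injEq] at h
  refine Prod.ext h.1 ?_
  have h1 : ω i = false := hS _ hp
  have h2 : ω' i = false := hS _ hq
  funext a
  by_cases ha : a = i
  · subst ha; exact h1.trans h2.symm
  · simpa [ha] using congrFun h.2 a

/-- The error function in the weighted Gowers–Cauchy–Schwarz inequality. -/
noncomputable def gcsBound (C : ℝ) (ε : ℝ) : ℕ → ℝ
  | 0 => C * ε
  | n + 1 => √(2 * gcsBound C ε n)

theorem gcsBound_tendsto (C : ℝ) (n : ℕ) :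
    Filter.Tendsto (fun ε => gcsBound C ε n) (nhds 0) (nhds 0) := by
  induction n with
  | zero => simpa [gcsBound] using (Filter.tendsto_id (x := nhds (0 : ℝ))).const_mul C
  | succ n ih => simpa [gcsBound] using (ih.const_mul 2).sqrt

omit [DecidableEq I] in
theorem LinearFormsCondition.avg_le_two {ν : I → (I → X) → ℝ} {ε : ℝ}
    (h : LinearFormsCondition ν ε) (hε : ε ≤ 1) (S : Finset (I × (I → Bool)))
    (hS : ∀ p ∈ S, p.2 p.1 = false) : (avg fun x => ∏ p ∈ S, liftWeight ν p x) ≤ 2 := by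
  have := (abs_le.1 (h S hS)).2
  linarith

variable [Fintype I] [Finite X] [Nonempty X]

omit [Nonempty X] in
theorem avg_prod_sub_one_le {ν : I → (I → X) → ℝ} {ε : ℝ} (hε : 0 ≤ ε)
    (h : LinearFormsCondition ν ε) (S S' : Finset (I × (I → Bool))) (hne : S.Nonempty)
    (hdisj : Disjoint S S') (hS : ∀ p ∈ S ∪ S', p.2 p.1 = false) :
    |avg fun x => (∏ p ∈ S, (liftWeight ν p x - 1)) * ∏ p ∈ S', liftWeight ν p x| ≤
      2 ^ Fintype.card (I × (I → Bool)) * ε := by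
  classical
  have e1 : ∀ x, (∏ p ∈ S, (liftWeight ν p x - 1)) * ∏ p ∈ S', liftWeight ν p x =
      ∑ t ∈ S.powerset, (∏ _p ∈ S \ t, (-1 : ℝ)) * ∏ p ∈ t ∪ S', liftWeight ν p x := by
    intro x
    simp_rw [sub_eq_add_neg]
    rw [Finset.prod_add, Finset.sum_mul]
    refine Finset.sum_congr rfl fun t ht => ?_
    rw [Finset.prod_union (Finset.disjoint_of_subset_left (Finset.mem_powerset.1 ht) hdisj)]
    ring
  have e2 : (0 : ℝ) = ∑ t ∈ S.powerset, (∏ _p ∈ S \ t, (-1 : ℝ)) := by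
    have := Finset.prod_add (fun _ => (1 : ℝ)) (fun _ => -1) S
    simp only [Finset.prod_const_one, one_mul] at this
    rw [← this, Finset.prod_const, add_neg_cancel, zero_pow hne.card_pos.ne']
  simp_rw [e1]
  rw [avg_sum]
  simp_rw [avg_mul_left]
  have e3 : ∑ t ∈ S.powerset, (∏ _p ∈ S \ t, (-1 : ℝ)) *
      (avg fun x => ∏ p ∈ t ∪ S', liftWeight ν p x) =
      ∑ t ∈ S.powerset, (∏ _p ∈ S \ t, (-1 : ℝ)) *
      ((avg fun x => ∏ p ∈ t ∪ S', liftWeight ν p x) - 1) := by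
    simp_rw [mul_sub, mul_one]
    rw [Finset.sum_sub_distrib, ← e2, sub_zero]
  rw [e3]
  refine (Finset.abs_sum_le_sum_abs _ _).trans ?_
  have : ∀ t ∈ S.powerset, |(∏ _p ∈ S \ t, (-1 : ℝ)) *
      ((avg fun x => ∏ p ∈ t ∪ S', liftWeight ν p x) - 1)| ≤ ε := by
    intro t ht
    rw [abs_mul, Finset.abs_prod]
    simp only [abs_neg, abs_one, Finset.prod_const_one, one_mul]
    exact h _ fun p hp => hS p (Finset.union_subset_union_left (Finset.mem_powerset.1 ht) hp)
  refine (Finset.sum_le_card_nsmul _ _ _ this).trans ?_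
  rw [Finset.card_powerset, nsmul_eq_mul]
  push_cast
  gcongr
  · norm_num
  · exact Finset.card_le_univ S

/-- **Weighted Gowers–Cauchy–Schwarz**: correlations of `ν j - 1` with products of functions,
each dominated by weights and independent of some coordinate, are small. -/
theorem gowers_cauchy_schwarz {ν : I → (I → X) → ℝ} (hν : ∀ j, IndepOf j (ν j)) {ε : ℝ}
    (hε : 0 ≤ ε) (hε1 : ε ≤ 1) (h : LinearFormsCondition ν ε) (L : List I) :
    L.Nodup → ∀ (S S' : Finset (I × (I → Bool))) (T : I → Finset (I × (I → Bool)))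
    (A : I → (I ⊕ I → X) → ℝ), S.Nonempty → Disjoint S S' →
    (∀ p ∈ S ∪ S', p.2 p.1 = false ∧ p.1 ∉ L ∧ ∀ i ∈ L, p.2 i = false) →
    (∀ i ∈ L, ∀ p ∈ T i, p.2 p.1 = false ∧ p.1 = i ∧ ∀ i ∈ L, p.2 i = false) →
    (∀ i ∈ L, IndepOf (.inl i) (A i)) → (∀ i ∈ L, ∀ i' ∈ L, IndepOf (.inr i') (A i)) →
    (∀ i ∈ L, ∀ x, |A i x| ≤ ∏ p ∈ T i, liftWeight ν p x) →
    |avg fun x => (∏ p ∈ S, (liftWeight ν p x - 1)) * (∏ p ∈ S', liftWeight ν p x) *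
      (L.map fun i => A i x).prod| ≤ gcsBound (2 ^ Fintype.card (I × (I → Bool))) ε L.length := by
  classical
  induction L with
  | nil =>
    intro _ S S' T A hne hdisj hS _ _ _ _
    simp only [List.map_nil, List.prod_nil, mul_one, List.length_nil, gcsBound]
    exact avg_prod_sub_one_le hε h S S' hne hdisj fun p hp => (hS p hp).1
  | cons i L ih =>
    intro hnd S S' T A hne hdisj hS hT hAl hAr hAT
    have hiL : i ∉ L := (List.nodup_cons.1 hnd).1
    have hmem : ∀ {i'}, i' ∈ L → i' ∈ i :: L := fun h => List.mem_cons_of_mem _ h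
    have hi : i ∈ i :: L := List.mem_cons_self
    have hne' : ∀ {i'}, i' ∈ L → i' ≠ i := fun h hh => hiL (hh ▸ h)
    have hSi : ∀ p ∈ S, p.2 i = false := fun p hp =>
      (hS p (Finset.mem_union_left _ hp)).2.2 i hi
    have hSi' : ∀ p ∈ S', p.2 i = false := fun p hp =>
      (hS p (Finset.mem_union_right _ hp)).2.2 i hi
    have hflip : ∀ p : I × (I → Bool), (flipLabel i p).2 i = true := fun p => by simp [flipLabel]
    have hdf : ∀ U U' : Finset (I × (I → Bool)), (∀ p ∈ U, p.2 i = false) →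
        Disjoint U (U'.image (flipLabel i)) := by
      intro U U' hU
      rw [Finset.disjoint_left]
      rintro p hp hq
      obtain ⟨q, -, rfl⟩ := Finset.mem_image.1 hq
      have := hU _ hp
      rw [hflip] at this
      exact Bool.noConfusion this
    have hprodflip : ∀ (U : Finset (I × (I → Bool))) (F : ℝ → ℝ) (x : I ⊕ I → X),
        (∀ p ∈ U, p.2 i = false) → ∏ p ∈ U.image (flipLabel i), F (liftWeight ν p x) =
          ∏ p ∈ U, F (liftWeight ν p (x ∘ Equiv.swap (.inl i) (.inr i))) := by
      intro U F x hU
      rw [Finset.prod_image (flipLabel_injOn hU)]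
      exact Finset.prod_congr rfl fun p hp => by rw [liftWeight_swap (hU p hp)]
    have hprodU : ∀ (U : Finset (I × (I → Bool))) (F : ℝ → ℝ) (x : I ⊕ I → X),
        (∀ p ∈ U, p.2 i = false) → ∏ p ∈ U ∪ U.image (flipLabel i), F (liftWeight ν p x) =
          (∏ p ∈ U, F (liftWeight ν p x)) *
          ∏ p ∈ U, F (liftWeight ν p (x ∘ Equiv.swap (.inl i) (.inr i))) := by
      intro U F x hU
      rw [Finset.prod_union (hdf U U hU), hprodflip U F x hU]
    have hflip_ok : ∀ {p : I × (I → Bool)}, p.2 p.1 = false → p.1 ≠ i →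
        (flipLabel i p).2 (flipLabel i p).1 = false := by
      intro p hp hpi
      simp [flipLabel, hpi, hp]
    have hflip_L : ∀ {p : I × (I → Bool)}, (∀ i' ∈ i :: L, p.2 i' = false) →
        ∀ i' ∈ L, (flipLabel i p).2 i' = false := by
      intro p hp i' hi'
      simp [flipLabel, hne' hi', hp i' (hmem hi')]
    -- One application of Cauchy–Schwarz.
    set B : (I ⊕ I → X) → ℝ := fun x => (∏ p ∈ S, (liftWeight ν p x - 1)) *
      (∏ p ∈ S', liftWeight ν p x) * (L.map fun i => A i x).prod with hB
    have hlist : ∀ (q : I ⊕ I), (∀ i' ∈ L, IndepOf q (A i')) →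
        IndepOf q fun x => (L.map fun i => A i x).prod := by
      intro q hq x t
      exact congrArg List.prod (List.map_congr_left fun i' hi' => hq i' hi' x t)
    have hBq : IndepOf (.inr i) B := by
      refine IndepOf.mul (IndepOf.mul (IndepOf.prod fun p hp x t => ?_)
        (IndepOf.prod fun p hp => liftWeight_indep_inr (hSi' p hp)))
        (hlist _ fun i' hi' => hAr i' (hmem hi') i hi)
      rw [liftWeight_indep_inr (hSi p hp)]
    have hcs := gowers_cauchy_schwarz_step (p := Sum.inl i) (q := Sum.inr i) (by simp)
      (A := A i) (A' := fun x => ∏ p ∈ T i, liftWeight ν p x) (B := B) (hAl i hi)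
      (IndepOf.prod fun p hp => liftWeight_indep_inl hν (hT i hi p hp).2.1)
      (IndepOf.prod fun p hp => liftWeight_indep_inr ((hT i hi p hp).2.2 i hi))
      hBq (hAT i hi)
    have hT2 := h.avg_le_two hε1 (T i) fun p hp => (hT i hi p hp).1
    have hS2i : ∀ p ∈ S ∪ S', p.1 ≠ i := fun p hp hpi => (hS p hp).2.1 (hpi ▸ hi)
    have hrec := ih (List.nodup_cons.1 hnd).2 (S ∪ S.image (flipLabel i))
      (T i ∪ (S' ∪ S'.image (flipLabel i))) (fun i' => T i' ∪ (T i').image (flipLabel i))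
      (fun i' x => A i' x * A i' (x ∘ Equiv.swap (.inl i) (.inr i)))
      (hne.mono Finset.subset_union_left) (by
        have hTS : ∀ p ∈ T i, p.1 = i := fun p hp => (hT i hi p hp).2.1
        rw [Finset.disjoint_left]
        intro p hp hq
        have hpi : p.1 ≠ i := by
          rcases Finset.mem_union.1 hp with hp | hp
          · exact hS2i p (Finset.mem_union_left _ hp)
          · obtain ⟨a, ha, rfl⟩ := Finset.mem_image.1 hp
            exact hS2i a (Finset.mem_union_left _ ha)
        rcases Finset.mem_union.1 hq with hq | hq
        · exact hpi (hTS p hq)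
        rcases Finset.mem_union.1 hp with hp | hp <;> rcases Finset.mem_union.1 hq with hq | hq
        · exact Finset.disjoint_left.1 hdisj hp hq
        · exact Finset.disjoint_left.1 (hdf S S' hSi) hp hq
        · exact Finset.disjoint_left.1 (hdf S' S hSi') hq hp
        · obtain ⟨a, ha, rfl⟩ := Finset.mem_image.1 hp
          obtain ⟨b, hb, hab⟩ := Finset.mem_image.1 hq
          have : a = b := flipLabel_injOn (S := {p | p.2 i = false}) (fun p hp => hp)
            (hSi a ha) (hSi' b hb) hab.symm
          subst this
          exact Finset.disjoint_left.1 hdisj ha hb)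
      (by
        have key : ∀ p ∈ S ∪ S', (p.2 p.1 = false ∧ p.1 ∉ L ∧ ∀ i ∈ L, p.2 i = false) ∧
            ((flipLabel i p).2 (flipLabel i p).1 = false ∧ (flipLabel i p).1 ∉ L ∧
              ∀ i' ∈ L, (flipLabel i p).2 i' = false) := by
          intro p hp
          obtain ⟨h1, h2, h3⟩ := hS p hp
          have h2' : p.1 ∉ L := fun hc => h2 (hmem hc)
          exact ⟨⟨h1, h2', fun i' hi' => h3 i' (hmem hi')⟩, hflip_ok h1 (hS2i p hp), h2', hflip_L h3⟩
        intro p hp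
        simp only [Finset.mem_union, Finset.mem_image] at hp
        rcases hp with (hp | ⟨q, hq, rfl⟩) | hp | hp | ⟨q, hq, rfl⟩
        · exact (key p (Finset.mem_union_left _ hp)).1
        · exact (key q (Finset.mem_union_left _ hq)).2
        · obtain ⟨h1, h2, h3⟩ := hT i hi p hp
          exact ⟨h1, h2 ▸ hiL, fun i' hi' => h3 i' (hmem hi')⟩
        · exact (key p (Finset.mem_union_right _ hp)).1
        · exact (key q (Finset.mem_union_right _ hq)).2)
      (by
        intro i' hi' p hp
        rcases Finset.mem_union.1 hp with hp | hp
        · obtain ⟨h1, h2, h3⟩ := hT i' (hmem hi') p hp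
          exact ⟨h1, h2, fun a ha => h3 a (hmem ha)⟩
        · obtain ⟨q, hq, rfl⟩ := Finset.mem_image.1 hp
          obtain ⟨h1, h2, h3⟩ := hT i' (hmem hi') q hq
          exact ⟨hflip_ok h1 (h2 ▸ hne' hi'), h2, hflip_L h3⟩)
      (by
        intro i' hi' x t
        have e : update x (Sum.inl i') t ∘ Equiv.swap (Sum.inl i) (Sum.inr i) =
            update (x ∘ Equiv.swap (Sum.inl i) (Sum.inr i)) (Sum.inl i') t := by
          rw [Function.update_comp_equiv]
          rw [Equiv.symm_swap, Equiv.swap_apply_of_ne_of_ne (by simp [hne' hi']) (by simp)]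
        beta_reduce
        rw [e, hAl i' (hmem hi'), hAl i' (hmem hi')])
      (by
        intro a ha i' hi' x t
        have e : update x (Sum.inr i') t ∘ Equiv.swap (Sum.inl i) (Sum.inr i) =
            update (x ∘ Equiv.swap (Sum.inl i) (Sum.inr i)) (Sum.inr i') t := by
          rw [Function.update_comp_equiv]
          rw [Equiv.symm_swap, Equiv.swap_apply_of_ne_of_ne (by simp) (by simp [hne' hi'])]
        beta_reduce
        rw [e, hAr a (hmem ha) i' (hmem hi'), hAr a (hmem ha) i' (hmem hi')])
      (by
        intro i' hi' x
        rw [show _ = _ from hprodU (T i') (fun a => a) x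
          (fun p hp => (hT i' (hmem hi') p hp).2.2 i hi), abs_mul]
        exact mul_le_mul (hAT i' (hmem hi') x) (hAT i' (hmem hi') _) (abs_nonneg _)
          ((abs_nonneg _).trans (hAT i' (hmem hi') x)))
    have hTS' : Disjoint (T i) (S' ∪ S'.image (flipLabel i)) := by
      rw [Finset.disjoint_left]
      intro p hp hq
      have hpi := (hT i hi p hp).2.1
      rcases Finset.mem_union.1 hq with hq | hq
      · exact hS2i p (Finset.mem_union_right _ hq) hpi
      · obtain ⟨a, ha, rfl⟩ := Finset.mem_image.1 hq
        exact hS2i a (Finset.mem_union_right _ ha) hpi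
    have hfin : ∀ x, (∏ p ∈ S ∪ S.image (flipLabel i), (liftWeight ν p x - 1)) *
        (∏ p ∈ T i ∪ (S' ∪ S'.image (flipLabel i)), liftWeight ν p x) *
        (L.map fun i' => A i' x * A i' (x ∘ Equiv.swap (.inl i) (.inr i))).prod =
        (∏ p ∈ T i, liftWeight ν p x) * (B x * B (x ∘ Equiv.swap (.inl i) (.inr i))) := by
      intro x
      rw [hprodU S (fun a => a - 1) x hSi, Finset.prod_union hTS', show _ = _ from hprodU S' (fun a => a) x hSi',
        List.prod_map_mul, hB]
      ring
    simp_rw [hfin] at hrec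
    have e0 : ∀ x, (∏ p ∈ S, (liftWeight ν p x - 1)) * (∏ p ∈ S', liftWeight ν p x) *
      ((i :: L).map fun i => A i x).prod = A i x * B x := by
      intro x
      rw [List.map_cons, List.prod_cons, hB]; ring
    simp_rw [e0]
    rw [List.length_cons, gcsBound, ← Real.sqrt_sq_eq_abs]
    refine Real.sqrt_le_sqrt (hcs.trans ?_)
    set Q := avg fun x => (∏ p ∈ T i, liftWeight ν p x) *
      (B x * B (x ∘ Equiv.swap (.inl i) (.inr i)))
    have hT0 : 0 ≤ avg fun x => ∏ p ∈ T i, liftWeight ν p x :=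
      avg_nonneg fun x => (abs_nonneg _).trans (hAT i hi x)
    calc _ ≤ (avg fun x => ∏ p ∈ T i, liftWeight ν p x) * |Q| :=
          mul_le_mul_of_nonneg_left (le_abs_self _) hT0
      _ ≤ 2 * _ := mul_le_mul hT2 hrec (abs_nonneg _) (by norm_num)

end Labels

/-! ### The relative counting lemma -/

section Counting

variable {I X : Type} [DecidableEq I]

/-- The average of `F` over the coordinate `j`. -/
noncomputable def avgAt (j : I) (F : (I → X) → ℝ) (x : I → X) : ℝ := avg fun t => F (update x j t)

theorem avgAt_indep (j : I) (F : (I → X) → ℝ) : IndepOf j (avgAt j F) := fun x t => by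
  simp [avgAt]

theorem avgAt_mul_of_indep [Finite X] {j : I} {F G : (I → X) → ℝ} (hF : IndepOf j F)
    (x : I → X) : avgAt j (fun x => F x * G x) x = F x * avgAt j G x := by
  rw [avgAt, avgAt, ← avg_mul_left]
  exact avg_congr fun t => by rw [hF]

theorem avgAt_mono [Finite X] {j : I} {F G : (I → X) → ℝ} (h : ∀ x, F x ≤ G x) (x : I → X) :
    avgAt j F x ≤ avgAt j G x := avg_mono fun _ => h _

theorem avg_avgAt [Finite I] [Finite X] [Nonempty X] (j : I) (F : (I → X) → ℝ) :
    avg (avgAt j F) = avg F := avg_update j F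

omit [DecidableEq I] in
theorem avg_pick_false [Finite I] [Finite X] [Nonempty X] (F : (I → X) → ℝ) :
    (avg fun z => F (pick (fun _ => false) z)) = avg F := by
  rw [avg_sumArrow]
  exact avg_congr fun x => avg_const (X := I → X) (F x)

theorem avg_avgAt_mul [Finite I] [Finite X] [Nonempty X] (j : I) (F G : (I → X) → ℝ) :
    (avg fun x => avgAt j F x * avgAt j G x) = avg fun z =>
      F (pick (fun _ => false) z) * G (pick (update (fun _ => false) j true) z) := by
  rw [avg_sumArrow]
  have e1 : ∀ x : I → X, (avg fun y => F (pick (fun _ => false) (Sum.elim x y)) *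
      G (pick (update (fun _ => false) j true) (Sum.elim x y))) = avgAt j G x * F x := by
    intro x
    have : ∀ y : I → X, pick (update (fun _ => false) j true) (Sum.elim x y) =
        update x j (y j) := by
      intro y
      funext i
      by_cases hi : i = j
      · subst hi; simp [pick]
      · simp [pick, hi]
    have e2 : ∀ y : I → X, pick (fun _ => false) (Sum.elim x y) = x := fun y => rfl
    simp_rw [this, e2]
    rw [avg_mul_left, avg_pi_eval j fun t => G (update x j t), mul_comm]
    rfl
  simp_rw [e1]
  rw [avg_mul_indep (avgAt_indep j G)]
  exact avg_congr fun x => mul_comm _ _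

/-- The family `a` is bounded by the weights `ν`, or by one. -/
def Dominated (ν a : I → (I → X) → ℝ) : Prop := (∀ i x, |a i x| ≤ ν i x) ∨ ∀ i x, |a i x| ≤ 1

omit [DecidableEq I] in
theorem Dominated.exists_labels {ν a : I → (I → X) → ℝ} (h : Dominated ν a) (ω : I → Bool) :
    ∃ T : I → Finset (I × (I → Bool)), (∀ i, ∀ p ∈ T i, p = (i, ω)) ∧
      ∀ i x, |liftWeight a (i, ω) x| ≤ ∏ p ∈ T i, liftWeight ν p x := by
  rcases h with h | h
  · exact ⟨fun i => {(i, ω)}, fun i p hp => Finset.mem_singleton.1 hp, fun i x => by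
      rw [Finset.prod_singleton]; exact h _ _⟩
  · exact ⟨fun i => ∅, fun i p hp => absurd hp (Finset.notMem_empty _), fun i x => by
      rw [Finset.prod_empty]; exact h _ _⟩

variable [Fintype I]

theorem length_toList_erase (j : I) :
    (Finset.univ.erase j).toList.length = Fintype.card I - 1 := by
  rw [Finset.length_toList, Finset.card_erase_of_mem (Finset.mem_univ j), Finset.card_univ]

variable [Finite X] [Nonempty X]

/-- The strong linear forms condition. -/
theorem abs_avg_weight_sub_one_mul_le {ν : I → (I → X) → ℝ} (hν : ∀ j, IndepOf j (ν j)) {ε : ℝ}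
    (hε : 0 ≤ ε) (hε1 : ε ≤ 1) (h : LinearFormsCondition ν ε) (j : I) {a b : I → (I → X) → ℝ}
    (ha : ∀ i, IndepOf i (a i)) (hb : ∀ i, IndepOf i (b i)) (hda : Dominated ν a)
    (hdb : Dominated ν b) :
    |avg fun x => (ν j x - 1) * (avgAt j (fun x => ∏ i ∈ Finset.univ.erase j, a i x) x *
      avgAt j (fun x => ∏ i ∈ Finset.univ.erase j, b i x) x)| ≤
      gcsBound (2 ^ Fintype.card (I × (I → Bool))) ε (Fintype.card I - 1) := by
  have hj1 : IndepOf j fun x => ν j x - 1 := fun x t => by simp only [hν j x t]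
  obtain ⟨Ta, hTa, hTa'⟩ := hda.exists_labels fun _ => false
  obtain ⟨Tb, hTb, hTb'⟩ := hdb.exists_labels (update (fun _ => false) j true)
  have hL : ∀ i, i ∈ (Finset.univ.erase j).toList ↔ i ≠ j := fun i => by simp
  have := gowers_cauchy_schwarz hν hε hε1 h (Finset.univ.erase j).toList (Finset.nodup_toList _)
    {(j, fun _ => false)} ∅ (fun i => Ta i ∪ Tb i)
    (fun i x => liftWeight a (i, fun _ => false) x *
      liftWeight b (i, update (fun _ => false) j true) x) (Finset.singleton_nonempty _)
    (Finset.disjoint_empty_right _) (by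
      intro p hp
      rw [Finset.union_empty, Finset.mem_singleton] at hp
      subst hp
      simp) (by
      intro i hi p hp
      rw [hL] at hi
      rcases Finset.mem_union.1 hp with hp | hp
      · rw [hTa i p hp]; simp
      · rw [hTb i p hp]
        refine ⟨by simp [hi], rfl, fun i' hi' => ?_⟩
        rw [hL] at hi'
        simp [hi']) (by
      intro i _
      exact (liftWeight_indep_inl ha rfl).mul (liftWeight_indep_inl hb rfl)) (by
      intro i hi i' hi'
      rw [hL] at hi'
      exact (liftWeight_indep_inr rfl).mul (liftWeight_indep_inr (by simp [hi']))) (by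
      intro i hi x
      rw [abs_mul, Finset.prod_union]
      · exact mul_le_mul (hTa' i x) (hTb' i x) (abs_nonneg _) ((abs_nonneg _).trans (hTa' i x))
      · rw [Finset.disjoint_left]
        intro p hp hq
        have := (hTa i p hp).symm.trans (hTb i p hq)
        simp only [Prod.mk.injEq, true_and] at this
        have := congrFun this j
        simp at this)
  rw [length_toList_erase] at this
  convert this using 3
  simp_rw [← mul_assoc, ← avgAt_mul_of_indep hj1]
  rw [avg_avgAt_mul]
  refine avg_congr fun z => ?_
  rw [Finset.prod_singleton, Finset.prod_empty, mul_one, List.prod_map_mul,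
    Finset.prod_map_toList, Finset.prod_map_toList]
  simp only [liftWeight, mul_assoc]

/-- `h` is almost orthogonal to products of functions each of which omits a coordinate. -/
def CutSmall (j : I) (h : (I → X) → ℝ) (ε : ℝ) : Prop :=
  ∀ u : I → (I → X) → ℝ, (∀ i, IndepOf i (u i)) → (∀ i x, |u i x| ≤ 1) →
    |avg fun x => h x * ∏ i ∈ Finset.univ.erase j, u i x| ≤ ε

theorem LinearFormsCondition.cutSmall {ν : I → (I → X) → ℝ} (hν : ∀ j, IndepOf j (ν j)) {ε : ℝ}
    (hε : 0 ≤ ε) (hε1 : ε ≤ 1) (h : LinearFormsCondition ν ε) (j : I) :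
    CutSmall j (fun x => ν j x - 1)
      (gcsBound (2 ^ Fintype.card (I × (I → Bool))) ε (Fintype.card I - 1)) := by
  intro u hu hu1
  have hL : ∀ i, i ∈ (Finset.univ.erase j).toList ↔ i ≠ j := fun i => by simp
  have := gowers_cauchy_schwarz hν hε hε1 h (Finset.univ.erase j).toList (Finset.nodup_toList _)
    {(j, fun _ => false)} ∅ (fun i => ∅) (fun i x => liftWeight u (i, fun _ => false) x)
    (Finset.singleton_nonempty _) (Finset.disjoint_empty_right _) (by
      intro p hp
      rw [Finset.union_empty, Finset.mem_singleton] at hp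
      subst hp
      simp) (fun i hi p hp => absurd hp (Finset.notMem_empty _))
    (fun i _ => liftWeight_indep_inl hu rfl) (fun i _ i' _ => liftWeight_indep_inr rfl)
    (fun i _ x => by rw [Finset.prod_empty]; exact hu1 _ _)
  rw [length_toList_erase] at this
  convert this using 2
  rw [← avg_pick_false]
  refine avg_congr fun z => ?_
  rw [Finset.prod_singleton, Finset.prod_empty, mul_one, Finset.prod_map_toList]
  rfl

omit [Fintype I] [Finite X] [Nonempty X] in
theorem LinearFormsCondition.update_one {ν : I → (I → X) → ℝ} {ε : ℝ}
    (h : LinearFormsCondition ν ε) (j : I) :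
    LinearFormsCondition (update ν j fun _ => 1) ε := by
  intro S hS
  have := h (S.filter fun p => p.1 ≠ j) fun p hp => hS p (Finset.mem_filter.1 hp).1
  convert this using 4
  funext x
  rw [Finset.prod_filter]
  refine Finset.prod_congr rfl fun p _ => ?_
  by_cases hp : p.1 = j
  · simp [liftWeight, hp]
  · simp [liftWeight, hp]

/-- The second moment of the averaged weights around one. -/
theorem LinearFormsCondition.avg_avgAt_sub_one_sq_le {ν : I → (I → X) → ℝ} {ε : ℝ}
    (h : LinearFormsCondition ν ε) (j : I) :
    (avg fun x => (avgAt j (fun x => ∏ i ∈ Finset.univ.erase j, ν i x) x - 1) ^ 2) ≤ 3 * ε := by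
  set N := avgAt j (fun x => ∏ i ∈ Finset.univ.erase j, ν i x) with hN
  set ω : I → Bool := update (fun _ => false) j true
  set S := (Finset.univ.erase j).image fun i => (i, fun _ : I => false)
  set S' := (Finset.univ.erase j).image fun i => (i, ω)
  have hinj : ∀ ω : I → Bool, Set.InjOn (fun i : I => (i, ω)) (Finset.univ.erase j : Finset I) :=
    fun ω a _ b _ hab => (Prod.mk.inj hab).1
  have hSv : ∀ p ∈ S, p.2 p.1 = false := by
    intro p hp
    obtain ⟨i, hi, rfl⟩ := Finset.mem_image.1 hp
    rfl
  have hSv' : ∀ p ∈ S', p.2 p.1 = false := by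
    intro p hp
    obtain ⟨i, hi, rfl⟩ := Finset.mem_image.1 hp
    simp [ω, (Finset.mem_erase.1 hi).1]
  have hd : Disjoint S S' := by
    rw [Finset.disjoint_left]
    intro p hp hq
    obtain ⟨a, ha, rfl⟩ := Finset.mem_image.1 hp
    obtain ⟨b, hb, hab⟩ := Finset.mem_image.1 hq
    have := congrFun (Prod.mk.inj hab).2 j
    simp [ω] at this
  have h1 : |avg N - 1| ≤ ε := by
    convert h S hSv using 3
    rw [hN, avg_avgAt, ← avg_pick_false]
    exact avg_congr fun z => (Finset.prod_image (f := fun p => liftWeight ν p z) (hinj _)).symm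
  have h2 : |(avg fun x => N x * N x) - 1| ≤ ε := by
    convert h (S ∪ S') (fun p hp => (Finset.mem_union.1 hp).elim (hSv p) (hSv' p)) using 3
    rw [hN, avg_avgAt_mul]
    refine avg_congr fun z => ?_
    rw [Finset.prod_union hd, Finset.prod_image (hinj _), Finset.prod_image (hinj _)]
    rfl
  have h3 : (avg fun x => (N x - 1) ^ 2) = (avg fun x => N x * N x) - 2 * avg N + 1 := by
    rw [← avg_mul_left, ← avg_sub]
    conv_rhs => rw [← avg_const (X := I → X) 1, ← avg_add]
    exact avg_congr fun x => by ring
  rw [h3]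
  linarith [(abs_le.1 h1).1, (abs_le.1 h2).2]

omit [Finite X] [Nonempty X] in
theorem CutSmall.of_le {j : I} {h : (I → X) → ℝ} {ε ε' : ℝ} (hh : CutSmall j h ε) (he : ε ≤ ε') :
    CutSmall j h ε' := fun u hu hu1 => (hh u hu hu1).trans he

theorem cutSmall_zero (j : I) {ε : ℝ} (hε : 0 ≤ ε) :
    CutSmall j (fun _ : I → X => (0 : ℝ)) ε := by
  intro u _ _
  simp only [zero_mul]
  rw [avg_const, abs_zero]
  exact hε

omit [Nonempty X] in
/-- The counting lemma for bounded functions. -/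
theorem counting_lemma_bounded {f g : I → (I → X) → ℝ} (hf : ∀ i, IndepOf i (f i))
    (hg : ∀ i, IndepOf i (g i)) (hf1 : ∀ i x, |f i x| ≤ 1) (hg1 : ∀ i x, |g i x| ≤ 1) {ε : ℝ}
    (h : ∀ i, CutSmall i (fun x => f i x - g i x) ε) :
    |(avg fun x => ∏ i, f i x) - avg fun x => ∏ i, g i x| ≤ Fintype.card I * ε := by
  classical
  set F : Finset I → I → (I → X) → ℝ := fun s i => if i ∈ s then f i else g i with hF
  have key : ∀ s : Finset I,
      |(avg fun x => ∏ i, F s i x) - avg fun x => ∏ i, g i x| ≤ s.card * ε := by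
    intro s
    induction s using Finset.induction_on with
    | empty => simp [hF]
    | insert j s hj ih =>
      have e1 : ∀ x, (∏ i, F (insert j s) i x) - ∏ i, F s i x =
          (f j x - g j x) * ∏ i ∈ Finset.univ.erase j, F s i x := by
        intro x
        rw [← Finset.mul_prod_erase _ _ (Finset.mem_univ j),
          ← Finset.mul_prod_erase _ (fun i => F s i x) (Finset.mem_univ j), sub_mul]
        congr 1
        · congr 1
          · simp [hF]
          · refine Finset.prod_congr rfl fun i hi => ?_
            simp [hF, (Finset.mem_erase.1 hi).1]
        · simp [hF, hj]
      have e2 := h j (F s) (fun i => by simp only [hF]; split_ifs; exacts [hf i, hg i])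
        (fun i => by simp only [hF]; split_ifs; exacts [hf1 i, hg1 i])
      rw [← avg_congr e1, avg_sub] at e2
      rw [Finset.card_insert_of_notMem hj]
      push_cast
      calc _ = |((avg fun x => ∏ i, F (insert j s) i x) - avg fun x => ∏ i, F s i x) +
            ((avg fun x => ∏ i, F s i x) - avg fun x => ∏ i, g i x)| := by congr 1; ring
        _ ≤ _ := abs_add_le _ _
        _ ≤ (s.card + 1) * ε := by linarith
  have := key Finset.univ
  simpa [hF] using this

/-- The error function in the induction step of the relative counting lemma. -/
noncomputable def countingBound (I : Type) [Fintype I] [DecidableEq I] (η ε : ℝ) : ℝ :=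
  ε + √(2 * (4 * gcsBound (2 ^ Fintype.card (I × (I → Bool))) ε (Fintype.card I - 1) +
    3 * ε + 2 * √(3 * ε) + 2 * η))

theorem countingBound_tendsto (η : ℝ) :
    Filter.Tendsto (countingBound I η) (nhds 0) (nhds √(4 * η)) := by
  have h1 := (gcsBound_tendsto (2 ^ Fintype.card (I × (I → Bool))) (Fintype.card I - 1)).const_mul 4
  have h2 : Filter.Tendsto (fun ε : ℝ => 3 * ε) (nhds 0) (nhds (3 * 0)) :=
    Filter.tendsto_id.const_mul 3
  have := (Filter.tendsto_id (x := nhds (0 : ℝ))).add (((((h1.add h2).add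
    (h2.sqrt.const_mul 2)).add_const (2 * η)).const_mul 2).sqrt)
  convert this using 2
  · rfl
  rw [mul_zero, mul_zero, Real.sqrt_zero]
  ring_nf

/-- Removing the weight from one position. -/
theorem counting_lemma_step {ν f g : I → (I → X) → ℝ} (hν : ∀ j, IndepOf j (ν j))
    (hf : ∀ i, IndepOf i (f i)) (hg : ∀ i, IndepOf i (g i)) (hf0 : ∀ i x, 0 ≤ f i x)
    (hfν : ∀ i x, f i x ≤ ν i x) (hg0 : ∀ i x, 0 ≤ g i x) (hg1 : ∀ i x, g i x ≤ 1) {ε : ℝ}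
    (hε : 0 ≤ ε) (hε1 : ε ≤ 1) (hlfc : LinearFormsCondition ν ε) (j : I)
    (hcut : CutSmall j (fun x => f j x - g j x) ε) {η : ℝ}
    (hrec : ∀ h : (I → X) → ℝ, IndepOf j h → (∀ x, 0 ≤ h x) → (∀ x, h x ≤ 1) →
      |(avg fun x => ∏ i, update f j h i x) - avg fun x => ∏ i, update g j h i x| ≤ η) :
    |(avg fun x => ∏ i, f i x) - avg fun x => ∏ i, g i x| ≤ countingBound I η ε := by
  set f' := avgAt j (fun x => ∏ i ∈ Finset.univ.erase j, f i x) with hf'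
  set g' := avgAt j (fun x => ∏ i ∈ Finset.univ.erase j, g i x) with hg'
  set ν' := avgAt j (fun x => ∏ i ∈ Finset.univ.erase j, ν i x) with hν'
  have hf'i : IndepOf j f' := avgAt_indep _ _
  have hg'i : IndepOf j g' := avgAt_indep _ _
  have hν0 : ∀ i x, 0 ≤ ν i x := fun i x => (hf0 i x).trans (hfν i x)
  have hf'0 : ∀ x, 0 ≤ f' x := fun x => avg_nonneg fun t => Finset.prod_nonneg fun i _ => hf0 i _
  have hg'0 : ∀ x, 0 ≤ g' x := fun x => avg_nonneg fun t => Finset.prod_nonneg fun i _ => hg0 i _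
  have hf'ν : ∀ x, f' x ≤ ν' x := avgAt_mono fun x =>
    Finset.prod_le_prod (fun i _ => hf0 i x) fun i _ => hfν i x
  have hg'1 : ∀ x, g' x ≤ 1 := fun x => avg_le_of_le fun t =>
    Finset.prod_le_one (fun i _ => hg0 i _) fun i _ => hg1 i _
  have hsplit : ∀ F : I → (I → X) → ℝ, IndepOf j (F j) → (avg fun x => ∏ i, F i x) =
      avg fun x => F j x * avgAt j (fun x => ∏ i ∈ Finset.univ.erase j, F i x) x := by
    intro F hF
    simp_rw [← Finset.mul_prod_erase _ (fun i => F i _) (Finset.mem_univ j)]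
    exact avg_mul_indep hF
  have hsplit' : ∀ F : I → (I → X) → ℝ, ∀ h : (I → X) → ℝ, IndepOf j h →
      (avg fun x => ∏ i, update F j h i x) =
      avg fun x => h x * avgAt j (fun x => ∏ i ∈ Finset.univ.erase j, F i x) x := by
    intro F h hh
    rw [hsplit _ (by simpa using hh)]
    have : ∀ x, ∏ i ∈ Finset.univ.erase j, update F j h i x =
        ∏ i ∈ Finset.univ.erase j, F i x := fun x =>
      Finset.prod_congr rfl fun i hi => by rw [update_of_ne (Finset.mem_erase.1 hi).1]
    simp_rw [this]
    simp
  -- the position `j` of `f` is replaced by that of `g`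
  have hstep : |avg fun x => (f j x - g j x) * g' x| ≤ ε := by
    have e : ∀ h : (I → X) → ℝ, IndepOf j h → (avg fun x => h x * g' x) =
        avg fun x => h x * ∏ i ∈ Finset.univ.erase j, g i x := fun h hh =>
      (avg_mul_indep (B := fun x => ∏ i ∈ Finset.univ.erase j, g i x) hh).symm
    have hi : IndepOf j fun x => f j x - g j x := fun x t => by simp only [hf j x t, hg j x t]
    rw [e _ hi]
    exact hcut g hg fun i x => by rw [abs_of_nonneg (hg0 i x)]; exact hg1 i x
  -- the strong linear forms condition
  have hdf : Dominated ν f := Or.inl fun i x => by rw [abs_of_nonneg (hf0 i x)]; exact hfν i x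
  have hdg : Dominated ν g := Or.inr fun i x => by rw [abs_of_nonneg (hg0 i x)]; exact hg1 i x
  set γ := gcsBound (2 ^ Fintype.card (I × (I → Bool))) ε (Fintype.card I - 1) with hγ
  have hslf : (avg fun x => (ν j x - 1) * (f' x - g' x) ^ 2) ≤ 4 * γ := by
    have h1 := abs_avg_weight_sub_one_mul_le hν hε hε1 hlfc j hf hf hdf hdf
    have h2 := abs_avg_weight_sub_one_mul_le hν hε hε1 hlfc j hf hg hdf hdg
    have h3 := abs_avg_weight_sub_one_mul_le hν hε hε1 hlfc j hg hg hdg hdg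
    have e : (avg fun x => (ν j x - 1) * (f' x - g' x) ^ 2) =
        (avg fun x => (ν j x - 1) * (f' x * f' x)) - 2 * (avg fun x => (ν j x - 1) * (f' x * g' x))
        + avg fun x => (ν j x - 1) * (g' x * g' x) := by
      rw [← avg_mul_left, ← avg_sub, ← avg_add]
      exact avg_congr fun x => by ring
    rw [e]
    linarith [(abs_le.1 h1).2, (abs_le.1 h2).1, (abs_le.1 h3).2]
  -- the second moment of `f' - g'`
  have hsq : (avg fun x => (f' x - g' x) ^ 2) ≤ 3 * ε + 2 * √(3 * ε) + 2 * η := by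
    have h2 : (avg fun x => (ν' x - 1) ^ 2) ≤ 3 * ε := hlfc.avg_avgAt_sub_one_sq_le j
    have h1 : (avg fun x => |ν' x - 1|) ≤ √(3 * ε) := by
      refine Real.le_sqrt_of_sq_le ((sq_avg_le _).trans ?_)
      simpa only [sq_abs] using h2
    set m : (I → X) → ℝ := fun x => min (f' x) 1 with hm
    have hmi : IndepOf j m := fun x t => by simp only [hm, hf'i x t]
    have hr1 := hrec m hmi (fun x => le_min (hf'0 x) zero_le_one) (fun x => min_le_right _ _)
    have hr2 := hrec g' hg'i hg'0 hg'1
    rw [hsplit' _ _ hmi, hsplit' _ _ hmi, ← avg_sub] at hr1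
    rw [hsplit' _ _ hg'i, hsplit' _ _ hg'i, ← avg_sub] at hr2
    have hpt : ∀ x, (f' x - g' x) ^ 2 ≤ ((ν' x - 1) ^ 2 + 2 * |ν' x - 1|) +
        ((m x * f' x - m x * g' x) - (g' x * f' x - g' x * g' x)) := by
      intro x
      have a1 : 0 ≤ f' x - m x := sub_nonneg.2 (min_le_left _ _)
      have a2 : f' x - m x ≤ |ν' x - 1| := by
        rcases le_total (f' x) 1 with hle | hle
        · simp only [hm, min_eq_left hle, sub_self]; exact abs_nonneg _
        · simp only [hm, min_eq_right hle]
          exact (sub_le_sub_right (hf'ν x) 1).trans (le_abs_self _)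
      have a3 : f' x - g' x ≤ |ν' x - 1| + 2 := by
        linarith [hf'ν x, hg'0 x, le_abs_self (ν' x - 1)]
      have a4 : (f' x - g' x) * (f' x - m x) ≤ (|ν' x - 1| + 2) * |ν' x - 1| :=
        (mul_le_mul_of_nonneg_right a3 a1).trans
          (mul_le_mul_of_nonneg_left a2 (by positivity))
      have a5 := sq_abs (ν' x - 1)
      nlinarith [a4, a5]
    refine (avg_mono hpt).trans ?_
    rw [avg_add, avg_add, avg_sub, avg_mul_left]
    linarith [(abs_le.1 hr1).2, (abs_le.1 hr2).1]
  have hνj : avg (ν j) ≤ 2 := by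
    have := hlfc.avg_le_two hε1 {(j, fun _ => false)} (by simp)
    simp only [Finset.prod_singleton] at this
    rwa [show (avg fun x => liftWeight ν (j, fun _ => false) x) = avg (ν j) from
      avg_pick_false (ν j)] at this
  have hmain : (avg fun x => f j x * (f' x - g' x)) ^ 2 ≤
      2 * (4 * γ + 3 * ε + 2 * √(3 * ε) + 2 * η) := by
    have h1 : |avg fun x => f j x * (f' x - g' x)| ≤ avg fun x => ν j x * |f' x - g' x| :=
      (abs_avg_le _).trans (avg_mono fun x => by
        rw [abs_mul, abs_of_nonneg (hf0 j x)]
        exact mul_le_mul_of_nonneg_right (hfν j x) (abs_nonneg _))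
    have h2 : (avg fun x => ν j x * |f' x - g' x| ^ 2) ≤
        4 * γ + 3 * ε + 2 * √(3 * ε) + 2 * η := by
      have : (avg fun x => ν j x * |f' x - g' x| ^ 2) =
          (avg fun x => (ν j x - 1) * (f' x - g' x) ^ 2) + avg fun x => (f' x - g' x) ^ 2 := by
        rw [← avg_add]
        exact avg_congr fun x => by rw [sq_abs]; ring
      rw [this]
      linarith
    have h3 : 0 ≤ avg fun x => ν j x * |f' x - g' x| ^ 2 :=
      avg_nonneg fun x => mul_nonneg (hν0 j x) (sq_nonneg _)
    calc _ = |avg fun x => f j x * (f' x - g' x)| ^ 2 := (sq_abs _).symm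
      _ ≤ (avg fun x => ν j x * |f' x - g' x|) ^ 2 := pow_le_pow_left₀ (abs_nonneg _) h1 2
      _ ≤ avg (ν j) * avg fun x => ν j x * |f' x - g' x| ^ 2 :=
          avg_mul_sq_le_weighted _ _ (hν0 j)
      _ ≤ 2 * _ := mul_le_mul hνj h2 h3 (by norm_num)
  have e : (avg fun x => ∏ i, f i x) - (avg fun x => ∏ i, g i x) =
      (avg fun x => (f j x - g j x) * g' x) + avg fun x => f j x * (f' x - g' x) := by
    rw [hsplit f (hf j), hsplit g (hg j), ← avg_sub, ← avg_add]
    exact avg_congr fun x => by ring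
  rw [e]
  exact (abs_add_le _ _).trans (add_le_add hstep (Real.abs_le_sqrt hmain))

end Counting

/-- The relative counting lemma. -/
theorem counting_lemma (I : Type) [DecidableEq I] [Fintype I] (n : ℕ) : ∀ η : ℝ, 0 < η →
    ∃ ε₀ : ℝ, 0 < ε₀ ∧ ∀ (X : Type) [Finite X] [Nonempty X] (ν f g : I → (I → X) → ℝ),
      (∀ i, IndepOf i (ν i)) → (∀ i, IndepOf i (f i)) → (∀ i, IndepOf i (g i)) →
      (∀ i x, 0 ≤ f i x) → (∀ i x, f i x ≤ ν i x) → (∀ i x, 0 ≤ g i x) → (∀ i x, g i x ≤ 1) →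
      LinearFormsCondition ν ε₀ → (∀ i, CutSmall i (fun x => f i x - g i x) ε₀) →
      ∀ D : Finset I, D.card ≤ n → (∀ i ∉ D, ∀ x, ν i x = 1) →
      |(avg fun x => ∏ i, f i x) - avg fun x => ∏ i, g i x| ≤ η := by
  induction n with
  | zero =>
    intro η hη
    have hc : (0 : ℝ) < Fintype.card I + 1 := by positivity
    refine ⟨η / (Fintype.card I + 1), by positivity, ?_⟩
    intro X _ _ ν f g _ hf hg hf0 hfν hg0 hg1 _ hcut D hD hDν
    rw [Nat.le_zero, Finset.card_eq_zero] at hD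
    subst hD
    refine (counting_lemma_bounded hf hg (fun i x => ?_) (fun i x => ?_) hcut).trans ?_
    · rw [abs_of_nonneg (hf0 i x)]; exact (hfν i x).trans (hDν i (Finset.notMem_empty _) x).le
    · rw [abs_of_nonneg (hg0 i x)]; exact hg1 i x
    · rw [mul_div_assoc', div_le_iff₀ hc]
      nlinarith
  | succ n ih =>
    intro η hη
    obtain ⟨ε₁, hε₁, ih⟩ := ih (min (η ^ 2 / 16) η) (by positivity)
    have hlim : √(4 * min (η ^ 2 / 16) η) < η := by
      refine (Real.sqrt_le_sqrt (mul_le_mul_of_nonneg_left (min_le_left _ _)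
        (by norm_num))).trans_lt ?_
      rw [show 4 * (η ^ 2 / 16) = (η / 2) ^ 2 by ring, Real.sqrt_sq (by positivity)]
      linarith
    have hev := ((countingBound_tendsto (I := I) (min (η ^ 2 / 16) η)).eventually_lt_const hlim)
    obtain ⟨r, hr, hball⟩ := Metric.eventually_nhds_iff.1 hev
    have hr2 : 0 < min (r / 2) (min ε₁ 1) := by positivity
    refine ⟨min (r / 2) (min ε₁ 1), hr2, ?_⟩
    set ε := min (r / 2) (min ε₁ 1)
    have hεr : ε < r := (min_le_left _ _).trans_lt (by linarith)
    have hεε : ε ≤ ε₁ := (min_le_right _ _).trans (min_le_left _ _)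
    have hε1 : ε ≤ 1 := (min_le_right _ _).trans (min_le_right _ _)
    intro X _ _ ν f g hν hf hg hf0 hfν hg0 hg1 hlfc hcut D hD hDν
    rcases D.eq_empty_or_nonempty with rfl | ⟨j, hj⟩
    · exact (ih X ν f g hν hf hg hf0 hfν hg0 hg1 (fun S hS => (hlfc S hS).trans hεε)
        (fun i => (hcut i).of_le hεε) ∅ (by simp) hDν).trans (min_le_right _ _)
    refine (counting_lemma_step hν hf hg hf0 hfν hg0 hg1 hr2.le hε1 hlfc j (hcut j)
      (η := min (η ^ 2 / 16) η) ?_).trans (hball (by simpa [abs_of_pos hr2] using hεr)).le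
    intro h hhi hh0 hh1
    have hup : ∀ {P : I → ((I → X) → ℝ) → Prop} (F : I → (I → X) → ℝ) (a : (I → X) → ℝ),
        (∀ i, P i (F i)) → P j a → ∀ i, P i (update F j a i) := by
      intro P F a hF ha i
      by_cases hi : i = j
      · subst hi; simpa using ha
      · simpa [hi] using hF i
    refine ih X (update ν j fun _ => 1) (update f j h) (update g j h)
      (hup (P := IndepOf) ν _ hν fun _ _ => rfl) (hup (P := IndepOf) f _ hf hhi)
      (hup (P := IndepOf) g _ hg hhi) (hup (P := fun _ a => ∀ x, 0 ≤ a x) f _ hf0 hh0) ?_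
      (hup (P := fun _ a => ∀ x, 0 ≤ a x) g _ hg0 hh0)
      (hup (P := fun _ a => ∀ x, a x ≤ 1) g _ hg1 hh1)
      (fun S hS => (hlfc.update_one j S hS).trans hεε) ?_ (D.erase j) ?_ ?_
    · intro i x
      by_cases hi : i = j
      · subst hi; simpa using hh1 x
      · simpa [hi] using hfν i x
    · intro i
      by_cases hi : i = j
      · subst hi; simpa using cutSmall_zero (X := X) i hε₁.le
      · simpa [hi] using (hcut i).of_le hεε
    · rw [Finset.card_erase_of_mem hj]; omega
    · intro i hi x
      by_cases hij : i = j
      · subst hij; simp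
      · simp only [update_of_ne hij]
        exact hDν i (fun hc => hi (Finset.mem_erase.2 ⟨hij, hc⟩)) x

/-! ### The dense model theorem -/

section DenseModel

/-- The class of test functions is closed under multiplication up to convex combinations. -/
theorem convexHull_mul_mem {G : Type} {K : Set (G → ℝ)}
    (hmul : ∀ φ ∈ K, ∀ ψ ∈ K, φ * ψ ∈ convexHull ℝ K) {φ ψ : G → ℝ} (hφ : φ ∈ convexHull ℝ K)
    (hψ : ψ ∈ convexHull ℝ K) : φ * ψ ∈ convexHull ℝ K := by
  have hconv : ∀ ψ : G → ℝ, Convex ℝ {φ | φ * ψ ∈ convexHull ℝ K} := by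
    intro ψ φ₁ h₁ φ₂ h₂ a b ha hb hab
    have := (convex_convexHull ℝ K) h₁ h₂ ha hb hab
    simpa only [Set.mem_ofPred_eq, add_mul, smul_mul_assoc] using this
  have h1 : ∀ ψ ∈ K, convexHull ℝ K ⊆ {φ | φ * ψ ∈ convexHull ℝ K} := fun ψ hψ =>
    convexHull_min (fun φ hφ => hmul φ hφ ψ hψ) (hconv ψ)
  have h2 : convexHull ℝ K ⊆ {ψ | ψ * φ ∈ convexHull ℝ K} :=
    convexHull_min (fun ψ hψ => by
      rw [Set.mem_ofPred_eq, mul_comm]; exact h1 ψ hψ hφ) (hconv φ)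
  rw [mul_comm]
  exact h2 hψ

theorem continuous_avg {E G : Type*} [TopologicalSpace E] [Finite G] {F : G → E → ℝ}
    (hF : ∀ x, Continuous (F x)) : Continuous fun e => avg fun x => F x e := by
  have := Fintype.ofFinite G
  simp_rw [avg_eq_sum]
  exact (continuous_finsetSum _ fun x _ => hF x).div_const _

/-- The dense model theorem for an abstract class of test functions. -/
theorem dense_model_abstract {ε : ℝ} (hε : 0 < ε) : ∃ ε' : ℝ, 0 < ε' ∧
    ∀ (G : Type) [Finite G] [Nonempty G] (K : Set (G → ℝ)), (∀ φ ∈ K, ∀ x, |φ x| ≤ 1) → 1 ∈ K →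
      (∀ φ ∈ K, -φ ∈ K) → (∀ φ ∈ K, ∀ ψ ∈ K, φ * ψ ∈ convexHull ℝ K) →
      ∀ ν f : G → ℝ, (∀ x, 0 ≤ f x) → (∀ x, f x ≤ ν x) →
      (∀ φ ∈ K, |avg fun x => (ν x - 1) * φ x| ≤ ε') →
      ∃ g : G → ℝ, (∀ x, 0 ≤ g x) ∧ (∀ x, g x ≤ 1) ∧
        ∀ φ ∈ K, |avg fun x => (f x - g x) * φ x| ≤ ε := by
  obtain ⟨p, hp⟩ := exists_polynomial_near_of_continuousOn (-1) 1 (fun t => max t 0)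
    (by fun_prop) (ε / 8) (by positivity)
  set Q := ∑ i ∈ Finset.range (p.natDegree + 1), |p.coeff i| with hQ
  have hQ0 : 0 ≤ Q := Finset.sum_nonneg fun i _ => abs_nonneg _
  refine ⟨min 1 (ε / (2 * (1 + Q))), by positivity, ?_⟩
  set ε' := min 1 (ε / (2 * (1 + Q)))
  have hε'1 : ε' ≤ 1 := min_le_left _ _
  have hε'Q : Q * ε' ≤ ε / 2 := by
    have h1 : ε' ≤ ε / (2 * (1 + Q)) := min_le_right _ _
    calc Q * ε' ≤ (1 + Q) * (ε / (2 * (1 + Q))) := by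
          apply mul_le_mul (by linarith) h1 _ (by linarith)
          exact le_min zero_le_one (by positivity)
      _ = ε / 2 := by field_simp
  intro G _ _ K hbd hone hneg hmul ν f hf0 hfν hν
  have := Fintype.ofFinite G
  set C := closure (convexHull ℝ K) with hC
  have hKC : K ⊆ C := (subset_convexHull ℝ K).trans subset_closure
  -- properties of the test functions which persist on the closed convex hull
  have hCbd : C ⊆ Set.Icc (-1) 1 := by
    refine closure_minimal (convexHull_min (fun φ hφ => ?_) (convex_Icc _ _)) isClosed_Icc
    exact ⟨fun x => (abs_le.1 (hbd φ hφ x)).1, fun x => (abs_le.1 (hbd φ hφ x)).2⟩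
  have hpow : ∀ φ ∈ convexHull ℝ K, ∀ n : ℕ, φ ^ n ∈ convexHull ℝ K := by
    intro φ hφ n
    induction n with
    | zero => rw [pow_zero]; exact subset_convexHull ℝ K hone
    | succ n ih => rw [pow_succ]; exact convexHull_mul_mem hmul ih hφ
  have hνK : ∀ φ ∈ convexHull ℝ K, |avg fun x => (ν x - 1) * φ x| ≤ ε' := by
    have hconv : Convex ℝ {φ : G → ℝ | |avg fun x => (ν x - 1) * φ x| ≤ ε'} := by
      intro φ₁ h₁ φ₂ h₂ a b ha hb hab
      have e : (avg fun x => (ν x - 1) * (a • φ₁ + b • φ₂) x) =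
          a * (avg fun x => (ν x - 1) * φ₁ x) + b * avg fun x => (ν x - 1) * φ₂ x := by
        rw [← avg_mul_left, ← avg_mul_left, ← avg_add]
        exact avg_congr fun x => by simp only [Pi.add_apply, Pi.smul_apply, smul_eq_mul]; ring
      rw [Set.mem_ofPred_eq, e]
      refine (abs_add_le _ _).trans ?_
      rw [abs_mul, abs_mul, abs_of_nonneg ha, abs_of_nonneg hb]
      calc _ ≤ a * ε' + b * ε' := add_le_add (mul_le_mul_of_nonneg_left h₁ ha)
            (mul_le_mul_of_nonneg_left h₂ hb)
        _ = ε' := by rw [← add_mul, hab, one_mul]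
    exact convexHull_min hν hconv
  have hνC : ∀ φ ∈ C, ∀ n : ℕ, |avg fun x => (ν x - 1) * φ x ^ n| ≤ ε' := by
    intro φ hφ n
    have hcl : IsClosed {φ : G → ℝ | |avg fun x => (ν x - 1) * φ x ^ n| ≤ ε'} := by
      refine isClosed_le (continuous_abs.comp (continuous_avg fun x => ?_)) continuous_const
      fun_prop
    exact closure_minimal (fun φ hφ => hνK _ (hpow φ hφ n)) hcl hφ
  have havgν : avg ν ≤ 2 := by
    have := (abs_le.1 (hνK 1 (subset_convexHull ℝ K hone))).2
    simp only [Pi.one_apply, mul_one] at this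
    rw [avg_sub, avg_const] at this
    linarith
  have hpos : ∀ φ ∈ C, (avg fun x => (ν x - 1) * max (φ x) 0) ≤ ε := by
    intro φ hφ
    have h1 : (avg fun x => (ν x - 1) * p.eval (φ x)) ≤ Q * ε' := by
      have : ∀ x, (ν x - 1) * p.eval (φ x) =
          ∑ i ∈ Finset.range (p.natDegree + 1), p.coeff i * ((ν x - 1) * φ x ^ i) := by
        intro x
        rw [Polynomial.eval_eq_sum_range, Finset.mul_sum]
        exact Finset.sum_congr rfl fun i _ => by ring
      simp_rw [this]
      rw [avg_sum, hQ, Finset.sum_mul]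
      refine Finset.sum_le_sum fun i _ => ?_
      rw [avg_mul_left]
      refine (le_abs_self _).trans ?_
      rw [abs_mul]
      exact mul_le_mul_of_nonneg_left (hνC φ hφ i) (abs_nonneg _)
    have h2 : ∀ x, (ν x - 1) * max (φ x) 0 ≤
        (ν x - 1) * p.eval (φ x) + (ν x + 1) * (ε / 8) := by
      intro x
      have hx := abs_lt.1 (hp (φ x) ⟨(hCbd hφ).1 x, (hCbd hφ).2 x⟩)
      have hν0 : 0 ≤ ν x := (hf0 x).trans (hfν x)
      nlinarith [mul_nonneg hν0 (sub_nonneg.2 hx.1.le), mul_nonneg hν0 (sub_nonneg.2 hx.2.le)]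
    have h3 := avg_mono h2
    rw [avg_add, avg_mul_right, avg_add, avg_const] at h3
    nlinarith
  have hcompact : IsCompact C := isCompact_Icc.of_isClosed_subset isClosed_closure hCbd
  have hcont1 : ∀ y : G → ℝ, Continuous fun g : G → ℝ => avg fun x => (f x - g x) * y x := fun y =>
    continuous_avg fun x => by fun_prop
  have hcont2 : ∀ g : G → ℝ, Continuous fun y : G → ℝ => avg fun x => (f x - g x) * y x := fun y =>
    continuous_avg fun x => by fun_prop
  obtain ⟨g, hg, b, hb, hgb⟩ := Sion.exists_isSaddlePointOn (X := Set.Icc (0 : G → ℝ) 1) (Y := C)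
    (f := fun g y => avg fun x => (f x - g x) * y x) ⟨0, le_rfl, zero_le_one⟩ (convex_Icc _ _)
    isCompact_Icc (fun y _ => (hcont1 y).lowerSemicontinuous.lowerSemicontinuousOn _)
    (fun y _ => by
      refine ConvexOn.quasiconvexOn ⟨convex_Icc _ _, fun g₁ _ g₂ _ a b _ _ hab => le_of_eq ?_⟩
      rw [smul_eq_mul, smul_eq_mul, ← avg_mul_left, ← avg_mul_left, ← avg_add]
      refine avg_congr fun x => ?_
      simp only [Pi.add_apply, Pi.smul_apply, smul_eq_mul]
      linear_combination (-(f x * y x)) * hab)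
    (convex_convexHull ℝ K).closure ⟨1, hKC hone⟩ hcompact
    (fun y _ => (hcont2 y).upperSemicontinuous.upperSemicontinuousOn _)
    (fun g _ => by
      refine ConcaveOn.quasiconcaveOn ⟨(convex_convexHull ℝ K).closure,
        fun y₁ _ y₂ _ a b _ _ hab => le_of_eq ?_⟩
      rw [smul_eq_mul, smul_eq_mul, ← avg_mul_left, ← avg_mul_left, ← avg_add]
      refine avg_congr fun x => ?_
      simp only [Pi.add_apply, Pi.smul_apply, smul_eq_mul]
      ring)
  have hle : ∀ φ ∈ K, (avg fun x => (f x - g x) * φ x) ≤ ε := by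
    classical
    intro φ hφ
    refine (hgb (fun x => if 0 ≤ b x then 1 else 0) ⟨fun x => ?_, fun x => ?_⟩ φ (hKC hφ)).trans
      ((avg_mono fun x => ?_).trans (hpos b hb))
    · dsimp only; split_ifs <;> simp
    · dsimp only; split_ifs <;> simp
    · dsimp only
      split_ifs with h
      · rw [max_eq_left h]
        exact mul_le_mul_of_nonneg_right (by linarith [hfν x]) h
      · rw [max_eq_right (not_le.1 h).le]
        nlinarith [hf0 x, not_le.1 h]
  refine ⟨g, fun x => hg.1 x, fun x => hg.2 x, fun φ hφ => abs_le.2 ⟨?_, hle φ hφ⟩⟩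
  have := hle _ (hneg φ hφ)
  simp only [Pi.neg_apply, mul_neg] at this
  rw [avg_neg] at this
  linarith

end DenseModel

section Convolution

variable {J G : Type} [DecidableEq J] [Fintype J] [AddCommGroup G]

/-- The point of `J → G` with sum `n` which agrees with `y` outside of `j₀`. -/
def withSum (j₀ : J) (n : G) (y : J → G) : J → G := y + Pi.single j₀ (n - ∑ i, y i)

theorem withSum_add (j₀ : J) (n : G) (y h : J → G) :
    withSum j₀ n (y + h) = withSum j₀ n y + (h + Pi.single j₀ (-∑ i, h i)) := by
  simp only [withSum, Pi.add_apply, Finset.sum_add_distrib]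
  rw [show n - (∑ i, y i + ∑ i, h i) = (n - ∑ i, y i) + -∑ i, h i by abel, Pi.single_add]
  abel

/-- The generalised convolution of the functions `u i`. -/
noncomputable def genConv (j₀ : J) (u : J → (J → G) → ℝ) (n : G) : ℝ :=
  avg fun y => ∏ i, u i (withSum j₀ n y)

variable [Finite G]

theorem avg_mul_genConv (j₀ : J) (u : J → (J → G) → ℝ) (h : G → ℝ) :
    (avg fun n => h n * genConv j₀ u n) = avg fun x : J → G => h (∑ i, x i) * ∏ i, u i x := by
  have e1 : ∀ y : J → G, (avg fun n => h n * ∏ i, u i (withSum j₀ n y)) =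
      avg fun m => h (m + ∑ i, y i) * ∏ i, u i (y + Pi.single j₀ m) := by
    intro y
    rw [← avg_equiv (Equiv.addRight (∑ i, y i))]
    exact avg_congr fun m => by simp [withSum]
  have e2 : ∀ m : G, (avg fun y : J → G => h (m + ∑ i, y i) * ∏ i, u i (y + Pi.single j₀ m)) =
      avg fun x : J → G => h (∑ i, x i) * ∏ i, u i x := by
    intro m
    rw [← avg_equiv (Equiv.addRight (Pi.single j₀ m : J → G))
      fun x => h (∑ i, x i) * ∏ i, u i x]
    refine avg_congr fun y => ?_
    simp [Finset.sum_add_distrib, add_comm]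
  simp_rw [genConv, ← avg_mul_left]
  rw [avg_comm, avg_congr e1, avg_comm, avg_congr e2, avg_const]

/-- Products of functions of absolute value at most one, each omitting a coordinate. -/
def IsTestFamily (u : J → (J → G) → ℝ) : Prop := (∀ i, IndepOf i (u i)) ∧ ∀ i x, |u i x| ≤ 1

theorem genConv_mul_mem (j₀ : J) {u v : J → (J → G) → ℝ} (hu : IsTestFamily u)
    (hv : IsTestFamily v) : genConv j₀ u * genConv j₀ v ∈
      convexHull ℝ {φ : G → ℝ | ∃ u, IsTestFamily u ∧ φ = genConv j₀ u} := by
  have := Fintype.ofFinite (J → G)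
  set W : (J → G) → J → G := fun h => h + Pi.single j₀ (-∑ i, h i) with hW
  set w : (J → G) → J → (J → G) → ℝ := fun h i x => u i x * v i (x + W h) with hw
  have hwt : ∀ h, IsTestFamily (w h) := by
    intro h
    refine ⟨fun i x t => ?_, fun i x => ?_⟩
    · simp only [hw]
      rw [hu.1 i, ← hv.1 i (x + W h) (t + W h i)]
      congr 2
      funext a
      by_cases ha : a = i
      · subst ha; simp
      · simp [ha]
    · rw [abs_mul]
      exact mul_le_one₀ (hu.2 i x) (abs_nonneg _) (hv.2 i _)
  have key : genConv j₀ u * genConv j₀ v =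
      ∑ h : J → G, (1 / Fintype.card (J → G) : ℝ) • genConv j₀ (w h) := by
    funext n
    rw [Pi.mul_apply, Finset.sum_apply, genConv, genConv, avg_mul_avg]
    have e : ∀ y : J → G, (avg fun y' => (∏ i, u i (withSum j₀ n y)) *
        ∏ i, v i (withSum j₀ n y')) = avg fun h => ∏ i, w h i (withSum j₀ n y) := by
      intro y
      rw [← avg_equiv (Equiv.addLeft y)]
      refine avg_congr fun h => ?_
      simp only [hw, hW, Finset.prod_mul_distrib, Equiv.coe_addLeft, withSum_add]
    rw [avg_congr e, avg_comm, avg_eq_sum, Finset.sum_div]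
    refine Finset.sum_congr rfl fun h _ => ?_
    rw [Pi.smul_apply, smul_eq_mul, genConv]
    ring
  rw [key]
  refine (convex_convexHull ℝ _).sum_mem (fun _ _ => by positivity) ?_
    fun h _ => subset_convexHull ℝ _ ⟨w h, hwt h, rfl⟩
  rw [Finset.sum_const, nsmul_eq_mul, Finset.card_univ]
  have : (Fintype.card (J → G) : ℝ) ≠ 0 := Nat.cast_ne_zero.2 Fintype.card_ne_zero
  field_simp

end Convolution

/-- The dense model theorem. -/
theorem dense_model (J : Type) [DecidableEq J] [Fintype J] [Nonempty J] {ε : ℝ} (hε : 0 < ε) :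
    ∃ ε' : ℝ, 0 < ε' ∧ ∀ (G : Type) [AddCommGroup G] [Finite G], ∀ ν f : G → ℝ,
      (∀ x, 0 ≤ f x) → (∀ x, f x ≤ ν x) →
      (∀ u : J → (J → G) → ℝ, IsTestFamily u →
        |avg fun x => (ν (∑ i, x i) - 1) * ∏ i, u i x| ≤ ε') →
      ∃ g : G → ℝ, (∀ x, 0 ≤ g x) ∧ (∀ x, g x ≤ 1) ∧
        ∀ u : J → (J → G) → ℝ, IsTestFamily u →
          |avg fun x => (f (∑ i, x i) - g (∑ i, x i)) * ∏ i, u i x| ≤ ε := by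
  obtain ⟨j₀⟩ := ‹Nonempty J›
  obtain ⟨ε', hε', H⟩ := dense_model_abstract hε
  refine ⟨ε', hε', fun G _ _ ν f hf0 hfν hν => ?_⟩
  have hbd : ∀ φ ∈ {φ : G → ℝ | ∃ u, IsTestFamily u ∧ φ = genConv j₀ u}, ∀ x, |φ x| ≤ 1 := by
    rintro _ ⟨u, hu, rfl⟩ n
    refine abs_avg_le_of_le fun y => ?_
    rw [Finset.abs_prod]
    exact Finset.prod_le_one (fun _ _ => abs_nonneg _) fun i _ => hu.2 i _
  have hone : 1 ∈ {φ : G → ℝ | ∃ u, IsTestFamily u ∧ φ = genConv j₀ u} := by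
    refine ⟨fun _ _ => 1, ⟨fun _ _ _ => rfl, fun _ _ => by simp⟩, ?_⟩
    funext n
    simp [genConv, avg_const]
  have hneg : ∀ φ ∈ {φ : G → ℝ | ∃ u, IsTestFamily u ∧ φ = genConv j₀ u},
      -φ ∈ {φ : G → ℝ | ∃ u, IsTestFamily u ∧ φ = genConv j₀ u} := by
    rintro _ ⟨u, hu, rfl⟩
    refine ⟨fun i x => (if i = j₀ then -1 else 1) * u i x, ⟨fun i x t => ?_, fun i x => ?_⟩, ?_⟩
    · simp only [hu.1 i x t]
    · rw [abs_mul]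
      have := hu.2 i x
      split_ifs <;> simpa using this
    · funext n
      simp only [genConv, Finset.prod_mul_distrib, Pi.neg_apply]
      simp [avg_neg]
  obtain ⟨g, hg0, hg1, hg⟩ := H G _ hbd hone hneg
    (by rintro _ ⟨u, hu, rfl⟩ _ ⟨v, hv, rfl⟩; exact genConv_mul_mem j₀ hu hv) ν f hf0 hfν
    (by rintro _ ⟨u, hu, rfl⟩; rw [avg_mul_genConv j₀ u fun n => ν n - 1]; exact hν u hu)
  refine ⟨g, hg0, hg1, fun u hu => ?_⟩
  rw [← avg_mul_genConv j₀ u fun n => f n - g n]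
  exact hg _ ⟨u, hu, rfl⟩

section Forms

theorem avg_insertNth {n : ℕ} {X : Type} [Finite X] (j : Fin (n + 1)) (F : (Fin (n + 1) → X) → ℝ) :
    avg F = avg fun t => avg fun w : Fin n → X => F (j.insertNth t w) := by
  rw [← avg_prod (fun p : X × (Fin n → X) => F (j.insertNth p.1 p.2)),
    ← avg_equiv (Fin.insertNthEquiv (fun _ => X) j)]
  rfl

variable {N r : ℕ} [NeZero N]

/-- The linear forms `∑ (i - j) x i` which parametrise arithmetic progressions. -/
def apForm (N : ℕ) {r : ℕ} (j : Fin (r + 1)) (x : Fin (r + 1) → ZMod N) : ZMod N :=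
  ∑ i : Fin (r + 1), (((i : ℕ) : ZMod N) - ((j : ℕ) : ZMod N)) * x i

omit [NeZero N] in
theorem apForm_eq_sum_succAbove (j : Fin (r + 1)) (x : Fin (r + 1) → ZMod N) :
    apForm N j x = ∑ i : Fin r, (((j.succAbove i : Fin (r + 1)) : ℕ) - ((j : ℕ) : ZMod N)) *
      x (j.succAbove i) := by
  rw [apForm, Fin.sum_univ_succAbove _ j]
  simp

omit [NeZero N] in
theorem apForm_indep (F : ZMod N → ℝ) (j : Fin (r + 1)) :
    IndepOf j fun x => F (apForm N j x) := by
  intro x t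
  simp [apForm_eq_sum_succAbove, Fin.succAbove_ne]

omit [NeZero N] in
theorem isUnit_natCast_sub {n : ℕ} (hN : N.Coprime n.factorial) {a b : ℕ} (ha : a ≤ n) (hb : b ≤ n)
    (hab : a ≠ b) : IsUnit ((a : ZMod N) - b) := by
  rcases lt_or_gt_of_ne hab with h | h
  · rw [← neg_sub, IsUnit.neg_iff, ← Nat.cast_sub h.le]
    exact isUnit_natCast_of_le hN (by omega) (by omega)
  · rw [← Nat.cast_sub h.le]
    exact isUnit_natCast_of_le hN (by omega) (by omega)

omit [NeZero N] in
/-- The units occurring as coefficients of `apForm`. -/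
theorem exists_units {n : ℕ} (hN : N.Coprime n.factorial) (hr : r ≤ n) (j : Fin (r + 1)) :
    ∃ c : Fin r → (ZMod N)ˣ, ∀ i, (c i : ZMod N) =
      ((j.succAbove i : Fin (r + 1)) : ℕ) - ((j : ℕ) : ZMod N) := by
  have : ∀ i : Fin r, IsUnit ((((j.succAbove i : Fin (r + 1)) : ℕ) : ZMod N) - ((j : ℕ) : ZMod N)) :=
    fun i => isUnit_natCast_sub hN (by omega) (by omega)
      fun h => Fin.succAbove_ne j i (Fin.ext h)
  choose c hc using this
  exact ⟨c, hc⟩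

omit [NeZero N] in
theorem avg_scale (c : Fin r → (ZMod N)ˣ) (F : (Fin r → ZMod N) → ℝ) :
    (avg fun x : Fin r → ZMod N => F fun i => c i * x i) = avg F :=
  avg_equiv (Equiv.piCongrRight fun i => (c i).mulLeft) F

theorem cutSmall_of_isTestFamily {n : ℕ} (hN : N.Coprime n.factorial) (hr : r ≤ n)
    (j : Fin (r + 1)) {h : ZMod N → ℝ} {ε : ℝ}
    (hh : ∀ u : Fin r → (Fin r → ZMod N) → ℝ, IsTestFamily u →
      |avg fun x => h (∑ i, x i) * ∏ i, u i x| ≤ ε) :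
    CutSmall j (fun x => h (apForm N j x)) ε := by
  obtain ⟨c, hc⟩ := exists_units hN hr j
  intro u hu hu1
  rw [avg_insertNth j]
  refine abs_avg_le_of_le fun t => ?_
  convert hh (fun i w => u (j.succAbove i) (j.insertNth t fun i => ((c i)⁻¹ : (ZMod N)ˣ) * w i))
    ⟨fun i x s => ?_, fun i x => hu1 _ _⟩ using 2
  · rw [← avg_scale c (fun w => h (∑ i, w i) *
      ∏ i, u (j.succAbove i) (j.insertNth t fun i => ((c i)⁻¹ : (ZMod N)ˣ) * w i))]
    refine avg_congr fun w => ?_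
    beta_reduce
    rw [apForm_eq_sum_succAbove]
    congr 1
    · simp [hc]
    · have : Finset.univ.erase j = Finset.univ.image j.succAbove := by
        rw [Fin.image_succAbove_univ]; ext; simp
      rw [this, Finset.prod_image fun a _ b _ hab => Fin.succAbove_right_injective hab]
      simp
  · beta_reduce
    rw [← hu (j.succAbove i) (j.insertNth t fun i => ((c i)⁻¹ : (ZMod N)ˣ) * x i)
      (((c i)⁻¹ : (ZMod N)ˣ) * s)]
    congr 1
    funext a
    refine Fin.succAboveCases j ?_ (fun a => ?_) a
    · simp [(Fin.succAbove_ne j i).symm]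
    · by_cases ha : a = i
      · subst ha; simp
      · simp [ha, Fin.succAbove_right_injective.ne ha]

theorem CutSmall.abs_avg_le {n : ℕ} (hN : N.Coprime n.factorial) (hr : r ≤ n)
    (j : Fin (r + 1)) {h : ZMod N → ℝ} {ε : ℝ} (hh : CutSmall j (fun x => h (apForm N j x)) ε)
    {u : Fin r → (Fin r → ZMod N) → ℝ} (hu : IsTestFamily u) :
    |avg fun x => h (∑ i, x i) * ∏ i, u i x| ≤ ε := by
  obtain ⟨c, hc⟩ := exists_units hN hr j
  set U : Fin (r + 1) → (Fin (r + 1) → ZMod N) → ℝ := fun a x =>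
    Fin.succAboveCases (α := fun _ => ℝ) j 1 (fun i => u i fun i => c i * x (j.succAbove i)) a
    with hU
  have hUj : ∀ x, U j x = 1 := fun x => by simp [hU]
  have hUi : ∀ i x, U (j.succAbove i) x = u i fun i => c i * x (j.succAbove i) := fun i x => by
    simp [hU]
  convert hh U (fun a => ?_) (fun a x => ?_) using 2
  · rw [avg_insertNth j]
    have : ∀ t : ZMod N, (avg fun w : Fin r → ZMod N => h (apForm N j (j.insertNth t w)) *
        ∏ i ∈ Finset.univ.erase j, U i (j.insertNth t w)) =
        avg fun x => h (∑ i, x i) * ∏ i, u i x := by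
      intro t
      rw [← avg_scale c fun x => h (∑ i, x i) * ∏ i, u i x]
      refine avg_congr fun w => ?_
      rw [apForm_eq_sum_succAbove]
      congr 1
      · simp [hc]
      · have : Finset.univ.erase j = Finset.univ.image j.succAbove := by
          rw [Fin.image_succAbove_univ]; ext; simp
        rw [this, Finset.prod_image fun a _ b _ hab => Fin.succAbove_right_injective hab]
        simp [hUi]
    simp_rw [this]
    rw [avg_const]
  · refine Fin.succAboveCases j (fun x t => by rw [hUj, hUj]) (fun i x t => ?_) a
    rw [hUi, hUi, ← hu.1 i (fun i => c i * x (j.succAbove i)) (c i * t)]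
    congr 1
    funext b
    by_cases hb : b = i
    · subst hb; simp
    · simp [hb, Fin.succAbove_right_injective.ne hb]
  · refine Fin.succAboveCases j (by rw [hUj]; simp) (fun i => ?_) a
    rw [hUi]
    exact hu.2 i _

end Forms

/-- The forms `apForm N j` run over the arithmetic progressions in `ZMod N` uniformly. -/
theorem avg_apForm {N r : ℕ} [NeZero N] (F : (Fin (r + 2) → ZMod N) → ℝ) :
    (avg fun x => F fun j => apForm N j x) =
      avg fun a : ZMod N => avg fun d : ZMod N => F fun j : Fin (r + 2) => a + (j : ℕ) * d := by
  have key : ∀ (t s : ZMod N) (y : Fin r → ZMod N) (j : Fin (r + 2)),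
      apForm N j (Fin.insertNth 0 t (Fin.insertNth 0 s y : Fin (r + 1) → ZMod N)) =
      (s + ∑ i : Fin r, ((i : ℕ) + 2 : ZMod N) * y i) + (j : ℕ) * -(t + s + ∑ i, y i) := by
    intro t s y j
    simp only [apForm, Fin.insertNth_zero', Fin.sum_univ_succ, Fin.cons_zero, Fin.cons_succ,
      Fin.val_zero, Fin.val_succ]
    push_cast
    have : ∑ i : Fin r, ((i : ℕ) + 1 + 1 - (j : ℕ) : ZMod N) * y i =
        (∑ i : Fin r, ((i : ℕ) + 2 : ZMod N) * y i) - (j : ℕ) * ∑ i, y i := by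
      rw [Finset.mul_sum, ← Finset.sum_sub_distrib]
      exact Finset.sum_congr rfl fun i _ => by ring
    rw [this]
    ring
  rw [avg_insertNth 0]
  have h1 : ∀ t : ZMod N, (avg fun w : Fin (r + 1) → ZMod N =>
      F fun j => apForm N j (Fin.insertNth 0 t w)) = avg fun y : Fin r → ZMod N =>
        avg fun a : ZMod N => F fun j => a + (j : ℕ) *
          -(t + (a - ∑ i : Fin r, ((i : ℕ) + 2 : ZMod N) * y i) + ∑ i, y i) := by
    intro t
    rw [avg_insertNth 0, avg_comm]
    refine avg_congr fun y => ?_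
    rw [← avg_equiv (Equiv.addRight (∑ i : Fin r, ((i : ℕ) + 2 : ZMod N) * y i)) (fun a : ZMod N =>
      F fun j => a + (j : ℕ) * -(t + (a - ∑ i : Fin r, ((i : ℕ) + 2 : ZMod N) * y i) + ∑ i, y i))]
    refine avg_congr fun s => ?_
    simp only [key, Equiv.coe_addRight, add_sub_cancel_right]
  rw [avg_congr h1, avg_comm]
  have h2 : ∀ y : Fin r → ZMod N, (avg fun t : ZMod N => avg fun a : ZMod N =>
      F fun j => a + (j : ℕ) * -(t + (a - ∑ i : Fin r, ((i : ℕ) + 2 : ZMod N) * y i) + ∑ i, y i)) =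
      avg fun a : ZMod N => avg fun d : ZMod N => F fun j : Fin (r + 2) => a + (j : ℕ) * d := by
    intro y
    rw [avg_comm]
    refine avg_congr fun a => ?_
    rw [← avg_equiv ((Equiv.addRight ((a - ∑ i : Fin r, ((i : ℕ) + 2 : ZMod N) * y i) +
      ∑ i, y i)).trans (Equiv.neg _)) (fun d : ZMod N => F fun j => a + (j : ℕ) * d)]
    refine avg_congr fun t => ?_
    simp only [Equiv.trans_apply, Equiv.coe_addRight, Equiv.neg_apply, add_assoc]
  rw [avg_congr h2, avg_const]

/-- **Relative Szemerédi theorem** for weights satisfying the linear forms condition. -/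
theorem relative_szemeredi (r : ℕ) {δ : ℝ} (hδ : 0 < δ) : ∃ n : ℕ, r + 2 ≤ n ∧ ∃ c : ℝ, 0 < c ∧
    ∃ ε : ℝ, 0 < ε ∧ ∀ (N : ℕ) [NeZero N], N.Coprime n.factorial → ∀ ν f : ZMod N → ℝ,
      (∀ x, 0 ≤ f x) → (∀ x, f x ≤ ν x) → δ ≤ avg f →
      LinearFormsCondition (fun (j : Fin (r + 2)) x => ν (apForm N j x)) ε →
      c ≤ avg fun a : ZMod N => avg fun d : ZMod N =>
        ∏ j : Fin (r + 2), f (a + (j : ℕ) * d) := by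
  obtain ⟨n, c, hc, hsz⟩ := szemeredi (r + 2) (δ / 2) (by positivity)
  obtain ⟨ε₁, hε₁, hcount⟩ := counting_lemma (Fin (r + 2)) (r + 2) (c / 2) (by positivity)
  obtain ⟨ε₂, hε₂, hdense⟩ := dense_model (Fin (r + 1)) (lt_min hε₁ (by positivity : 0 < δ / 2))
  have hev := (gcsBound_tendsto (2 ^ Fintype.card (Fin (r + 2) × (Fin (r + 2) → Bool)))
    (Fintype.card (Fin (r + 2)) - 1)).eventually_lt_const hε₂
  obtain ⟨ρ, hρ, hball⟩ := Metric.eventually_nhds_iff.1 hev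
  have hε0 : 0 < min (ρ / 2) (min ε₁ 1) := by positivity
  refine ⟨max n (r + 2), le_max_right _ _, c / 2, by positivity, min (ρ / 2) (min ε₁ 1), hε0, ?_⟩
  set ε := min (ρ / 2) (min ε₁ 1)
  have hερ : ε < ρ := (min_le_left _ _).trans_lt (by linarith)
  have hεε₁ : ε ≤ ε₁ := (min_le_right _ _).trans (min_le_left _ _)
  have hε1 : ε ≤ 1 := (min_le_right _ _).trans (min_le_right _ _)
  intro N _ hN ν f hf0 hfν hδf hlfc
  have hrn : r + 1 ≤ max n (r + 2) := by omega
  have hcut := hlfc.cutSmall (fun j => apForm_indep ν j) hε0.le hε1 0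
  obtain ⟨g, hg0, hg1, hg⟩ := hdense (ZMod N) ν f hf0 hfν fun u hu =>
    (CutSmall.abs_avg_le hN hrn 0 (h := fun n => ν n - 1) hcut hu).trans
      (hball (by simpa [abs_of_pos hε0] using hερ)).le
  have hgavg : δ / 2 ≤ avg g := by
    have h1 := hg (fun _ _ => 1) ⟨fun _ _ _ => rfl, fun _ _ => by simp⟩
    simp only [Finset.prod_const_one, mul_one] at h1
    have h2 : (avg fun x : Fin (r + 1) → ZMod N => f (∑ i, x i) - g (∑ i, x i)) =
        avg fun n => f n - g n := by
      rw [avg_insertNth 0, avg_comm]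
      have : ∀ w : Fin r → ZMod N, (avg fun t : ZMod N =>
          f (∑ i, (Fin.insertNth 0 t w : Fin (r + 1) → ZMod N) i) -
          g (∑ i, (Fin.insertNth 0 t w : Fin (r + 1) → ZMod N) i)) = avg fun n => f n - g n := by
        intro w
        rw [← avg_equiv (Equiv.addRight (∑ i, w i)) (fun n => f n - g n)]
        refine avg_congr fun t => ?_
        simp [Fin.sum_univ_succ]
      rw [avg_congr this, avg_const]
    rw [h2, avg_sub] at h1
    linarith [(abs_le.1 h1).2, min_le_right ε₁ (δ / 2)]
  have hszg := hsz N (hN.coprime_dvd_right (Nat.factorial_dvd_factorial (le_max_left _ _))) g hg0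
    hg1 hgavg
  have hcnt := hcount (ZMod N) (fun j x => ν (apForm N j x)) (fun j x => f (apForm N j x))
    (fun j x => g (apForm N j x)) (fun j => apForm_indep ν j) (fun j => apForm_indep f j)
    (fun j => apForm_indep g j) (fun _ _ => hf0 _) (fun _ _ => hfν _) (fun _ _ => hg0 _)
    (fun _ _ => hg1 _) (fun S hS => (hlfc S hS).trans hεε₁)
    (fun j => (cutSmall_of_isTestFamily hN hrn j (h := fun n => f n - g n) hg).of_le
      (min_le_left _ _)) Finset.univ (by simp) (fun i hi => absurd (Finset.mem_univ i) hi)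
  rw [avg_apForm fun y => ∏ j, f (y j), avg_apForm fun y => ∏ j, g (y j)] at hcnt
  linarith [(abs_le.1 hcnt).1]

section DiagonalSums

variable {ι : Type*} [DecidableEq ι]

/-- The value of an orthogonal system at the prime `p` on a pair of products. -/
noncomputable def diagFactor (g : ι → ℝ) (p : ι) (P : Finset ι × Finset ι) : ℝ :=
  if p ∈ P.1 then if p ∈ P.2 then g p else 0 else if p ∈ P.2 then 0 else 1

theorem diagFactor_nonneg {g : ι → ℝ} {p : ι} (hg : 0 ≤ g p) (P : Finset ι × Finset ι) :
    0 ≤ diagFactor g p P := by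
  unfold diagFactor; split_ifs <;> simp [hg]

theorem prod_diagFactor (g : ι → ℝ) (U : Finset ι) (P : Finset ι × Finset ι) :
    ∏ p ∈ U, diagFactor g p P = if P.1 ∩ U = P.2 ∩ U then ∏ p ∈ P.1 ∩ U, g p else 0 := by
  split_ifs with h
  · have h' : ∀ p ∈ U, (p ∈ P.1 ↔ p ∈ P.2) := fun p hp => by
      have := Finset.ext_iff.1 h p
      simpa [hp] using this
    rw [Finset.inter_comm, ← Finset.prod_filter_mul_prod_filter_not U (· ∈ P.1),
      Finset.filter_mem_eq_inter]
    refine (congrArg₂ (· * ·) (Finset.prod_congr rfl fun p hp => ?_)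
      (Finset.prod_eq_one fun p hp => ?_)).trans (mul_one _)
    · rw [Finset.mem_inter] at hp
      simp [diagFactor, hp.2, (h' p hp.1).1 hp.2]
    · rw [Finset.mem_filter] at hp
      simp [diagFactor, hp.2, (h' p hp.1).not.1 hp.2]
  · obtain ⟨p, hp⟩ : ∃ p, ¬ (p ∈ P.1 ∩ U ↔ p ∈ P.2 ∩ U) := by
      by_contra! hcon
      exact h (Finset.ext hcon)
    simp only [Finset.mem_inter] at hp
    have hpU : p ∈ U := by tauto
    refine Finset.prod_eq_zero hpU ?_
    unfold diagFactor
    split_ifs <;> tauto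

theorem sum_prod_diagFactor {g : ι → ℝ} {𝒬 : Finset ι} {𝓕 : Finset (Finset ι)}
    (h𝒬 : ∀ F ∈ 𝓕, F ⊆ 𝒬) :
    ∑ P ∈ 𝓕 ×ˢ 𝓕, ∏ p ∈ 𝒬, diagFactor g p P = ∑ F ∈ 𝓕, ∏ p ∈ F, g p := by
  rw [Finset.sum_product]
  refine Finset.sum_congr rfl fun F hF => ?_
  rw [Finset.sum_eq_single_of_mem F hF]
  · rw [prod_diagFactor, if_pos rfl, Finset.inter_eq_left.2 (h𝒬 F hF)]
  · intro F' hF' hne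
    rw [prod_diagFactor, if_neg]
    rw [Finset.inter_eq_left.2 (h𝒬 F hF), Finset.inter_eq_left.2 (h𝒬 F' hF')]
    exact hne.symm

theorem sum_prod_sdiff_diagFactor_le {g : ι → ℝ} {𝒬 : Finset ι} {𝓕 : Finset (Finset ι)}
    (hg : ∀ p ∈ 𝒬, 0 ≤ g p) (h𝒬 : ∀ F ∈ 𝓕, F ⊆ 𝒬) (h𝓕 : ∀ F ∈ 𝓕, ∀ E ⊆ F, E ∈ 𝓕) {A : Finset ι} :
    ∑ P ∈ 𝓕 ×ˢ 𝓕, ∏ p ∈ 𝒬 \ A, diagFactor g p P ≤ 4 ^ A.card * ∑ F ∈ 𝓕, ∏ p ∈ F, g p := by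
  have hinter : ∀ F ∈ 𝓕, F ∩ (𝒬 \ A) = F \ A := fun F hF => by
    rw [← Finset.inter_sdiff_assoc, Finset.inter_eq_left.2 (h𝒬 F hF)]
  set Q := (𝓕 ×ˢ 𝓕).filter fun P => P.1 \ A = P.2 \ A
  set e : Finset ι × Finset ι → (Finset ι × Finset ι) × Finset ι :=
    fun P => ((P.1 ∩ A, P.2 ∩ A), P.1 \ A)
  have h1 : ∑ P ∈ 𝓕 ×ˢ 𝓕, ∏ p ∈ 𝒬 \ A, diagFactor g p P = ∑ P ∈ Q, ∏ p ∈ P.1 \ A, g p := by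
    rw [Finset.sum_filter]
    refine Finset.sum_congr rfl fun P hP => ?_
    rw [Finset.mem_product] at hP
    rw [prod_diagFactor, hinter _ hP.1, hinter _ hP.2]
  have hinj : Set.InjOn e Q := by
    intro P hP P' hP' h
    simp only [Q, Finset.coe_filter, Set.mem_ofPred_eq] at hP hP'
    simp only [e, Prod.mk.injEq] at h
    refine Prod.ext ?_ ?_
    · rw [← Finset.sdiff_union_inter P.1 A, h.2, h.1.1, Finset.sdiff_union_inter]
    · rw [← Finset.sdiff_union_inter P.2 A, ← hP.2, h.2, h.1.2, hP'.2, Finset.sdiff_union_inter]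
  have h2 : ∑ P ∈ Q, ∏ p ∈ P.1 \ A, g p = ∑ x ∈ Q.image e, ∏ p ∈ x.2, g p := by
    rw [Finset.sum_image hinj]
  have h3 : Q.image e ⊆ (A.powerset ×ˢ A.powerset) ×ˢ 𝓕 := by
    intro x hx
    obtain ⟨P, hP, rfl⟩ := Finset.mem_image.1 hx
    simp only [Q, Finset.mem_filter, Finset.mem_product] at hP
    simp only [e, Finset.mem_product, Finset.mem_powerset]
    exact ⟨⟨Finset.inter_subset_right, Finset.inter_subset_right⟩,
      h𝓕 _ hP.1.1 _ Finset.sdiff_subset⟩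
  rw [h1, h2]
  refine (Finset.sum_le_sum_of_subset_of_nonneg h3 fun x hx _ =>
    Finset.prod_nonneg fun p hp => hg p (h𝒬 _ (Finset.mem_product.1 hx).2 hp)).trans_eq ?_
  rw [Finset.sum_product]
  dsimp only
  rw [Finset.sum_const, Finset.card_product, Finset.card_powerset, nsmul_eq_mul]
  push_cast
  rw [← mul_pow]
  norm_num

/-- Correlations of truncated sums over an almost orthogonal system. -/
theorem abs_sum_prod_sub_le {S : Type*} [Fintype S] [DecidableEq S] {g κ : ι → ℝ} {𝒬 : Finset ι}
    {𝓕 : Finset (Finset ι)} (hg : ∀ p ∈ 𝒬, 0 ≤ g p) (hκ : ∀ p ∈ 𝒬, 0 ≤ κ p)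
    (h𝒬 : ∀ F ∈ 𝓕, F ⊆ 𝒬) (h𝓕 : ∀ F ∈ 𝓕, ∀ E ⊆ F, E ∈ 𝓕)
    (e : ι → (S → Finset ι × Finset ι) → ℝ)
    (he : ∀ p ∈ 𝒬, ∀ P, |e p P - ∏ q, diagFactor g p (P q)| ≤ κ p) :
    |∑ P ∈ Fintype.piFinset (fun _ : S => 𝓕 ×ˢ 𝓕), ∏ p ∈ 𝒬, e p P -
      (∑ F ∈ 𝓕, ∏ p ∈ F, g p) ^ Fintype.card S| ≤
      (∑ F ∈ 𝓕, ∏ p ∈ F, g p) ^ Fintype.card S *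
        (∏ p ∈ 𝒬, (1 + 4 ^ Fintype.card S * κ p) - 1) := by
  set G := ∑ F ∈ 𝓕, ∏ p ∈ F, g p
  set s := Fintype.card S
  set Ω := Fintype.piFinset (fun _ : S => 𝓕 ×ˢ 𝓕)
  have hG : 0 ≤ G := Finset.sum_nonneg fun F hF => Finset.prod_nonneg fun p hp => hg p (h𝒬 F hF hp)
  set b : ι → (S → Finset ι × Finset ι) → ℝ := fun p P => ∏ q, diagFactor g p (P q)
  have hb : ∀ p ∈ 𝒬, ∀ P, 0 ≤ b p P := fun p hp P =>
    Finset.prod_nonneg fun q _ => diagFactor_nonneg (hg p hp) _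
  have hswap : ∀ U : Finset ι, ∑ P ∈ Ω, ∏ p ∈ U, b p P =
      (∑ P ∈ 𝓕 ×ˢ 𝓕, ∏ p ∈ U, diagFactor g p P) ^ s := by
    intro U
    simp only [b]
    simp_rw [Finset.prod_comm (s := U)]
    rw [← Finset.prod_univ_sum (fun _ : S => 𝓕 ×ˢ 𝓕) fun _ P => ∏ p ∈ U, diagFactor g p P]
    simp [s]
  have hterm : ∀ A ∈ 𝒬.powerset,
      |∑ P ∈ Ω, (∏ p ∈ A, (e p P - b p P)) * ∏ p ∈ 𝒬 \ A, b p P| ≤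
        (∏ p ∈ A, 4 ^ s * κ p) * G ^ s := by
    intro A hA
    rw [Finset.mem_powerset] at hA
    calc _ ≤ ∑ P ∈ Ω, (∏ p ∈ A, κ p) * ∏ p ∈ 𝒬 \ A, b p P := by
          refine (Finset.abs_sum_le_sum_abs _ _).trans (Finset.sum_le_sum fun P _ => ?_)
          rw [abs_mul, Finset.abs_prod, abs_of_nonneg (Finset.prod_nonneg fun p hp =>
            hb p (Finset.mem_sdiff.1 hp).1 P)]
          gcongr with p hp
          · exact Finset.prod_nonneg fun p hp => hb p (Finset.mem_sdiff.1 hp).1 P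
          · exact he p (hA hp) P
      _ = (∏ p ∈ A, κ p) * (∑ P ∈ 𝓕 ×ˢ 𝓕, ∏ p ∈ 𝒬 \ A, diagFactor g p P) ^ s := by
          rw [← Finset.mul_sum, hswap]
      _ ≤ (∏ p ∈ A, κ p) * (4 ^ A.card * G) ^ s := by
          gcongr
          · exact Finset.prod_nonneg fun p hp => hκ p (hA hp)
          · exact Finset.sum_nonneg fun P _ => Finset.prod_nonneg fun p hp =>
              diagFactor_nonneg (hg p (Finset.mem_sdiff.1 hp).1) _
          · exact sum_prod_sdiff_diagFactor_le hg h𝒬 h𝓕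
      _ = _ := by
          rw [Finset.prod_mul_distrib, Finset.prod_const, mul_pow, ← pow_mul, ← pow_mul, mul_comm s]
          ring
  have hexp : ∑ P ∈ Ω, ∏ p ∈ 𝒬, e p P = ∑ A ∈ 𝒬.powerset,
      ∑ P ∈ Ω, (∏ p ∈ A, (e p P - b p P)) * ∏ p ∈ 𝒬 \ A, b p P := by
    rw [Finset.sum_comm]
    refine Finset.sum_congr rfl fun P _ => ?_
    rw [← Finset.prod_add]
    simp
  have hempty : ∑ P ∈ Ω, (∏ p ∈ (∅ : Finset ι), (e p P - b p P)) * ∏ p ∈ 𝒬 \ ∅, b p P = G ^ s := by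
    simp only [Finset.prod_empty, one_mul, Finset.sdiff_empty]
    rw [hswap, sum_prod_diagFactor h𝒬]
  have hmem : ∅ ∈ 𝒬.powerset := by simp
  rw [hexp, ← Finset.add_sum_erase _ _ hmem, hempty, add_sub_cancel_left]
  refine (Finset.abs_sum_le_sum_abs _ _).trans ((Finset.sum_le_sum fun A hA =>
    hterm A (Finset.mem_of_mem_erase hA)).trans_eq ?_)
  rw [Finset.prod_one_add, ← Finset.add_sum_erase _ _ hmem, ← Finset.sum_mul]
  simp [mul_comm]

end DiagonalSums

section AffineForms

variable {T : Type} [Fintype T] [DecidableEq T] {n : ℕ} [NeZero n]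

/-- An affine form over `ZMod n`. -/
def affineForm (u : ZMod n) (c z : T → ZMod n) : ZMod n := u + ∑ i, c i * z i

omit [NeZero n] in
theorem affineForm_update (u : ZMod n) (c z : T → ZMod n) (i : T) (t : ZMod n) :
    affineForm u c (update z i t) = t * c i + (u + ∑ j ∈ Finset.univ.erase i, c j * z j) := by
  rw [affineForm, ← Finset.add_sum_erase _ _ (Finset.mem_univ i), update_self, Finset.sum_congr rfl
    fun j hj => by rw [update_of_ne (Finset.ne_of_mem_erase hj)]]
  ring

omit [NeZero n] in
theorem affineForm_indep {u : ZMod n} {c : T → ZMod n} {i : T} (hc : c i = 0) (F : ZMod n → ℝ) :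
    IndepOf i fun z => F (affineForm u c z) := fun z t => by
  have := affineForm_update u c z i
  have h2 := this (z i)
  rw [update_eq_self] at h2
  simp only [this t, h2, hc, mul_zero]

omit [NeZero n] in
theorem avg_affineForm_update {u : ZMod n} {c : T → ZMod n} {i : T} (hc : IsUnit (c i))
    (F : ZMod n → ℝ) (z : T → ZMod n) :
    (avg fun t => F (affineForm u c (update z i t))) = avg F := by
  simp_rw [affineForm_update]
  rw [avg_mul_isUnit (fun t => F (t + (u + ∑ j ∈ Finset.univ.erase i, c j * z j))) hc,
    avg_add_right]

theorem avg_affineForm {u : ZMod n} {c : T → ZMod n} {i : T} (hc : IsUnit (c i))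
    (F : ZMod n → ℝ) : (avg fun z => F (affineForm u c z)) = avg F := by
  rw [← avg_update i]
  simp_rw [avg_affineForm_update hc]
  exact avg_const _

theorem avg_mul_affineForm {u : ZMod n} {c : T → ZMod n} {i : T} (hc : IsUnit (c i))
    (F : ZMod n → ℝ) {A : (T → ZMod n) → ℝ} (hA : IndepOf i A) :
    (avg fun z => A z * F (affineForm u c z)) = avg A * avg F := by
  rw [avg_mul_indep hA]
  simp_rw [avg_affineForm_update hc]
  exact avg_mul_right _ _

theorem avg_ind_eq_zero : (avg fun x : ZMod n => ind (x = 0)) = 1 / n := by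
  rw [avg_eq_sum, Finset.sum_eq_single 0 (fun x _ hx => ind_of_false hx) (by simp),
    ind_of_true rfl, ZMod.card]

end AffineForms

/-- The local factor of the Selberg weight. -/
noncomputable def ramanujanWeight (p : ℕ) (b : Prop) : ℝ := -ind b + (1 - ind b) / (p - 1)

/-- The contribution of the prime `p` to the correlation of products of local factors. -/
noncomputable def localMean {S T : Type} [Fintype S] [Fintype T] {p : ℕ} (u : S → ZMod p) (c : S → T → ZMod p) (P : S → Finset ℕ × Finset ℕ) :
    ℝ :=
  avg fun z => ∏ q, (if p ∈ (P q).1 then ramanujanWeight p (affineForm (u q) (c q) z = 0) else 1) *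
    (if p ∈ (P q).2 then ramanujanWeight p (affineForm (u q) (c q) z = 0) else 1)

theorem localMean_of_notMem {S T : Type} [Fintype S] [Fintype T] {p : ℕ} [NeZero p]
    (u : S → ZMod p) (c : S → T → ZMod p) {P : S → Finset ℕ × Finset ℕ}
    (hP : ∀ q, p ∉ (P q).1 ∧ p ∉ (P q).2) : localMean u c P = 1 := by
  simp [localMean, hP, avg_const]

section LocalFactor

variable {S T : Type} [Fintype S] [DecidableEq S] [Fintype T] [DecidableEq T] {p : ℕ} [Fact p.Prime]

/-- The independence assumption on affine forms. -/
structure PairwiseSplit {S T : Type} {n : ℕ} (c : S → T → ZMod n) : Prop where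
  exists_isUnit : ∀ q, ∃ i, IsUnit (c q i)
  split : ∀ q q', q ≠ q' → ∃ i, IsUnit (c q i) ∧ c q' i = 0

omit [Fintype S] [DecidableEq S] in
theorem abs_avg_prod_ind_sub_le {c : S → T → ZMod p} (hc : PairwiseSplit c) (u : S → ZMod p)
    (U : Finset S) :
    |(avg fun z => ∏ q ∈ U, ind (affineForm (u q) (c q) z = 0)) - ∏ _q ∈ U, (1 / p : ℝ)| ≤
      1 / (p : ℝ) ^ 2 := by
  have hp : (1 : ℝ) ≤ p := mod_cast (Fact.out : p.Prime).one_le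
  have hp1 : 1 / (p : ℝ) ≤ 1 := by rw [div_le_one (by linarith)]; exact hp
  rcases lt_trichotomy U.card 1 with h | h | h
  · rw [Finset.card_eq_zero.1 (by omega : U.card = 0)]
    simp [avg_const]
  · obtain ⟨q, rfl⟩ := Finset.card_eq_one.1 h
    obtain ⟨i, hi⟩ := hc.exists_isUnit q
    simp only [Finset.prod_singleton]
    rw [avg_affineForm hi fun x => ind (x = 0), avg_ind_eq_zero]
    simp
  · obtain ⟨q, hq, q', hq', hne⟩ := Finset.one_lt_card.1 h
    obtain ⟨i, hi, hi0⟩ := hc.split q q' hne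
    obtain ⟨i', hi'⟩ := hc.exists_isUnit q'
    have h1 : (avg fun z => ∏ q ∈ U, ind (affineForm (u q) (c q) z = 0)) ≤ 1 / (p : ℝ) ^ 2 := by
      have : (avg fun z => ind (affineForm (u q') (c q') z = 0) *
          ind (affineForm (u q) (c q) z = 0)) = 1 / (p : ℝ) ^ 2 := by
        rw [avg_mul_affineForm hi (fun x => ind (x = 0))
          (affineForm_indep hi0 fun x => ind (x = 0)), avg_affineForm hi' fun x => ind (x = 0),
          avg_ind_eq_zero]
        ring
      rw [← this]
      refine avg_mono fun z => ?_
      rw [← ind_forall_finset, ← ind_and]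
      exact ind_mono fun h => ⟨h q' hq', h q hq⟩
    have h2 : 0 ≤ avg fun z => ∏ q ∈ U, ind (affineForm (u q) (c q) z = 0) :=
      avg_nonneg fun z => Finset.prod_nonneg fun q _ => ind_nonneg _
    have h3 : ∏ _q ∈ U, (1 / p : ℝ) ≤ 1 / (p : ℝ) ^ 2 := by
      rw [Finset.prod_const, ← one_div_pow]
      exact pow_le_pow_of_le_one (by positivity) hp1 h
    have h4 : 0 ≤ ∏ _q ∈ U, (1 / p : ℝ) := by positivity
    rw [abs_le]
    constructor <;> linarith

theorem abs_localMean_sub_le {c : S → T → ZMod p} (hc : PairwiseSplit c) (u : S → ZMod p)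
    (P : S → Finset ℕ × Finset ℕ) :
    |localMean u c P - ∏ q, diagFactor (fun p : ℕ => 1 / ((p : ℝ) - 1)) p (P q)| ≤
      4 ^ Fintype.card S / (p : ℝ) ^ 2 := by
  have hp : (2 : ℝ) ≤ p := mod_cast (Fact.out : p.Prime).two_le
  set g : ℝ := 1 / ((p : ℝ) - 1) with hg
  have hg0 : 0 ≤ g := by rw [hg]; exact div_nonneg zero_le_one (by linarith)
  have hg1 : g ≤ 1 := by rw [hg, div_le_one (by linarith)]; linarith
  have hkey : ∀ Q : Finset ℕ × Finset ℕ, ∃ a b : ℝ, |a| ≤ 1 ∧ |b| ≤ 2 ∧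
      (∀ x : Prop, (if p ∈ Q.1 then ramanujanWeight p x else 1) *
        (if p ∈ Q.2 then ramanujanWeight p x else 1) = b * ind x + a) ∧
      diagFactor (fun p : ℕ => 1 / ((p : ℝ) - 1)) p Q = b * (1 / p) + a := by
    intro Q
    have hw : ∀ x, ramanujanWeight p x = (-1 - g) * ind x + g := fun x => by
      rw [ramanujanWeight, hg]; ring
    have hpg : g * ((p : ℝ) - 1) = 1 := by rw [hg]; field_simp [show (p : ℝ) - 1 ≠ 0 by linarith]
    by_cases h1 : p ∈ Q.1 <;> by_cases h2 : p ∈ Q.2 <;>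
      simp only [diagFactor, h1, h2, if_true, if_false, hw]
    · refine ⟨g ^ 2, 1 - g ^ 2, ?_, ?_, fun x => ?_, ?_⟩
      · rw [abs_of_nonneg (by positivity)]; nlinarith
      · rw [abs_of_nonneg (by nlinarith)]; nlinarith
      · by_cases hx : x
        · rw [ind_of_true hx]; ring
        · rw [ind_of_false hx]; ring
      · rw [← hg]
        field_simp
        linear_combination (1 - g) * hpg
    · refine ⟨g, -1 - g, ?_, ?_, fun x => by ring, ?_⟩
      · rwa [abs_of_nonneg hg0]
      · rw [abs_of_nonpos (by linarith)]; linarith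
      · field_simp
        linear_combination -hpg
    · refine ⟨g, -1 - g, ?_, ?_, fun x => by ring, ?_⟩
      · rwa [abs_of_nonneg hg0]
      · rw [abs_of_nonpos (by linarith)]; linarith
      · field_simp
        linear_combination -hpg
    · exact ⟨1, 0, by simp, by simp, fun x => by ring, by ring⟩
  choose a b ha hb hab hd using hkey
  simp only [localMean, hab, hd, Finset.prod_add, Finset.prod_mul_distrib]
  rw [avg_sum, ← Finset.sum_sub_distrib]
  calc _ ≤ ∑ U ∈ (Finset.univ : Finset S).powerset, 2 ^ Fintype.card S * (1 / (p : ℝ) ^ 2) := by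
        refine (Finset.abs_sum_le_sum_abs _ _).trans (Finset.sum_le_sum fun U _ => ?_)
        have h1 : (avg fun z => (∏ q ∈ U, b (P q)) * (∏ q ∈ U, ind (affineForm (u q) (c q) z = 0)) *
            ∏ q ∈ Finset.univ \ U, a (P q)) = (∏ q ∈ U, b (P q)) * (∏ q ∈ Finset.univ \ U, a (P q)) *
            avg fun z => ∏ q ∈ U, ind (affineForm (u q) (c q) z = 0) := by
          rw [← avg_mul_left]
          exact avg_congr fun z => by ring
        rw [h1, show ∀ x y z v : ℝ, x * y * z - x * v * y = x * y * (z - v) by intros; ring,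
          abs_mul, abs_mul]
        have h2 : |∏ q ∈ U, b (P q)| ≤ 2 ^ Fintype.card S := by
          rw [Finset.abs_prod]
          calc _ ≤ ∏ _q ∈ U, (2 : ℝ) := Finset.prod_le_prod (fun _ _ => abs_nonneg _) fun q _ => hb _
            _ ≤ _ := by
              rw [Finset.prod_const]
              exact pow_le_pow_right₀ one_le_two (Finset.card_le_univ U)
        have h3 : |∏ q ∈ Finset.univ \ U, a (P q)| ≤ 1 := by
          rw [Finset.abs_prod]
          exact Finset.prod_le_one (fun _ _ => abs_nonneg _) fun q _ => ha _
        calc _ ≤ 2 ^ Fintype.card S * 1 * (1 / (p : ℝ) ^ 2) := by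
              gcongr
              exact abs_avg_prod_ind_sub_le hc u U
          _ = _ := by ring
    _ = _ := by
        rw [Finset.sum_const, Finset.card_powerset, nsmul_eq_mul, Finset.card_univ]
        push_cast
        rw [← mul_assoc, ← mul_pow]
        norm_num
        ring

end LocalFactor

section ChineseRemainder

theorem natCast_val_eq_apply {a b : ℕ} [NeZero b] (h : a ∣ b) (φ : ZMod b →+* ZMod a) (z : ZMod b) :
    ((z.val : ℕ) : ZMod a) = φ z := by
  rw [RingHom.ext_zmod φ (ZMod.castHom h (ZMod a)), ZMod.castHom_apply, ZMod.natCast_val]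

/-- Functions of the residues modulo distinct primes are independent. -/
theorem avg_prod_natCast_val {T : Type} [Fintype T] (s : Finset ℕ) (hs : ∀ p ∈ s, p.Prime)
    (g : ∀ p : ℕ, (T → ZMod p) → ℝ) :
    (avg fun z : T → ZMod (∏ p ∈ s, p) => ∏ p ∈ s, g p fun i => ((z i).val : ZMod p)) =
      ∏ p ∈ s, avg (g p) := by
  induction s using Finset.induction_on with
  | empty =>
    have : Unique (ZMod (∏ p ∈ (∅ : Finset ℕ), p)) := inferInstanceAs (Unique (Fin 1))
    simp [avg_const]
  | insert p s hp ih =>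
    have hpp : p.Prime := hs p (by simp)
    have hs' : ∀ q ∈ s, q.Prime := fun q hq => hs q (by simp [hq])
    rw [Finset.prod_insert (f := fun p => avg (g p)) hp, ← ih hs']
    set D := ∏ q ∈ s, q with hD
    have : NeZero p := ⟨hpp.ne_zero⟩
    have : NeZero D := ⟨Finset.prod_ne_zero_iff.2 fun q hq => (hs' q hq).ne_zero⟩
    have hcop : p.Coprime D := Nat.Coprime.prod_right fun q hq =>
      (Nat.coprime_primes hpp (hs' q hq)).2 fun h => hp (h ▸ hq)
    rw [Finset.prod_insert hp, ← hD]
    let e := ZMod.chineseRemainder hcop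
    let E : (T → ZMod (p * D)) ≃ (T → ZMod p) × (T → ZMod D) :=
      (Equiv.piCongrRight fun _ => e.toEquiv).trans (Equiv.arrowProdEquivProdArrow _ _ _)
    rw [avg_mul_avg, ← avg_prod (fun a : (T → ZMod p) × (T → ZMod D) =>
      g p a.1 * ∏ q ∈ s, g q fun i => ((a.2 i).val : ZMod q)), ← avg_equiv E (fun a =>
      g p a.1 * ∏ q ∈ s, g q fun i => ((a.2 i).val : ZMod q))]
    refine avg_congr fun z => ?_
    rw [Finset.prod_insert hp]
    congr 1
    · congr 1
      funext i
      exact natCast_val_eq_apply (dvd_mul_right p D) ((RingHom.fst _ _).comp e.toRingHom) (z i)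
    · refine Finset.prod_congr rfl fun q hq => ?_
      congr 1
      funext i
      have hqD : q ∣ D := Finset.dvd_prod_of_mem _ hq
      rw [natCast_val_eq_apply (hqD.trans (dvd_mul_left D p)) ((ZMod.castHom hqD (ZMod q)).comp
        ((RingHom.snd _ _).comp e.toRingHom)) (z i),
        natCast_val_eq_apply hqD (ZMod.castHom hqD (ZMod q))]
      rfl

end ChineseRemainder

section WrapAround

variable {S T : Type} [Fintype S] [DecidableEq S] [Fintype T] [DecidableEq T]

/-- The products of local factors occurring in the expansion of the sieve weights. -/
noncomputable def tupleProd (W B : ℕ) (P : S → Finset ℕ × Finset ℕ) (v : S → ℕ) : ℝ :=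
  ∏ q, (∏ p ∈ (P q).1, ramanujanWeight p (p ∣ W * v q + B)) *
    ∏ p ∈ (P q).2, ramanujanWeight p (p ∣ W * v q + B)

theorem abs_ramanujanWeight_le {p : ℕ} (hp : p.Prime) (b : Prop) : |ramanujanWeight p b| ≤ 1 := by
  have : (2 : ℝ) ≤ p := mod_cast hp.two_le
  by_cases hb : b
  · simp [ramanujanWeight, ind_of_true hb]
  · simp only [ramanujanWeight, ind_of_false hb]
    rw [neg_zero, zero_add, sub_zero, abs_of_nonneg (div_nonneg zero_le_one (by linarith)),
      div_le_one (by linarith)]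
    linarith

theorem abs_mul_le_one {a b : ℝ} (ha : |a| ≤ 1) (hb : |b| ≤ 1) : |a * b| ≤ 1 := by
  rw [abs_mul]; exact mul_le_one₀ ha (abs_nonneg _) hb

theorem abs_prod_le_one {ι : Type*} {s : Finset ι} {f : ι → ℝ} (h : ∀ i ∈ s, |f i| ≤ 1) :
    |∏ i ∈ s, f i| ≤ 1 := by
  rw [Finset.abs_prod]; exact Finset.prod_le_one (fun _ _ => abs_nonneg _) h

omit [DecidableEq S] in
theorem abs_tupleProd_le {W B : ℕ} {P : S → Finset ℕ × Finset ℕ}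
    (hP : ∀ q, (∀ p ∈ (P q).1, p.Prime) ∧ ∀ p ∈ (P q).2, p.Prime) (v : S → ℕ) :
    |tupleProd W B P v| ≤ 1 :=
  abs_prod_le_one fun q _ => abs_mul_le_one
    (abs_prod_le_one fun p hp => abs_ramanujanWeight_le ((hP q).1 p hp) _)
    (abs_prod_le_one fun p hp => abs_ramanujanWeight_le ((hP q).2 p hp) _)

omit [DecidableEq S] [DecidableEq T] in
theorem abs_localMean_le {p : ℕ} (hp : p.Prime) (u : S → ZMod p) (c : S → T → ZMod p)
    (P : S → Finset ℕ × Finset ℕ) : |localMean u c P| ≤ 1 := by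
  have : NeZero p := ⟨hp.ne_zero⟩
  refine abs_avg_le_of_le fun z => abs_prod_le_one fun q _ => abs_mul_le_one ?_ ?_ <;>
  · split_ifs
    · exact abs_ramanujanWeight_le hp _
    · simp

omit [DecidableEq S] in
theorem tupleProd_eq (W B : ℕ) {P : S → Finset ℕ × Finset ℕ} {s : Finset ℕ}
    (hP : ∀ q, (P q).1 ⊆ s ∧ (P q).2 ⊆ s) (v : S → ℕ) :
    tupleProd W B P v = ∏ p ∈ s, ∏ q,
      (if p ∈ (P q).1 then ramanujanWeight p (p ∣ W * v q + B) else 1) *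
      (if p ∈ (P q).2 then ramanujanWeight p (p ∣ W * v q + B) else 1) := by
  rw [Finset.prod_comm]
  refine Finset.prod_congr rfl fun q _ => ?_
  rw [Finset.prod_mul_distrib, Finset.prod_ite_mem, Finset.prod_ite_mem,
    Finset.inter_eq_right.2 (hP q).1, Finset.inter_eq_right.2 (hP q).2]

theorem ramanujanWeight_congr (p : ℕ) {a b : Prop} (h : a ↔ b) :
    ramanujanWeight p a = ramanujanWeight p b := by rw [propext h]

variable {N : ℕ} [NeZero N]

theorem avg_ind_near_boundary_le (m : ℕ) :
    (avg fun x : ZMod N => ind (¬ (m ≤ x.val ∧ x.val + m ≤ N))) ≤ 2 * m / N := by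
  classical
  have hN : (0 : ℝ) < N := mod_cast NeZero.pos N
  rw [avg_eq_sum, ZMod.card]
  gcongr
  calc ∑ x : ZMod N, ind (¬ (m ≤ x.val ∧ x.val + m ≤ N))
      = ((Finset.univ.filter fun x : ZMod N => ¬ (m ≤ x.val ∧ x.val + m ≤ N)).card : ℝ) := by
        rw [Finset.card_filter]
        push_cast
        exact Finset.sum_congr rfl fun x _ => by unfold ind; split_ifs <;> rfl
    _ ≤ ((Finset.range m ∪ (Finset.range N).filter fun v => N < v + m).card : ℝ) := by
        refine mod_cast Finset.card_le_card_of_injOn ZMod.val (fun x hx => ?_)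
          (ZMod.val_injective N).injOn
        have := ZMod.val_lt x
        simp only [Finset.coe_filter, Finset.mem_univ, true_and, Set.mem_ofPred_eq] at hx
        simp only [Finset.coe_union, Set.mem_union, Finset.mem_coe, Finset.mem_range,
          Finset.mem_filter]
        omega
    _ ≤ ((m + m : ℕ) : ℝ) := by
        refine mod_cast (Finset.card_union_le _ _).trans (add_le_add (by simp) ?_)
        refine (Finset.card_le_card_of_injOn (t := Finset.range m) (fun v => N - 1 - v)
          (fun v hv => ?_) fun v hv v' hv' h => ?_).trans_eq (Finset.card_range m)
        · simp only [Finset.coe_filter, Set.mem_ofPred_eq, Finset.mem_range] at hv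
          simp only [Finset.mem_coe, Finset.mem_range]
          omega
        · simp only [Finset.coe_filter, Set.mem_ofPred_eq, Finset.mem_range] at hv hv' h
          omega
    _ = 2 * m := by push_cast; ring

omit [DecidableEq S] in
/-- Averages of products of local factors along linear forms modulo `N` may be computed prime by
prime. -/
theorem abs_avg_tupleProd_sub_le (c : S → T → ℤ) {K : ℕ} (hK : ∀ q, ∑ i, |c q i| ≤ K)
    (hc : ∀ q, ∃ i, IsUnit (c q i : ZMod N)) (W B : ℕ) {P : S → Finset ℕ × Finset ℕ} {s : Finset ℕ}
    (hs : ∀ p ∈ s, p.Prime) (hP : ∀ q, (P q).1 ⊆ s ∧ (P q).2 ⊆ s) :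
    |(avg fun y : T → ZMod N => tupleProd W B P fun q => (∑ i, (c q i : ZMod N) * y i).val) -
      avg fun y : T → ZMod N => ∏ p ∈ s, localMean (fun q =>
        ((W * (∑ i, (c q i : ZMod N) * y i).val + B : ℕ) : ZMod p))
        (fun q i => (W : ZMod p) * (c q i : ZMod p)) P| ≤
      4 * Fintype.card S * K * (∏ p ∈ s, p : ℕ) / N := by
  set D := ∏ p ∈ s, p with hD
  have hD0 : NeZero D := ⟨Finset.prod_ne_zero_iff.2 fun q hq => (hs q hq).ne_zero⟩
  set ψ : S → (T → ZMod N) → ZMod N := fun q y => ∑ i, (c q i : ZMod N) * y i with hψ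
  set M : (T → ZMod N) → ℝ := fun y => ∏ p ∈ s, localMean (fun q =>
        ((W * (ψ q y).val + B : ℕ) : ZMod p)) (fun q i => (W : ZMod p) * (c q i : ZMod p)) P with hM
  set H : (T → ZMod N) → ℝ := fun y => tupleProd W B P fun q => (ψ q y).val with hH
  have hH1 : ∀ y, |H y| ≤ 1 := fun y => abs_tupleProd_le
    (fun q => ⟨fun p hp => hs p ((hP q).1 hp), fun p hp => hs p ((hP q).2 hp)⟩) _
  have hM1 : ∀ y, |M y| ≤ 1 := fun y => abs_prod_le_one fun p hp => abs_localMean_le (hs p hp) _ _ _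
  set good : ZMod N → Prop := fun x => K * D ≤ x.val ∧ x.val + K * D ≤ N
  let shift : (T → ZMod D) → T → ZMod N := fun z i => (((z i).val : ℕ) : ZMod N)
  have hshift : avg H = avg fun y => avg fun z : T → ZMod D => H (y + shift z) := by
    rw [avg_comm]
    have : ∀ z : T → ZMod D, (avg fun y => H (y + shift z)) = avg H := fun z => avg_add_right H _
    rw [avg_congr this, avg_const]
  have hgood : ∀ y, (∀ q, good (ψ q y)) →
      (avg fun z : T → ZMod D => H (y + shift z)) = M y := by
    intro y hy
    have hval : ∀ (q : S) (z : T → ZMod D), ((ψ q (y + shift z)).val : ℤ) =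
        (ψ q y).val + ∑ i, c q i * (z i).val := by
      intro q z
      have h1 : |∑ i, c q i * ((z i).val : ℤ)| ≤ K * D - K := by
        calc _ ≤ ∑ i, |c q i| * (D - 1) := by
              refine (Finset.abs_sum_le_sum_abs _ _).trans (Finset.sum_le_sum fun i _ => ?_)
              rw [abs_mul]
              have := ZMod.val_lt (z i)
              gcongr
              rw [abs_of_nonneg (by positivity)]
              omega
          _ ≤ (K : ℤ) * (D - 1) := by
              rw [← Finset.sum_mul]
              have := NeZero.pos D
              exact mul_le_mul_of_nonneg_right (hK q) (by omega)
          _ = _ := by ring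
      have h2 : ψ q (y + shift z) =
          (((ψ q y).val + ∑ i, c q i * (z i).val : ℤ) : ZMod N) := by
        push_cast
        rw [ZMod.natCast_zmod_val]
        simp only [hψ, shift, Pi.add_apply, mul_add, Finset.sum_add_distrib]
      have h3 := (hy q).1
      have h4 := (hy q).2
      have h5 := abs_le.1 h1
      have h6 : (K * D : ℤ) ≤ (ψ q y).val := mod_cast h3
      have h7 : ((ψ q y).val + K * D : ℤ) ≤ N := mod_cast h4
      have h8 := ZMod.val_lt (ψ q y)
      rw [h2, ZMod.val_intCast]
      refine Int.emod_eq_of_lt (by omega) ?_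
      rcases Nat.eq_zero_or_pos K with hK0 | hK0
      · subst hK0
        simp only [Nat.cast_zero, zero_mul, sub_zero, abs_nonpos_iff] at h1
        omega
      · omega
    rw [hM]
    simp only [localMean]
    rw [← avg_prod_natCast_val s hs fun p z => ∏ q,
      (if p ∈ (P q).1 then ramanujanWeight p (affineForm ((W * (ψ q y).val + B : ℕ) : ZMod p)
        (fun i => (W : ZMod p) * (c q i : ZMod p)) z = 0) else 1) *
      (if p ∈ (P q).2 then ramanujanWeight p (affineForm ((W * (ψ q y).val + B : ℕ) : ZMod p)
        (fun i => (W : ZMod p) * (c q i : ZMod p)) z = 0) else 1)]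
    refine avg_congr fun z => ?_
    rw [hH]
    beta_reduce
    rw [tupleProd_eq W B hP]
    refine Finset.prod_congr rfl fun p hp => Finset.prod_congr rfl fun q _ => ?_
    have : ramanujanWeight p (p ∣ W * (ψ q (y + shift z)).val + B) =
        ramanujanWeight p (affineForm ((W * (ψ q y).val + B : ℕ) : ZMod p)
          (fun i => (W : ZMod p) * (c q i : ZMod p)) (fun i => ((z i).val : ZMod p)) = 0) := by
      refine ramanujanWeight_congr p ?_
      rw [← ZMod.natCast_eq_zero_iff]
      have h := congrArg (Int.cast : ℤ → ZMod p) (hval q z)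
      push_cast at h
      push_cast
      rw [h, affineForm, mul_add, Finset.mul_sum]
      simp only [mul_assoc]
      rw [add_right_comm]
    rw [this]
  have hpt : ∀ y, |(avg fun z : T → ZMod D => H (y + shift z)) - M y| ≤
      2 * ∑ q, ind (¬ good (ψ q y)) := by
    intro y
    by_cases hy : ∀ q, good (ψ q y)
    · rw [hgood y hy, sub_self, abs_zero]
      exact mul_nonneg zero_le_two (Finset.sum_nonneg fun q _ => ind_nonneg _)
    · push Not at hy
      obtain ⟨q, hq⟩ := hy
      have h1 : 1 ≤ ∑ q, ind (¬ good (ψ q y)) := by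
        rw [← ind_of_true hq]
        exact Finset.single_le_sum (f := fun q => ind (¬ good (ψ q y)))
          (fun q _ => ind_nonneg _) (Finset.mem_univ q)
      have h2 := abs_sub (avg fun z : T → ZMod D => H (y + shift z)) (M y)
      have h3 : |avg fun z : T → ZMod D => H (y + shift z)| ≤ 1 := abs_avg_le_of_le fun z => hH1 _
      linarith [hM1 y]
  rw [hshift, ← avg_sub]
  refine (abs_avg_le _).trans ((avg_mono hpt).trans ?_)
  rw [avg_mul_left, avg_sum]
  have hq : ∀ q, (avg fun y => ind (¬ good (ψ q y))) ≤ 2 * (K * D : ℕ) / N := by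
    intro q
    obtain ⟨i, hi⟩ := hc q
    have := avg_affineForm (u := 0) (c := fun i => (c q i : ZMod N)) hi fun x : ZMod N => ind (¬ good x)
    simp only [affineForm, zero_add] at this
    rw [hψ]
    beta_reduce
    rw [this]
    exact avg_ind_near_boundary_le (K * D)
  calc _ ≤ 2 * ∑ _q : S, 2 * ((K * D : ℕ) : ℝ) / N := by
        gcongr with q
        exact hq q
    _ = _ := by
        rw [Finset.sum_const, Finset.card_univ, nsmul_eq_mul]
        push_cast
        ring

end WrapAround

section SieveWeight

/-- The sets of primes of product at most `R`. -/
def sieveFamily (𝒬 : Finset ℕ) (R : ℕ) : Finset (Finset ℕ) :=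
  𝒬.powerset.filter fun F => ∏ p ∈ F, p ≤ R

/-- The normalising factor of the Selberg weight. -/
noncomputable def sieveNorm (𝒬 : Finset ℕ) (R : ℕ) : ℝ :=
  ∑ F ∈ sieveFamily 𝒬 R, ∏ p ∈ F, 1 / ((p : ℝ) - 1)

/-- The Selberg weight, an enveloping sieve for the integers without small prime factors. -/
noncomputable def sieveWeight (𝒬 : Finset ℕ) (R n : ℕ) : ℝ :=
  (∑ F ∈ sieveFamily 𝒬 R, ∏ p ∈ F, ramanujanWeight p (p ∣ n)) ^ 2 / sieveNorm 𝒬 R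

variable {𝒬 : Finset ℕ} {R : ℕ}

theorem subset_of_mem_sieveFamily {F : Finset ℕ} (hF : F ∈ sieveFamily 𝒬 R) : F ⊆ 𝒬 :=
  Finset.mem_powerset.1 (Finset.mem_filter.1 hF).1

theorem prod_le_of_mem_sieveFamily {F : Finset ℕ} (hF : F ∈ sieveFamily 𝒬 R) : ∏ p ∈ F, p ≤ R :=
  (Finset.mem_filter.1 hF).2

theorem empty_mem_sieveFamily (hR : 1 ≤ R) : ∅ ∈ sieveFamily 𝒬 R := by
  simp [sieveFamily, hR]

variable (h𝒬 : ∀ p ∈ 𝒬, p.Prime)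

include h𝒬

theorem card_sieveFamily_le : (sieveFamily 𝒬 R).card ≤ R := by
  have hprime : ∀ F ∈ sieveFamily 𝒬 R, ∀ p ∈ F, p.Prime := fun F hF p hp =>
    h𝒬 p (subset_of_mem_sieveFamily hF hp)
  calc _ ≤ (Finset.Icc 1 R).card := by
        refine Finset.card_le_card_of_injOn (fun F => ∏ p ∈ F, p) (fun F hF => ?_)
          fun F hF F' hF' h => ?_
        · rw [Finset.mem_coe, Finset.mem_Icc]
          exact ⟨Finset.one_le_prod' fun p hp => (hprime F hF p hp).one_le,
            prod_le_of_mem_sieveFamily hF⟩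
        · rw [← Nat.primeFactors_prod (hprime F hF), ← Nat.primeFactors_prod (hprime F' hF')]
          exact congrArg _ h
    _ = R := by simp

theorem one_div_sub_one_nonneg {p : ℕ} (hp : p ∈ 𝒬) : (0 : ℝ) ≤ 1 / ((p : ℝ) - 1) :=
  div_nonneg zero_le_one (sub_nonneg.2 (mod_cast (h𝒬 p hp).one_le))

theorem one_le_sieveNorm (hR : 1 ≤ R) : 1 ≤ sieveNorm 𝒬 R := by
  calc (1 : ℝ) = ∏ p ∈ (∅ : Finset ℕ), 1 / ((p : ℝ) - 1) := by simp
    _ ≤ _ := Finset.single_le_sum (f := fun F : Finset ℕ => ∏ p ∈ F, 1 / ((p : ℝ) - 1))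
      (fun F hF => Finset.prod_nonneg fun p hp =>
        one_div_sub_one_nonneg h𝒬 (subset_of_mem_sieveFamily hF hp)) (empty_mem_sieveFamily hR)

omit h𝒬 in
theorem prod_sieveWeight_eq {S : Type} [Fintype S] [DecidableEq S] (W B : ℕ) (v : S → ℕ) :
    ∏ q, sieveWeight 𝒬 R (W * v q + B) = (sieveNorm 𝒬 R ^ Fintype.card S)⁻¹ *
      ∑ P ∈ Fintype.piFinset (fun _ : S => sieveFamily 𝒬 R ×ˢ sieveFamily 𝒬 R),
        tupleProd W B P v := by
  simp only [sieveWeight, tupleProd]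
  rw [Finset.prod_div_distrib, Finset.prod_const, Finset.card_univ, div_eq_inv_mul]
  congr 1
  rw [← Finset.prod_univ_sum (fun _ : S => sieveFamily 𝒬 R ×ˢ sieveFamily 𝒬 R) fun q P =>
    (∏ p ∈ P.1, ramanujanWeight p (p ∣ W * v q + B)) *
      ∏ p ∈ P.2, ramanujanWeight p (p ∣ W * v q + B)]
  refine Finset.prod_congr rfl fun q _ => ?_
  rw [sq, Finset.sum_mul_sum, Finset.sum_product]

omit h𝒬 in
theorem prod_one_add_div_sq_le {w : ℕ} (hw : 1 ≤ w) (hw𝒬 : ∀ p ∈ 𝒬, w < p) {C : ℝ} (hC : 0 ≤ C) :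
    ∏ p ∈ 𝒬, (1 + C / (p : ℝ) ^ 2) ≤ Real.exp (C / w) := by
  have h1 : ∑ p ∈ 𝒬, ((p : ℝ) ^ 2)⁻¹ ≤ (w : ℝ)⁻¹ := by
    set n := max w (𝒬.sup id)
    calc _ ≤ ∑ p ∈ Finset.Ioc w n, ((p : ℝ) ^ 2)⁻¹ := by
          refine Finset.sum_le_sum_of_subset_of_nonneg (fun p hp => ?_) fun p _ _ => by positivity
          rw [Finset.mem_Ioc]
          exact ⟨hw𝒬 p hp, (Finset.le_sup (f := id) hp).trans (le_max_right _ _)⟩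
      _ ≤ (w : ℝ)⁻¹ - (n : ℝ)⁻¹ := sum_Ioc_inv_sq_le_sub (by omega) (le_max_left _ _)
      _ ≤ _ := by simp
  calc _ ≤ ∏ p ∈ 𝒬, Real.exp (C / (p : ℝ) ^ 2) := by
        refine Finset.prod_le_prod (fun p _ => by positivity) fun p _ => ?_
        rw [add_comm]
        exact Real.add_one_le_exp _
    _ = Real.exp (C * ∑ p ∈ 𝒬, ((p : ℝ) ^ 2)⁻¹) := by
        rw [← Real.exp_sum, Finset.mul_sum]
        simp only [div_eq_mul_inv]
    _ ≤ _ := by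
        rw [div_eq_mul_inv]
        gcongr

theorem exists_support {S : Type} [Fintype S] [DecidableEq S] {P : S → Finset ℕ × Finset ℕ}
    (hP : P ∈ Fintype.piFinset (fun _ : S => sieveFamily 𝒬 R ×ˢ sieveFamily 𝒬 R)) :
    ∃ s ⊆ 𝒬, (∀ q, (P q).1 ⊆ s ∧ (P q).2 ⊆ s) ∧ (∀ p ∈ 𝒬, p ∉ s → ∀ q, p ∉ (P q).1 ∧ p ∉ (P q).2) ∧
      ∏ p ∈ s, p ≤ R ^ (2 * Fintype.card S) := by
  have hP' : ∀ q, (P q).1 ∈ sieveFamily 𝒬 R ∧ (P q).2 ∈ sieveFamily 𝒬 R := fun q =>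
    Finset.mem_product.1 (Fintype.mem_piFinset.1 hP q)
  have hsub : ∀ q, (P q).1 ∪ (P q).2 ⊆ 𝒬 := fun q =>
    Finset.union_subset (subset_of_mem_sieveFamily (hP' q).1) (subset_of_mem_sieveFamily (hP' q).2)
  have hs : (Finset.univ.biUnion fun q => (P q).1 ∪ (P q).2) ⊆ 𝒬 := by
    rw [Finset.biUnion_subset]; exact fun q _ => hsub q
  refine ⟨_, hs, fun q => ?_, fun p _ hp q => ?_, ?_⟩
  · have := Finset.subset_biUnion_of_mem (fun q => (P q).1 ∪ (P q).2) (Finset.mem_univ q)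
    exact ⟨Finset.subset_union_left.trans this, Finset.subset_union_right.trans this⟩
  · simp only [Finset.mem_biUnion, Finset.mem_univ, true_and, Finset.mem_union, not_exists,
      not_or] at hp
    exact hp q
  · have hpos : ∀ q, 0 < (∏ p ∈ (P q).1, p) * ∏ p ∈ (P q).2, p := fun q => Nat.mul_pos
      (Finset.prod_pos fun p hp => (h𝒬 p (subset_of_mem_sieveFamily (hP' q).1 hp)).pos)
      (Finset.prod_pos fun p hp => (h𝒬 p (subset_of_mem_sieveFamily (hP' q).2 hp)).pos)
    have hdvd : ∏ p ∈ Finset.univ.biUnion fun q => (P q).1 ∪ (P q).2, p ∣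
        ∏ q, ((∏ p ∈ (P q).1, p) * ∏ p ∈ (P q).2, p) := by
      refine Finset.prod_primes_dvd _ (fun p hp => (h𝒬 p (hs hp)).prime) fun p hp => ?_
      obtain ⟨q, -, hq⟩ := Finset.mem_biUnion.1 hp
      refine dvd_trans ?_ (Finset.dvd_prod_of_mem _ (Finset.mem_univ q))
      rcases Finset.mem_union.1 hq with h | h
      · exact (Finset.dvd_prod_of_mem _ h).mul_right _
      · exact (Finset.dvd_prod_of_mem _ h).mul_left _
    refine (Nat.le_of_dvd (Finset.prod_pos fun q _ => hpos q) hdvd).trans ?_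
    calc _ ≤ ∏ _q : S, R * R := Finset.prod_le_prod' fun q _ => Nat.mul_le_mul
          (prod_le_of_mem_sieveFamily (hP' q).1) (prod_le_of_mem_sieveFamily (hP' q).2)
      _ = _ := by rw [Finset.prod_const, Finset.card_univ, pow_mul, sq]

/-- Correlations of the Selberg weight along linear forms. -/
theorem abs_avg_prod_sieveWeight_sub_one_le {S T : Type} [Fintype S] [DecidableEq S] [Fintype T]
    [DecidableEq T] {N : ℕ} [NeZero N] (c : S → T → ℤ) {K : ℕ} (hK : ∀ q, ∑ i, |c q i| ≤ K)
    (hc : ∀ q, ∃ i, IsUnit (c q i : ZMod N)) {W B w : ℕ} (hw : 1 ≤ w) (hw𝒬 : ∀ p ∈ 𝒬, w < p)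
    (hW : ∀ p ∈ 𝒬, p.Coprime W) (hsplit : ∀ p ∈ 𝒬, PairwiseSplit fun q i => (c q i : ZMod p))
    (hR : 1 ≤ R) :
    |(avg fun y : T → ZMod N => ∏ q, sieveWeight 𝒬 R (W * (∑ i, (c q i : ZMod N) * y i).val + B))
      - 1| ≤ 4 * Fintype.card S * K * R ^ (4 * Fintype.card S) / N +
        (Real.exp (16 ^ Fintype.card S / w) - 1) := by
  set s := Fintype.card S with hs
  set G := sieveNorm 𝒬 R
  set Ω := Fintype.piFinset (fun _ : S => sieveFamily 𝒬 R ×ˢ sieveFamily 𝒬 R)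
  have hG1 : 1 ≤ G := one_le_sieveNorm h𝒬 hR
  have hG0 : (0 : ℝ) < G ^ s := by positivity
  have hGinv : (G ^ s)⁻¹ ≤ 1 := inv_le_one_of_one_le₀ (one_le_pow₀ hG1)
  have hR1 : (1 : ℝ) ≤ R := mod_cast hR
  set v : S → (T → ZMod N) → ℕ := fun q y => (∑ i, (c q i : ZMod N) * y i).val
  set M : (T → ZMod N) → (S → Finset ℕ × Finset ℕ) → ℝ := fun y P => ∏ p ∈ 𝒬,
    localMean (fun q => ((W * v q y + B : ℕ) : ZMod p))
      (fun q i => (W : ZMod p) * (c q i : ZMod p)) P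
  have hΩ : (Ω.card : ℝ) ≤ R ^ (2 * s) := by
    rw [Fintype.card_piFinset, Finset.prod_const, Finset.card_univ, Finset.card_product, ← sq,
      pow_mul]
    push_cast
    gcongr
    exact_mod_cast card_sieveFamily_le h𝒬
  have h1 : ∀ P ∈ Ω, |(avg fun y => tupleProd W B P fun q => v q y) - avg fun y => M y P| ≤
      4 * s * K * R ^ (2 * s) / N := by
    intro P hP
    obtain ⟨t, ht, htP, htn, hD⟩ := exists_support h𝒬 hP
    have hM : ∀ y, M y P = ∏ p ∈ t, localMean (fun q => ((W * v q y + B : ℕ) : ZMod p))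
        (fun q i => (W : ZMod p) * (c q i : ZMod p)) P := fun y => by
      refine (Finset.prod_subset ht fun p hp hpt => ?_).symm
      have : NeZero p := ⟨(h𝒬 p hp).ne_zero⟩
      exact localMean_of_notMem _ _ (htn p hp hpt)
    rw [avg_congr hM]
    refine (abs_avg_tupleProd_sub_le c hK hc W B (fun p hp => h𝒬 p (ht hp)) htP).trans ?_
    gcongr
    exact_mod_cast hD
  have h2 : ∀ y, |∑ P ∈ Ω, M y P - G ^ s| ≤ G ^ s * (Real.exp (16 ^ s / w) - 1) := by
    intro y
    have key := abs_sum_prod_sub_le (S := S) (𝒬 := 𝒬) (𝓕 := sieveFamily 𝒬 R)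
      (g := fun p : ℕ => 1 / ((p : ℝ) - 1)) (κ := fun p : ℕ => 4 ^ s / (p : ℝ) ^ 2)
      (fun p hp => one_div_sub_one_nonneg h𝒬 hp) (fun p _ => by positivity)
      (fun F hF => subset_of_mem_sieveFamily hF) (fun F hF E hE => ?_)
      (fun p P => localMean (fun q => ((W * v q y + B : ℕ) : ZMod p))
        (fun q i => (W : ZMod p) * (c q i : ZMod p)) P) (fun p hp P => ?_)
    · refine key.trans ?_
      change G ^ s * _ ≤ _
      gcongr
      refine le_trans (le_of_eq ?_) (prod_one_add_div_sq_le hw hw𝒬 (by positivity))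
      refine Finset.prod_congr rfl fun p _ => ?_
      rw [← mul_div_assoc, ← mul_pow, ← hs]
      norm_num
    · refine Finset.mem_filter.2 ⟨Finset.mem_powerset.2 (hE.trans (subset_of_mem_sieveFamily hF)),
        (Finset.prod_le_prod_of_subset_of_one_le' hE fun p hp _ => ?_).trans
          (prod_le_of_mem_sieveFamily hF)⟩
      exact (h𝒬 p (subset_of_mem_sieveFamily hF hp)).one_le
    · have : Fact p.Prime := ⟨h𝒬 p hp⟩
      have hWu : IsUnit (W : ZMod p) := (ZMod.isUnit_iff_coprime _ _).2 (hW p hp).symm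
      refine abs_localMean_sub_le ⟨fun q => ?_, fun q q' hqq => ?_⟩ _ P
      · obtain ⟨i, hi⟩ := (hsplit p hp).exists_isUnit q
        exact ⟨i, hWu.mul hi⟩
      · obtain ⟨i, hi, hi'⟩ := (hsplit p hp).split q q' hqq
        exact ⟨i, hWu.mul hi, by simp only [hi', mul_zero]⟩
  have h3 : (avg fun y : T → ZMod N => ∏ q, sieveWeight 𝒬 R (W * v q y + B)) - 1 =
      (G ^ s)⁻¹ * ∑ P ∈ Ω, ((avg fun y => tupleProd W B P fun q => v q y) - avg fun y => M y P) +
      (G ^ s)⁻¹ * avg fun y => ∑ P ∈ Ω, M y P - G ^ s := by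
    simp_rw [prod_sieveWeight_eq]
    rw [avg_mul_left, avg_sum, avg_sub, avg_sum, avg_const, Finset.sum_sub_distrib]
    have : (G ^ s)⁻¹ * G ^ s = 1 := inv_mul_cancel₀ hG0.ne'
    linear_combination this
  rw [h3]
  refine (abs_add_le _ _).trans (add_le_add ?_ ?_)
  · rw [abs_mul, abs_of_pos (inv_pos.2 hG0)]
    calc _ ≤ 1 * ∑ P ∈ Ω, 4 * s * K * (R : ℝ) ^ (2 * s) / N := by
          gcongr
          exact (Finset.abs_sum_le_sum_abs _ _).trans (Finset.sum_le_sum h1)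
      _ = Ω.card * (4 * s * K * (R : ℝ) ^ (2 * s) / N) := by
          rw [one_mul, Finset.sum_const, nsmul_eq_mul]
      _ ≤ R ^ (2 * s) * (4 * s * K * (R : ℝ) ^ (2 * s) / N) := by gcongr
      _ = _ := by
          rw [show 4 * s = 2 * s + 2 * s by ring, pow_add]
          ring
  · rw [abs_mul, abs_of_pos (inv_pos.2 hG0)]
    calc _ ≤ (G ^ s)⁻¹ * (G ^ s * (Real.exp (16 ^ s / w) - 1)) := by
          gcongr
          exact abs_avg_le_of_le h2
      _ = _ := by rw [inv_mul_cancel_left₀ hG0.ne']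

end SieveWeight

section SieveForms

variable {r : ℕ}

/-- The coefficients of the linear form `apForm` at the point selected by a label. -/
def labelCoeff (p : Fin (r + 2) × (Fin (r + 2) → Bool)) : Fin (r + 2) ⊕ Fin (r + 2) → ℤ :=
  Sum.elim (fun i => if p.2 i then 0 else (i : ℕ) - (p.1 : ℕ))
    fun i => if p.2 i then (i : ℕ) - (p.1 : ℕ) else 0

theorem apForm_pick {N : ℕ} (p : Fin (r + 2) × (Fin (r + 2) → Bool))
    (x : Fin (r + 2) ⊕ Fin (r + 2) → ZMod N) :
    apForm N p.1 (pick p.2 x) = ∑ t, (labelCoeff p t : ZMod N) * x t := by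
  rw [Fintype.sum_sum_type, ← Finset.sum_add_distrib]
  refine Finset.sum_congr rfl fun i _ => ?_
  cases h : p.2 i <;> simp [labelCoeff, pick, h]

theorem sum_abs_labelCoeff_le (p : Fin (r + 2) × (Fin (r + 2) → Bool)) :
    ∑ t, |labelCoeff p t| ≤ ((2 * (r + 2) ^ 2 : ℕ) : ℤ) := by
  have : ∀ t, |labelCoeff p t| ≤ (r + 2 : ℕ) := by
    rintro (i | i) <;> simp only [labelCoeff, Sum.elim_inl, Sum.elim_inr] <;> split_ifs <;>
      rw [abs_le] <;> constructor <;> omega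
  refine (Finset.sum_le_sum fun t _ => this t).trans (le_of_eq ?_)
  simp
  ring

theorem isUnit_labelCoeff {n : ℕ} (hn : n.Coprime (r + 2).factorial)
    (p : Fin (r + 2) × (Fin (r + 2) → Bool)) {i : Fin (r + 2)} (hi : i ≠ p.1) :
    IsUnit (labelCoeff p (cond (p.2 i) (.inr i) (.inl i)) : ZMod n) := by
  have := isUnit_natCast_sub hn (a := i) (b := p.1) (by omega) (by omega)
    fun h => hi (Fin.ext h)
  cases h : p.2 i <;> simpa [labelCoeff, h] using this

theorem exists_isUnit_labelCoeff {n : ℕ} (hn : n.Coprime (r + 2).factorial)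
    (p : Fin (r + 2) × (Fin (r + 2) → Bool)) : ∃ t, IsUnit (labelCoeff p t : ZMod n) := by
  obtain ⟨i, hi⟩ := exists_ne p.1
  exact ⟨_, isUnit_labelCoeff hn p hi⟩

theorem pairwiseSplit_labelCoeff {n : ℕ} (hn : n.Coprime (r + 2).factorial)
    {S : Finset (Fin (r + 2) × (Fin (r + 2) → Bool))} (hS : ∀ p ∈ S, p.2 p.1 = false) :
    PairwiseSplit fun (q : S) t => (labelCoeff q.1 t : ZMod n) := by
  refine ⟨fun q => exists_isUnit_labelCoeff hn q.1, fun q q' hqq => ?_⟩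
  obtain ⟨⟨j, ω⟩, hq⟩ := q
  obtain ⟨⟨j', ω'⟩, hq'⟩ := q'
  by_cases hj : j' = j
  · subst hj
    have : ∃ i, ω i ≠ ω' i := by
      by_contra! h
      exact hqq (by rw [Subtype.mk.injEq, funext h])
    obtain ⟨i, hi⟩ := this
    have hij : i ≠ j' := by
      rintro rfl
      exact hi ((hS _ hq).trans (hS _ hq').symm)
    refine ⟨_, isUnit_labelCoeff hn (j', ω) hij, ?_⟩
    cases h : ω i <;> cases h' : ω' i <;> simp_all [labelCoeff]
  · refine ⟨_, isUnit_labelCoeff hn (j, ω) hj, ?_⟩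
    dsimp only
    cases ω j' <;> simp [labelCoeff]

/-- The Selberg weight, restricted to a residue class, satisfies the linear forms condition. -/
theorem exists_linearFormsCondition_sieveWeight (r : ℕ) :
    ∃ m : ℕ, ∀ ε : ℝ, 0 < ε → ∃ w : ℕ, ∃ C : ℝ, 0 < C ∧ ∀ (𝒬 : Finset ℕ) (R N W B : ℕ) [NeZero N],
      (∀ p ∈ 𝒬, p.Prime ∧ w < p ∧ p.Coprime W) → 1 ≤ R → N.Coprime (r + 2).factorial →
      C * R ^ m ≤ N → LinearFormsCondition
        (fun (j : Fin (r + 2)) x => sieveWeight 𝒬 R (W * (apForm N j x).val + B)) ε := by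
  set s₀ := Fintype.card (Fin (r + 2) × (Fin (r + 2) → Bool))
  refine ⟨4 * s₀, fun ε hε => ?_⟩
  set K := 2 * (r + 2) ^ 2
  have hs₀1 : 1 ≤ s₀ := Fintype.card_pos
  have hexp : ∃ w : ℕ, 1 ≤ w ∧ r + 2 ≤ w ∧ Real.exp (16 ^ s₀ / w) - 1 ≤ ε / 2 := by
    have : Filter.Tendsto (fun w : ℕ => Real.exp (16 ^ s₀ / (w : ℝ)) - 1) Filter.atTop
        (nhds (Real.exp 0 - 1)) :=
      ((Real.continuous_exp.tendsto 0).comp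
        (tendsto_const_div_atTop_nhds_zero_nat (16 ^ s₀ : ℝ))).sub_const 1
    rw [Real.exp_zero, sub_self] at this
    obtain ⟨w, h, hw⟩ := (((this.eventually_le_const (half_pos hε))).and
      (Filter.eventually_ge_atTop (r + 2))).exists
    exact ⟨w, by omega, hw, h⟩
  obtain ⟨w, hw1, hwr, hw⟩ := hexp
  refine ⟨w, 8 * s₀ * K / ε, by positivity, ?_⟩
  intro 𝒬 R N W B _ h𝒬 hR hN hCR S hS
  have hN0 : (0 : ℝ) < N := mod_cast Nat.pos_of_ne_zero (NeZero.ne N)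
  have hcard : Fintype.card S ≤ s₀ := by
    rw [Fintype.card_coe]
    exact Finset.card_le_univ S
  have hp : ∀ p ∈ 𝒬, p.Coprime (r + 2).factorial := fun p hp =>
    (h𝒬 p hp).1.coprime_factorial_of_lt (by have := (h𝒬 p hp).2.1; omega)
  have key := abs_avg_prod_sieveWeight_sub_one_le (fun p hp => (h𝒬 p hp).1)
    (fun q : S => labelCoeff q.1) (fun q => sum_abs_labelCoeff_le q.1)
    (fun q => exists_isUnit_labelCoeff hN q.1) (W := W) (B := B) hw1 (fun p hp => (h𝒬 p hp).2.1)
    (fun p hp => (h𝒬 p hp).2.2) (fun p h => pairwiseSplit_labelCoeff (hp p h) hS) hR (N := N)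
  have heq : (avg fun x => ∏ p ∈ S, liftWeight (fun (j : Fin (r + 2)) x =>
      sieveWeight 𝒬 R (W * (apForm N j x).val + B)) p x) =
      avg fun y : Fin (r + 2) ⊕ Fin (r + 2) → ZMod N => ∏ q : S,
        sieveWeight 𝒬 R (W * (∑ t, (labelCoeff q.1 t : ZMod N) * y t).val + B) := by
    refine avg_congr fun x => ?_
    rw [← Finset.prod_coe_sort]
    refine Finset.prod_congr rfl fun p _ => ?_
    rw [liftWeight, apForm_pick]
  rw [heq]
  refine key.trans ?_
  have hR1 : (1 : ℝ) ≤ R := mod_cast hR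
  have h1 : 4 * (Fintype.card S : ℝ) * (K : ℕ) * (R : ℝ) ^ (4 * Fintype.card S) / N ≤ ε / 2 := by
    rw [div_le_iff₀ hN0]
    calc _ ≤ 4 * (s₀ : ℝ) * K * (R : ℝ) ^ (4 * s₀) := by gcongr
      _ = ε / 2 * (8 * s₀ * K / ε * R ^ (4 * s₀)) := by field_simp; ring
      _ ≤ _ := by gcongr
  have h2 : Real.exp (16 ^ Fintype.card S / w) ≤ Real.exp (16 ^ s₀ / w) := by
    gcongr
    norm_num
  linarith

end SieveForms

section SieveNorm

/-- The primes in the interval `(w, R]`. -/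
def primesIoc (w R : ℕ) : Finset ℕ := (Finset.Ioc w R).filter Nat.Prime

theorem mem_primesIoc {w R p : ℕ} : p ∈ primesIoc w R ↔ w < p ∧ p ≤ R ∧ p.Prime := by
  rw [primesIoc, Finset.mem_filter, Finset.mem_Ioc, and_assoc]

theorem sum_one_div_le_prod {s A : Finset ℕ} (hs : ∀ p ∈ s, p.Prime)
    (hA : ∀ n ∈ A, n ∈ Nat.factoredNumbers s) :
    ∑ n ∈ A, (n : ℝ)⁻¹ ≤ ∏ p ∈ s, (1 - (p : ℝ)⁻¹)⁻¹ := by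
  set f : ℕ →* ℝ := ⟨⟨fun n => (n : ℝ)⁻¹, by simp⟩, fun m n => by push_cast; rw [mul_inv]⟩
  have hf : ∀ {p : ℕ}, p.Prime → ‖f p‖ < 1 := fun {p} hp => by
    change ‖(p : ℝ)⁻¹‖ < 1
    rw [Real.norm_of_nonneg (by positivity)]
    exact inv_lt_one_of_one_lt₀ (mod_cast hp.one_lt)
  have key := (EulerProduct.summable_and_hasSum_factoredNumbers_prod_filter_prime_geometric hf s).2
  rw [Finset.filter_true_of_mem hs] at key
  have := sum_le_hasSum (A.subtype (· ∈ Nat.factoredNumbers s))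
    (fun i _ => inv_nonneg.2 (Nat.cast_nonneg (i : ℕ))) key
  refine le_trans (le_of_eq ?_) this
  exact (Finset.sum_subtype_of_mem (fun n : ℕ => (n : ℝ)⁻¹) hA).symm

theorem inv_mul_inv_one_sub_inv {p : ℕ} (hp : p.Prime) :
    (p : ℝ)⁻¹ * (1 - (p : ℝ)⁻¹)⁻¹ = 1 / ((p : ℝ) - 1) := by
  have : (p : ℝ) ≠ 0 := mod_cast hp.ne_zero
  have : (p : ℝ) - 1 ≠ 0 := sub_ne_zero.2 (mod_cast hp.one_lt.ne')
  field_simp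

/-- The standard lower bound for the normalising factor of the Selberg weight. -/
theorem log_le_mul_sieveNorm (w R : ℕ) :
    Real.log R ≤ (∏ p ∈ primesIoc 0 w, (1 - (p : ℝ)⁻¹)⁻¹) * sieveNorm (primesIoc w R) R := by
  have hpr : ∀ n ∈ Finset.Icc 1 R,
      n.primeFactors.filter (w < ·) ∈ sieveFamily (primesIoc w R) R := by
    intro n hn
    rw [Finset.mem_Icc] at hn
    refine Finset.mem_filter.2 ⟨Finset.mem_powerset.2 fun p hp => ?_, ?_⟩
    · rw [Finset.mem_filter, Nat.mem_primeFactors] at hp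
      exact mem_primesIoc.2 ⟨hp.2, (Nat.le_of_dvd (by omega) hp.1.2.1).trans hn.2, hp.1.1⟩
    · refine le_trans (Nat.le_of_dvd (by omega) ?_) hn.2
      exact (Finset.prod_dvd_prod_of_subset _ _ _ (Finset.filter_subset _ _)).trans
        (Nat.prod_primeFactors_dvd n)
  have h0 : Real.log R ≤ ∑ n ∈ Finset.Icc 1 R, (n : ℝ)⁻¹ := by
    have := log_le_harmonic_floor R (Nat.cast_nonneg R)
    rw [Nat.floor_natCast, harmonic_eq_sum_Icc] at this
    refine this.trans (le_of_eq ?_)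
    push_cast
    rfl
  refine h0.trans ?_
  rw [← Finset.sum_fiberwise_of_maps_to hpr, sieveNorm, Finset.mul_sum]
  refine Finset.sum_le_sum fun F hF => ?_
  have hFp : ∀ p ∈ F, w < p ∧ p ≤ R ∧ p.Prime := fun p hp =>
    mem_primesIoc.1 (subset_of_mem_sieveFamily hF hp)
  have hdisj : Disjoint (primesIoc 0 w) F := Finset.disjoint_left.2 fun p hp hp' => by
    have := (mem_primesIoc.1 hp).2.1
    have := (hFp p hp').1
    omega
  have hdvd : ∀ n ∈ (Finset.Icc 1 R).filter (fun n => n.primeFactors.filter (w < ·) = F),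
      ∏ p ∈ F, p ∣ n ∧ n ≠ 0 ∧ n.primeFactors ⊆ primesIoc 0 w ∪ F := by
    intro n hn
    obtain ⟨hnR, rfl⟩ := Finset.mem_filter.1 hn
    rw [Finset.mem_Icc] at hnR
    refine ⟨(Finset.prod_dvd_prod_of_subset _ _ _ (Finset.filter_subset _ _)).trans
        (Nat.prod_primeFactors_dvd n), by omega, fun p hp => ?_⟩
    rw [Finset.mem_union, Finset.mem_filter, mem_primesIoc]
    have := Nat.prime_of_mem_primeFactors hp
    rcases lt_or_ge w p with h | h
    · exact .inr ⟨hp, h⟩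
    · exact .inl ⟨this.pos, h, this⟩
  have hF0 : 0 < ∏ p ∈ F, p := Finset.prod_pos fun p hp => (hFp p hp).2.2.pos
  calc _ = ∑ n ∈ ((Finset.Icc 1 R).filter (fun n => n.primeFactors.filter (w < ·) = F)).image
        (· / ∏ p ∈ F, p), (∏ p ∈ F, (p : ℝ)⁻¹) * (n : ℝ)⁻¹ := by
        rw [Finset.sum_image]
        · refine Finset.sum_congr rfl fun n hn => ?_
          obtain ⟨m, rfl⟩ := (hdvd n hn).1
          rw [Nat.mul_div_cancel_left _ hF0]
          push_cast
          rw [mul_inv, Finset.prod_inv_distrib]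
        · intro n hn n' hn' h
          exact (Nat.div_left_inj (hdvd n hn).1 (hdvd n' hn').1).1 h
    _ ≤ (∏ p ∈ F, (p : ℝ)⁻¹) * ∏ p ∈ primesIoc 0 w ∪ F, (1 - (p : ℝ)⁻¹)⁻¹ := by
        rw [← Finset.mul_sum]
        refine mul_le_mul_of_nonneg_left (sum_one_div_le_prod (fun p hp => ?_) fun n hn => ?_)
          (Finset.prod_nonneg fun p _ => by positivity)
        · rcases Finset.mem_union.1 hp with h | h
          · exact (mem_primesIoc.1 h).2.2
          · exact (hFp p h).2.2
        · obtain ⟨m, hm, rfl⟩ := Finset.mem_image.1 hn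
          obtain ⟨h1, h2, h3⟩ := hdvd m hm
          exact Nat.mem_factoredNumbers_of_dvd (Nat.mem_factoredNumbers_of_primeFactors_subset h2 h3)
            (Nat.div_dvd_of_dvd h1)
    _ = _ := by
        rw [Finset.prod_union hdisj, mul_left_comm, ← Finset.prod_mul_distrib]
        congr 1
        exact Finset.prod_congr rfl fun p hp => inv_mul_inv_one_sub_inv (hFp p hp).2.2

theorem sieveNorm_le {𝒬 : Finset ℕ} {R : ℕ} (h𝒬 : ∀ p ∈ 𝒬, p.Prime) : sieveNorm 𝒬 R ≤ R := by
  calc _ ≤ ∑ F ∈ sieveFamily 𝒬 R, (1 : ℝ) := by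
        refine Finset.sum_le_sum fun F hF => Finset.prod_le_one (fun p hp => ?_) fun p hp => ?_
        · exact one_div_sub_one_nonneg h𝒬 (subset_of_mem_sieveFamily hF hp)
        · have : (2 : ℝ) ≤ p := mod_cast (h𝒬 p (subset_of_mem_sieveFamily hF hp)).two_le
          rw [div_le_one (by linarith)]
          linarith
    _ ≤ R := by
        rw [Finset.sum_const, nsmul_eq_mul, mul_one]
        exact_mod_cast card_sieveFamily_le h𝒬

theorem sieveWeight_nonneg {𝒬 : Finset ℕ} {R : ℕ} (h𝒬 : ∀ p ∈ 𝒬, p.Prime) (hR : 1 ≤ R) (n : ℕ) :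
    0 ≤ sieveWeight 𝒬 R n :=
  div_nonneg (sq_nonneg _) (zero_le_one.trans (one_le_sieveNorm h𝒬 hR))

theorem sieveWeight_eq_sieveNorm {𝒬 : Finset ℕ} {R n : ℕ}
    (hn : ∀ p ∈ 𝒬, ¬ p ∣ n) : sieveWeight 𝒬 R n = sieveNorm 𝒬 R := by
  have : ∑ F ∈ sieveFamily 𝒬 R, ∏ p ∈ F, ramanujanWeight p (p ∣ n) = sieveNorm 𝒬 R := by
    refine Finset.sum_congr rfl fun F hF => Finset.prod_congr rfl fun p hp => ?_
    simp [ramanujanWeight, hn p (subset_of_mem_sieveFamily hF hp), ind]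
  rw [sieveWeight, this, sq, mul_self_div_self]

/-- The Euler factor of a primorial. -/
theorem prod_inv_one_sub_inv_eq (w : ℕ) :
    ∏ p ∈ primesIoc 0 w, (1 - (p : ℝ)⁻¹)⁻¹ =
      (∏ p ∈ primesIoc 0 w, p : ℕ) / (Nat.totient (∏ p ∈ primesIoc 0 w, p) : ℝ) := by
  have hp : ∀ p ∈ primesIoc 0 w, p.Prime := fun p hp => (mem_primesIoc.1 hp).2.2
  have := Nat.totient_eq_mul_prod_factors (∏ p ∈ primesIoc 0 w, p)
  rw [Nat.primeFactors_prod hp] at this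
  have h := congrArg (Rat.cast : ℚ → ℝ) this
  push_cast at h
  rw [h, Finset.prod_inv_distrib]
  have : (∏ p ∈ primesIoc 0 w, (p : ℝ)) ≠ 0 :=
    Finset.prod_ne_zero_iff.2 fun p h => Nat.cast_ne_zero.2 (hp p h).ne_zero
  push_cast
  rw [div_mul_eq_div_div, div_self this, one_div]

end SieveNorm

section ShortIntervals

/-- Progressions modulo `N` of small residues are progressions of integers. -/
theorem exists_progression_of_zmod {N k : ℕ} [NeZero N] (hk : 2 ≤ k) {P : ℕ → Prop}
    (hP : ∀ x, P x → 2 * x < N) {a d : ZMod N} (hd : d ≠ 0)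
    (h : ∀ j < k, P (a + (j : ZMod N) * d).val) :
    ∃ m e : ℕ, 0 < e ∧ ∀ i < k, P (m + i * e) := by
  set u : ℕ → ℕ := fun j => (a + (j : ZMod N) * d).val
  have hu : ∀ j, ((u j : ℕ) : ZMod N) = a + (j : ZMod N) * d := fun j => ZMod.natCast_zmod_val _
  have hlt : ∀ j < k, 2 * u j < N := fun j hj => hP _ (h j hj)
  have hstep : ∀ j, j + 1 < k → (u (j + 1) : ℤ) = u j + (u 1 - u 0) := by
    intro j hj
    have hmod : (((u (j + 1) : ℤ) - (u j + (u 1 - u 0)) : ℤ) : ZMod N) = 0 := by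
      push_cast
      simp only [hu]
      push_cast
      ring
    have h1 := hlt (j + 1) hj
    have h2 := hlt j (by omega)
    have h3 := hlt 1 (by omega)
    have h4 := hlt 0 (by omega)
    have := Int.eq_zero_of_abs_lt_dvd ((ZMod.intCast_zmod_eq_zero_iff_dvd _ N).1 hmod)
      (by rw [abs_lt]; omega)
    omega
  have hlin : ∀ j, j < k → (u j : ℤ) = u 0 + j * (u 1 - u 0) := by
    intro j
    induction j with
    | zero => simp
    | succ j ih =>
      intro hj
      rw [hstep j hj, ih (by omega)]
      push_cast
      ring
  have hne : u 1 ≠ u 0 := by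
    intro h
    have := hu 1
    rw [h, hu 0] at this
    simp only [Nat.cast_zero, zero_mul, add_zero, Nat.cast_one, one_mul] at this
    exact hd (by simpa using this)
  rcases lt_or_gt_of_ne hne with hlt | hlt
  · refine ⟨u (k - 1), u 0 - u 1, by omega, fun i hi => ?_⟩
    have : u (k - 1) + i * (u 0 - u 1) = u (k - 1 - i) := by
      obtain ⟨t, ht⟩ : ∃ t, k - 1 = i + t := ⟨k - 1 - i, by omega⟩
      zify [hlt.le]
      rw [hlin (k - 1) (by omega), hlin (k - 1 - i) (by omega), ht, Nat.add_sub_cancel_left]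
      push_cast
      ring
    rw [this]
    exact h _ (by omega)
  · refine ⟨u 0, u 1 - u 0, by omega, fun i hi => ?_⟩
    have : u 0 + i * (u 1 - u 0) = u i := by
      zify [hlt.le]
      rw [hlin i hi]
    rw [this]
    exact h _ hi

/-- If the average over progressions is large, some nontrivial progression contributes. -/
theorem exists_progression_pos {N k : ℕ} [NeZero N] {f : ZMod N → ℝ} {G c : ℝ}
    (hf : ∀ x, 0 ≤ f x) (hfG : ∀ x, f x ≤ G)
    (hc : c ≤ avg fun a => avg fun d => ∏ j : Fin k, f (a + (j : ℕ) * d)) (hG : G ^ k < c * N) :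
    ∃ a d, d ≠ 0 ∧ ∀ j < k, 0 < f (a + (j : ZMod N) * d) := by
  by_contra! hcon
  have hN : (0 : ℝ) < N := mod_cast Nat.pos_of_ne_zero (NeZero.ne N)
  have h0 : ∀ a, (avg fun d => ∏ j : Fin k, f (a + (j : ℕ) * d)) ≤ G ^ k / N := by
    intro a
    rw [avg_eq_sum, ZMod.card]
    gcongr
    rw [Finset.sum_eq_single 0]
    · calc _ ≤ ∏ _j : Fin k, G := Finset.prod_le_prod (fun _ _ => hf _) fun _ _ => hfG _
        _ = _ := by simp
    · intro d _ hd
      obtain ⟨j, hj, hj'⟩ := hcon a d hd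
      exact Finset.prod_eq_zero (Finset.mem_univ ⟨j, hj⟩) (le_antisymm hj' (hf _))
    · simp
  have := hc.trans (avg_le_of_le h0)
  rw [le_div_iff₀ hN] at this
  linarith

open Classical in
/-- Some reduced residue class contains its share of a set of integers coprime to `W`. -/
theorem exists_residue_class {W : ℕ} (hW : 0 < W) (A : ℕ) {Q : Finset ℕ}
    (hQ : ∀ p ∈ Q, p.Coprime W ∧ A ≤ p) :
    ∃ B, A < B + W ∧
      (Q.card : ℝ) / W.totient ≤ (Q.filter fun p => ∃ x, p = W * x + B).card := by
  have hφ : (0 : ℝ) < W.totient := mod_cast Nat.totient_pos.2 hW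
  have hmaps : ∀ p ∈ Q, p % W ∈ (Finset.range W).filter W.Coprime := by
    intro p hp
    refine Finset.mem_filter.2 ⟨Finset.mem_range.2 (Nat.mod_lt _ hW), ?_⟩
    have := (hQ p hp).1
    rw [Nat.Coprime, Nat.gcd_comm, Nat.gcd_rec] at this
    rw [Nat.Coprime, Nat.gcd_comm]
    exact this
  have hne : ((Finset.range W).filter W.Coprime).Nonempty :=
    Finset.card_pos.1 (Nat.totient_pos.2 hW)
  have hcard : ((Finset.range W).filter W.Coprime).card • ((Q.card : ℝ) / W.totient) ≤ Q.card := by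
    rw [nsmul_eq_mul]
    exact (mul_div_cancel₀ _ hφ.ne').le
  obtain ⟨b, -, hb⟩ := Finset.exists_le_card_fiber_of_nsmul_le_card_of_maps_to hmaps hne hcard
  refine ⟨W * (A / W) + b, ?_, hb.trans (Nat.cast_le.2 (Finset.card_le_card fun p hp => ?_))⟩
  · have := Nat.div_add_mod A W
    have := Nat.mod_lt A hW
    omega
  · obtain ⟨hpQ, rfl⟩ := Finset.mem_filter.1 hp
    refine Finset.mem_filter.2 ⟨hpQ, p / W - A / W, ?_⟩
    have h1 : A / W ≤ p / W := Nat.div_le_div_right (hQ p hpQ).2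
    obtain ⟨t, ht⟩ := Nat.exists_eq_add_of_le h1
    have h2 := Nat.div_add_mod p W
    rw [ht, Nat.add_sub_cancel_left]
    rw [ht, Nat.mul_add] at h2
    omega

theorem exists_coprime_factorial_between (n : ℕ) {Y : ℝ} (hY : (n.factorial : ℝ) + 1 ≤ Y) :
    ∃ N : ℕ, N.Coprime n.factorial ∧ 2 * Y + 2 ≤ N ∧ N ≤ 4 * Y := by
  have hn : (0 : ℝ) < n.factorial := mod_cast n.factorial_pos
  have hY0 : 0 ≤ Y := by linarith
  refine ⟨n.factorial * ⌊3 * Y / n.factorial⌋₊ + 1, by simp, ?_, ?_⟩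
  · have := Nat.lt_floor_add_one (3 * Y / n.factorial)
    rw [div_lt_iff₀ hn] at this
    push_cast
    nlinarith
  · have := Nat.floor_le (a := 3 * Y / n.factorial) (by positivity)
    rw [le_div_iff₀ hn] at this
    push_cast
    nlinarith

theorem eventually_level {α : ℝ} (hα0 : 0 < α) (hα1 : α < 1) :
    ∀ᶠ M : ℝ in Filter.atTop, 1 ≤ ⌊M ^ α⌋₊ ∧ (⌊M ^ α⌋₊ : ℝ) < M ∧
      α / 2 * Real.log M ≤ Real.log ⌊M ^ α⌋₊ := by
  filter_upwards [(tendsto_rpow_atTop (half_pos hα0)).eventually_ge_atTop 2,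
    Filter.eventually_gt_atTop 1] with M h2 hM
  have hM0 : 0 < M := by linarith
  have hsq : M ^ α = M ^ (α / 2) * M ^ (α / 2) := by rw [← Real.rpow_add hM0]; ring_nf
  have hfl := Nat.lt_floor_add_one (M ^ α)
  have hlow : M ^ (α / 2) ≤ ⌊M ^ α⌋₊ := by nlinarith
  refine ⟨?_, ?_, ?_⟩
  · have : (1 : ℝ) ≤ ⌊M ^ α⌋₊ := by linarith
    exact_mod_cast this
  · refine (Nat.floor_le (by positivity)).trans_lt ?_
    simpa using Real.rpow_lt_rpow_of_exponent_lt hM hα1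
  · rw [← Real.log_rpow hM0]
    exact Real.log_le_log (by positivity) hlow

theorem card_div_le_avg_ind {N W B : ℕ} [NeZero N] {Q : Finset ℕ} {P : ℕ → Prop}
    (hQ : ∀ p ∈ Q, ∃ x, p = W * x + B ∧ P x) (hP : ∀ x, P x → x < N) :
    (Q.card : ℝ) / N ≤ avg fun x : ZMod N => ind (P x.val) := by
  classical
  rw [avg_eq_sum, ZMod.card]
  gcongr
  have : ∑ x : ZMod N, ind (P x.val) = (Finset.univ.filter fun x : ZMod N => P x.val).card := by
    rw [Finset.natCast_card_filter]
    exact Finset.sum_congr rfl fun x _ => by simp [ind]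
  rw [this]
  choose! g hg using hQ
  have hval : ∀ p ∈ Q, ((g p : ℕ) : ZMod N).val = g p := fun p hp =>
    ZMod.val_cast_of_lt (hP _ (hg p hp).2)
  refine Nat.cast_le.2 (Finset.card_le_card_of_injOn (fun p => ((g p : ℕ) : ZMod N))
    (fun p hp => ?_) fun p hp p' hp' h => ?_)
  · simpa [hval p hp] using (hg p hp).2
  · have := congrArg ZMod.val h
    simp only at this
    rw [hval p hp, hval p' hp'] at this
    rw [(hg p hp).1, (hg p' hp').1, this]

/-- A dense set of primes in a short interval contains progressions, given suitable parameters. -/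
theorem exists_prime_progression {r w R N : ℕ} [NeZero N] {c C ε δ₀ M L : ℝ} {m : ℕ}
    (hrel : ∀ ν f : ZMod N → ℝ, (∀ x, 0 ≤ f x) → (∀ x, f x ≤ ν x) → δ₀ ≤ avg f →
      LinearFormsCondition (fun (j : Fin (r + 2)) x => ν (apForm N j x)) ε →
      c ≤ avg fun a => avg fun d => ∏ j : Fin (r + 2), f (a + (j : ℕ) * d))
    (hform : ∀ (𝒬 : Finset ℕ) (R W B : ℕ), (∀ p ∈ 𝒬, p.Prime ∧ w < p ∧ p.Coprime W) → 1 ≤ R →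
      C * R ^ m ≤ N → LinearFormsCondition
        (fun (j : Fin (r + 2)) x => sieveWeight 𝒬 R (W * (apForm N j x).val + B)) ε)
    {W : ℕ} (hW : W = ∏ p ∈ primesIoc 0 w, p) (hR : 1 ≤ R) (hRM : R < M) (hwM : w < M)
    (hCR : C * R ^ m ≤ N) (hcR : (R : ℝ) ^ (r + 2) < c * N) (hN : 2 * (L / W) + 2 ≤ N)
    (hcard : δ₀ * (N * W) ≤ Real.log R *
      ({p : ℕ | p.Prime ∧ M ≤ (p : ℝ) ∧ (p : ℝ) ≤ M + L}.ncard : ℝ)) :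
    ∃ (m d : ℕ), 0 < d ∧ ∀ i : ℕ, i < r + 2 → Nat.Prime (m + i * d) ∧
      M ≤ ((m + i * d : ℕ) : ℝ) ∧ ((m + i * d : ℕ) : ℝ) ≤ M + L := by
  classical
  have hM0 : 0 < M := (Nat.cast_nonneg w).trans_lt hwM
  have hWp : ∀ p ∈ primesIoc 0 w, p.Prime := fun p hp => (mem_primesIoc.1 hp).2.2
  have hW0 : 0 < W := hW ▸ Finset.prod_pos fun p hp => (hWp p hp).pos
  have hcopW : ∀ p : ℕ, p.Prime → w < p → p.Coprime W := fun p hp hwp => by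
    rw [hW]
    refine Nat.Coprime.prod_right fun q hq => (Nat.coprime_primes hp (hWp q hq)).2 ?_
    have := (mem_primesIoc.1 hq).2.1
    omega
  have hN0 : (0 : ℝ) < N := mod_cast Nat.pos_of_ne_zero (NeZero.ne N)
  have hfin : {p : ℕ | p.Prime ∧ M ≤ (p : ℝ) ∧ (p : ℝ) ≤ M + L}.Finite :=
    (Set.finite_Iic ⌊M + L⌋₊).subset fun p hp => Nat.le_floor hp.2.2
  set Q := hfin.toFinset
  have hQ : ∀ p, p ∈ Q ↔ p.Prime ∧ M ≤ (p : ℝ) ∧ (p : ℝ) ≤ M + L := fun p => hfin.mem_toFinset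
  rw [Set.ncard_eq_toFinset_card _ hfin] at hcard
  obtain ⟨B, hAB, hB⟩ := exists_residue_class hW0 ⌊M⌋₊ (Q := Q) fun p hp => by
    have h := (hQ p).1 hp
    exact ⟨hcopW p h.1 (by exact_mod_cast hwM.trans_le h.2.1), Nat.floor_le_of_le h.2.1⟩
  set P : ℕ → Prop := fun x => W * x + B ∈ Q
  have hPlt : ∀ x, P x → 2 * x < N := by
    intro x hx
    have h1 := ((hQ _).1 hx).2.2
    have h2 : M < B + W := (Nat.lt_floor_add_one M).trans_le (mod_cast hAB)
    push_cast at h1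
    have hW0' : (0 : ℝ) < W := mod_cast hW0
    have h3 : (x : ℝ) < L / W + 1 := by
      rw [← sub_lt_iff_lt_add, lt_div_iff₀ hW0']
      nlinarith
    have : (2 * x : ℝ) < N := by linarith
    exact_mod_cast this
  set 𝒬 := primesIoc w R
  have h𝒬 : ∀ p ∈ 𝒬, p.Prime := fun p hp => (mem_primesIoc.1 hp).2.2
  set G := sieveNorm 𝒬 R
  have hG1 : 1 ≤ G := one_le_sieveNorm h𝒬 hR
  set ν : ZMod N → ℝ := fun x => sieveWeight 𝒬 R (W * x.val + B)
  set f : ZMod N → ℝ := fun x => G * ind (P x.val)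
  have hf : ∀ x, 0 ≤ f x := fun x => mul_nonneg (by linarith) (ind_nonneg _)
  have hfν : ∀ x, f x ≤ ν x := by
    intro x
    by_cases hx : P x.val
    · have hp := (hQ _).1 hx
      simp only [f, ν, ind_of_true hx, mul_one]
      refine (sieveWeight_eq_sieveNorm fun p hp𝒬 hdvd => ?_).ge
      have hpR := mem_primesIoc.1 hp𝒬
      rw [(Nat.prime_dvd_prime_iff_eq hpR.2.2 hp.1).1 hdvd] at hpR
      have : (R : ℝ) < R := (hRM.trans_le hp.2.1).trans_le (mod_cast hpR.2.1)
      exact lt_irrefl _ this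
    · simp only [f, ind_of_false hx, mul_zero]
      exact sieveWeight_nonneg h𝒬 hR _
  have havg : δ₀ ≤ avg f := by
    have h1 := card_div_le_avg_ind (N := N) (W := W) (B := B) (P := P)
      (Q := Q.filter fun p => ∃ x, p = W * x + B) (fun p hp => by
        obtain ⟨hp, x, rfl⟩ := Finset.mem_filter.1 hp
        exact ⟨x, rfl, hp⟩) fun x hx => by have := hPlt x hx; omega
    have hφ : (0 : ℝ) < W.totient := mod_cast Nat.totient_pos.2 hW0
    have hlog : Real.log R ≤ W / W.totient * G := by
      have := log_le_mul_sieveNorm w R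
      rwa [prod_inv_one_sub_inv_eq, ← hW] at this
    have hW0' : (0 : ℝ) < W := mod_cast hW0
    rw [avg_mul_left]
    calc δ₀ ≤ Real.log R * Q.card / (N * W) := by rwa [le_div_iff₀ (by positivity)]
      _ ≤ W / W.totient * G * Q.card / (N * W) := by gcongr
      _ = G * (Q.card / W.totient / N) := by field_simp
      _ ≤ G * avg fun x : ZMod N => ind (P x.val) := by
          gcongr
          exact le_trans (by gcongr) h1
  have hc := hrel ν f hf hfν havg (hform 𝒬 R W B (fun p hp => ⟨h𝒬 p hp, (mem_primesIoc.1 hp).1,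
    hcopW p (h𝒬 p hp) (mem_primesIoc.1 hp).1⟩) hR hCR)
  obtain ⟨a, d, hd, had⟩ := exists_progression_pos hf (G := G)
    (fun x => mul_le_of_le_one_right (by linarith) (ind_le_one _)) hc
    ((pow_le_pow_left₀ (by linarith) (sieveNorm_le h𝒬) _).trans_lt hcR)
  obtain ⟨u, e, he, hue⟩ := exists_progression_of_zmod (k := r + 2) (a := a) (by omega) hPlt hd
    fun j hj => by
      by_contra h
      have := had j hj
      simp only [f, ind_of_false h, mul_zero, lt_irrefl] at this
  refine ⟨W * u + B, W * e, Nat.mul_pos hW0 he, fun i hi => ?_⟩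
  have := (hQ _).1 (hue i hi)
  rwa [show W * (u + i * e) + B = W * u + B + i * (W * e) by ring] at this

end ShortIntervals

/-- **The Green–Tao theorem for short intervals: conditional strong form.**
Assume the primes have positive density in all short intervals `[M, M + M^a]`.  Then for every
`k ≥ 3`, every sufficiently long such interval contains an arithmetic progression of primes of
length `k`. -/
theorem green_tao_short_intervals
    (a δ : ℝ) (ha0 : 0 < a) (ha1 : a < 1) (hδ : 0 < δ)
    (hPNT : ∃ M₁ : ℝ, ∀ M : ℝ, M₁ ≤ M →
      δ * M ^ a / Real.log M ≤
        (({p : ℕ | Nat.Prime p ∧ M ≤ (p : ℝ) ∧ (p : ℝ) ≤ M + M ^ a}).ncard : ℝ)) :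
    ∀ k : ℕ, 3 ≤ k →
      ∃ M₀ : ℕ, 0 < M₀ ∧
        ∀ M : ℝ, (M₀ : ℝ) ≤ M →
          ∃ (m d : ℕ), 0 < d ∧
            ∀ i : ℕ, i < k →
              Nat.Prime (m + i * d) ∧
              M ≤ ((m + i * d : ℕ) : ℝ) ∧ ((m + i * d : ℕ) : ℝ) ≤ M + M ^ a := by
  intro k hk
  obtain ⟨r, rfl⟩ : ∃ r, k = r + 2 := ⟨k - 2, by omega⟩
  obtain ⟨m, hm⟩ := exists_linearFormsCondition_sieveWeight r
  set q : ℕ := m + (r + 2)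
  have hq : (1 : ℝ) ≤ q := by exact_mod_cast (by omega : 1 ≤ q)
  set α : ℝ := a / (2 * q)
  have hα0 : 0 < α := by positivity
  have hα1 : α < 1 := by
    rw [div_lt_one (by positivity)]
    linarith
  have hδ₀ : 0 < δ * α / 8 := by positivity
  obtain ⟨n, hn, c, hc, ε, hε, hrel⟩ := relative_szemeredi r hδ₀
  obtain ⟨w, C, hC, hform⟩ := hm ε hε
  set W : ℕ := ∏ p ∈ primesIoc 0 w, p with hW
  have hW0 : (0 : ℝ) < W := mod_cast Finset.prod_pos fun p hp => (mem_primesIoc.1 hp).2.2.pos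
  obtain ⟨M₁, hM₁⟩ := hPNT
  have hev : ∀ᶠ M : ℝ in Filter.atTop, ∃ (m d : ℕ), 0 < d ∧ ∀ i : ℕ, i < r + 2 →
      Nat.Prime (m + i * d) ∧ M ≤ ((m + i * d : ℕ) : ℝ) ∧ ((m + i * d : ℕ) : ℝ) ≤ M + M ^ a := by
    filter_upwards [Filter.eventually_ge_atTop M₁, Filter.eventually_gt_atTop (w : ℝ),
      Filter.eventually_gt_atTop 1, eventually_level hα0 hα1,
      (tendsto_rpow_atTop ha0).eventually_ge_atTop ((n.factorial + 1) * W),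
      (tendsto_rpow_atTop (half_pos ha0)).eventually_ge_atTop (C * W),
      (tendsto_rpow_atTop (half_pos ha0)).eventually_ge_atTop (W / c)]
      with M hMM hwM hM1 hlev hfac hCW hcW
    obtain ⟨hR1, hRM, hRlog⟩ := hlev
    set R := ⌊M ^ α⌋₊
    have hM0 : 0 < M := by linarith
    have hlogM : 0 < Real.log M := Real.log_pos hM1
    have hsq : M ^ a = M ^ (a / 2) * M ^ (a / 2) := by rw [← Real.rpow_add hM0]; ring_nf
    have hpos : 0 < M ^ (a / 2) := by positivity
    obtain ⟨N, hN, hN1, hN2⟩ := exists_coprime_factorial_between n (Y := M ^ a / W)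
      ((le_div_iff₀ hW0).2 hfac)
    have hMa : 0 < M ^ a / W := by positivity
    have hN0 : N ≠ 0 := by
      rintro rfl
      rw [Nat.cast_zero] at hN1
      linarith
    have : NeZero N := ⟨hN0⟩
    have hMN : M ^ a ≤ N * W := by
      rw [← div_le_iff₀ hW0]
      linarith
    have hR1' : (1 : ℝ) ≤ R := mod_cast hR1
    have hRq : (R : ℝ) ^ q ≤ M ^ (a / 2) := by
      calc (R : ℝ) ^ q ≤ (M ^ α) ^ q := by
            gcongr
            exact Nat.floor_le (by positivity)
        _ = M ^ (a / 2) := by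
            rw [← Real.rpow_natCast, ← Real.rpow_mul hM0.le]
            congr 1
            simp only [α]
            field_simp
    refine exists_prime_progression (hrel N hN) (fun 𝒬 R W B h1 h2 h3 => hform 𝒬 R N W B h1 h2
      (hN.coprime_dvd_right (Nat.factorial_dvd_factorial hn)) h3) hW hR1 hRM hwM ?_ ?_ hN1 ?_
    · have h1 : (R : ℝ) ^ m ≤ M ^ (a / 2) := (pow_le_pow_right₀ hR1' (by omega)).trans hRq
      refine le_of_mul_le_mul_right ?_ hW0
      calc C * R ^ m * W = C * W * R ^ m := by ring
        _ ≤ M ^ (a / 2) * M ^ (a / 2) := by gcongr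
        _ ≤ _ := by rwa [← hsq]
    · have h1 : (R : ℝ) ^ (r + 2) ≤ M ^ (a / 2) := (pow_le_pow_right₀ hR1' (by omega)).trans hRq
      refine h1.trans_lt ?_
      rw [div_le_iff₀ hc] at hcW
      have h2 : M ^ (a / 2) * W ≤ M ^ a * c := by rw [hsq]; nlinarith
      have h3 : M ^ (a / 2) ≤ c * (M ^ a / W) := by
        rw [← mul_div_assoc, le_div_iff₀ hW0]
        linarith
      nlinarith
    · refine le_trans ?_ (mul_le_mul hRlog (hM₁ M hMM) (by positivity) (by linarith [mul_pos hα0 hlogM]))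
      have h1 : (N : ℝ) * W ≤ 4 * M ^ a := by
        calc (N : ℝ) * W ≤ 4 * (M ^ a / W) * W := by gcongr
          _ = _ := by field_simp
      calc δ * α / 8 * (N * W) ≤ δ * α / 8 * (4 * M ^ a) := by gcongr
        _ = _ := by field_simp; ring
  obtain ⟨M', hM'⟩ := Filter.eventually_atTop.1 hev
  refine ⟨⌈M'⌉₊ + 1, by omega, fun M hM => hM' M ?_⟩
  have := Nat.le_ceil M'
  push_cast at hM
  linarith
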